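/- There exists n₀ ∈ ℕ such that for every odd integer n ≥ n₀ and every integer r ≥ 2, there are uncountably many pairwise non-isomorphic n-periodic groups of rank r (i.e. generated by r elements and not fewer). -/

import Mathlib

open scoped Classical

noncomputable section

universe u u' v w v' w'

/-! ## Words over an alphabet -/

/-- A word over the alphabet `S`: a list of letters together with exponents `±1`. -/
abbrev Word (S : Type u) := List (S × Bool)

namespace Word

variable {S : Type u}

/-- The formal inverse of a word. -/
def inv (w : Word S) : Word S := (w.map fun a => (a.1, !a.2)).reverse

/-- A word is reduced if it contains no cancelling adjacent pair. -/
def IsReduced (w : Word S) : Prop :=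
  List.Chain' (fun a b => ¬(a.1 = b.1 ∧ b.2 = !a.2)) w

/-- A word is cyclically reduced if its square is reduced. -/
def IsCyclicallyReduced (w : Word S) : Prop := IsReduced (w ++ w)

/-- `c` is a cyclic conjugate of `w` if it is obtained from `w` by rotation. -/
def IsCyclicConjugate (w c : Word S) : Prop := ∃ k, c = w.rotate k

/-- The `k`-th power of a word. -/
def pow (w : Word S) : ℕ → Word S
  | 0 => []
  | k + 1 => w ++ pow w k

end Word

/-! ## Burnside quotients, bundled groups and word metrics -/

/-- The (normal) subgroup of `G` generated by all `n`-th powers. -/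
def powerSubgroup (G : Type v) [Group G] (n : ℕ) : Subgroup G :=
  Subgroup.normalClosure { g : G | ∃ x : G, g = x ^ n }

instance powerSubgroup_normal (G : Type v) [Group G] (n : ℕ) :
    (powerSubgroup G n).Normal :=
  Subgroup.normalClosure_normal

/-- The quotient `G/G^n` of `G` by the normal subgroup generated by `n`-th powers. -/
abbrev BurnsideQuotient (G : Type v) [Group G] (n : ℕ) : Type v :=
  G ⧸ powerSubgroup G n

/-- A bundled group. -/
structure GrpB : Type 1 where
  carrier : Type
  [str : Group carrier]

attribute [instance] GrpB.str

instance : CoeSort GrpB Type := ⟨GrpB.carrier⟩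

def GrpB.of (G : Type) [Group G] : GrpB := ⟨G⟩

/-- The word metric on a group `G` associated with a (symmetrized) generating set `A`. -/
def wordDist {G : Type v} [Group G] (A : Set G) (g h : G) : ℝ :=
  sInf { r : ℝ | ∃ l : List G, (∀ a ∈ l, a ∈ A ∨ a⁻¹ ∈ A) ∧ g⁻¹ * h = l.prod ∧
    r = l.length }

/-- The left multiplication action of a group on itself. -/
def leftTransl {G : Type v} [Group G] : G → G → G := fun g x => g * x

/-! ## Labelled graphs (graphs in the sense of Serre with labelling) -/

structure LabGraph (S : Type u) where
  /-- vertices -/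
  V : Type v
  /-- (oriented) edges -/
  E : Type w
  /-- initial vertex -/
  init : E → V
  /-- inversion of edges -/
  bar : E → E
  bar_ne : ∀ e, bar e ≠ e
  bar_bar : ∀ e, bar (bar e) = e
  /-- labelling by `S ⊔ S⁻¹` -/
  label : E → S × Bool
  label_bar_fst : ∀ e, (label (bar e)).1 = (label e).1
  label_bar_snd : ∀ e, (label (bar e)).2 = !(label e).2

namespace LabGraph

variable {S : Type u}

/-- terminal vertex of an edge -/
def term (Γ : LabGraph S) (e : Γ.E) : Γ.V := Γ.init (Γ.bar e)

/-- A path is a list of consecutive edges. -/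
def IsPath (Γ : LabGraph S) (p : List Γ.E) : Prop :=
  List.Chain' (fun e f => Γ.term e = Γ.init f) p

def firstV (Γ : LabGraph S) (p : List Γ.E) : Option Γ.V := p.head?.map Γ.init

def lastV (Γ : LabGraph S) (p : List Γ.E) : Option Γ.V := p.getLast?.map Γ.term

def IsPathFrom (Γ : LabGraph S) (u v : Γ.V) (p : List Γ.E) : Prop :=
  Γ.IsPath p ∧ ((p = [] ∧ u = v) ∨ (Γ.firstV p = some u ∧ Γ.lastV p = some v))

def IsClosedPath (Γ : LabGraph S) (p : List Γ.E) : Prop :=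
  Γ.IsPath p ∧ p ≠ [] ∧ Γ.firstV p = Γ.lastV p

/-- A simple closed path: a closed path visiting no vertex twice. -/
def IsSimpleClosedPath (Γ : LabGraph S) (p : List Γ.E) : Prop :=
  Γ.IsClosedPath p ∧ (p.map Γ.init).Nodup

/-- The label of a path. -/
def wordOf (Γ : LabGraph S) (p : List Γ.E) : Word S := p.map Γ.label

def LabelsPath (Γ : LabGraph S) (w : Word S) : Prop :=
  ∃ p, Γ.IsPath p ∧ Γ.wordOf p = w

def LabelsClosedPath (Γ : LabGraph S) (w : Word S) : Prop :=
  ∃ p, Γ.IsClosedPath p ∧ Γ.wordOf p = w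

def Adj (Γ : LabGraph S) (u v : Γ.V) : Prop := ∃ e, Γ.init e = u ∧ Γ.term e = v

/-- Two vertices are in the same connected component iff they are reachable. -/
def Reachable (Γ : LabGraph S) : Γ.V → Γ.V → Prop := Relation.ReflTransGen Γ.Adj

/-- Label-preserving automorphisms of a labelled graph. -/
structure Aut (Γ : LabGraph S) where
  vmap : Γ.V ≃ Γ.V
  emap : Γ.E ≃ Γ.E
  init_comm : ∀ e, Γ.init (emap e) = vmap (Γ.init e)
  bar_comm : ∀ e, Γ.bar (emap e) = emap (Γ.bar e)
  label_comm : ∀ e, Γ.label (emap e) = Γ.label e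

/-- Label-preserving graph homomorphisms. -/
structure Hom (Γ : LabGraph.{u, v, w} S) (Δ : LabGraph.{u, v', w'} S) where
  vmap : Γ.V → Δ.V
  emap : Γ.E → Δ.E
  init_comm : ∀ e, Δ.init (emap e) = vmap (Γ.init e)
  bar_comm : ∀ e, Δ.bar (emap e) = emap (Γ.bar e)
  label_comm : ∀ e, Δ.label (emap e) = Γ.label e

/-- The connected component of `v₀`, as a labelled graph. -/
def component (Γ : LabGraph S) (v₀ : Γ.V) : LabGraph S where
  V := { v : Γ.V // Γ.Reachable v₀ v }
  E := { e : Γ.E // Γ.Reachable v₀ (Γ.init e) }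
  init e := ⟨Γ.init e.1, e.2⟩
  bar e := ⟨Γ.bar e.1, e.2.tail ⟨e.1, rfl, rfl⟩⟩
  bar_ne e h := Γ.bar_ne e.1 (congrArg Subtype.val h)
  bar_bar e := Subtype.ext (Γ.bar_bar e.1)
  label e := Γ.label e.1
  label_bar_fst e := Γ.label_bar_fst e.1
  label_bar_snd e := Γ.label_bar_snd e.1

/-- A piece: a word labelling two paths of `Γ` which are not identified by any
label-preserving automorphism of `Γ`. -/
def IsPiece (Γ : LabGraph S) (w : Word S) : Prop :=
  ∃ p₁ p₂ : List Γ.E, Γ.IsPath p₁ ∧ Γ.IsPath p₂ ∧ Γ.wordOf p₁ = w ∧ Γ.wordOf p₂ = w ∧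
    ∀ φ : Γ.Aut, p₂ ≠ p₁.map ⇑φ.emap

/-- A labelled graph is reduced if no two distinct edges with the same initial vertex
carry the same label. -/
def Reduced (Γ : LabGraph S) : Prop :=
  ∀ e₁ e₂ : Γ.E, Γ.init e₁ = Γ.init e₂ → Γ.label e₁ = Γ.label e₂ → e₁ = e₂

/-- `w` occurs on the (closed) path `γ`: it labels a subpath of some rotation of `γ`. -/
def OccursOn (Γ : LabGraph S) (w : Word S) (γ : List Γ.E) : Prop :=
  ∃ k, w <:+: Γ.wordOf (γ.rotate k)

/-- The graphical `C'(λ)` small cancellation condition. -/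
def GrSC (Γ : LabGraph S) (lam : ℝ) : Prop :=
  Γ.Reduced ∧
  ∀ γ, Γ.IsSimpleClosedPath γ → ∀ w, Γ.IsPiece w → Γ.OccursOn w γ →
    (w.length : ℝ) < lam * (γ.length : ℝ)

/-- Strongly reduced: no loops, and no closed path labelled `s t⁻¹` for `s ≠ t`. -/
def StronglyReduced (Γ : LabGraph S) : Prop :=
  (∀ e : Γ.E, Γ.init e ≠ Γ.term e) ∧
  ∀ s t : S, s ≠ t → ¬ Γ.LabelsClosedPath [(s, true), (t, false)]

/-- The graphical `C'_n(λ, p)`-condition of Coulon–Gruber. -/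
def GrSCB (Γ : LabGraph S) (n : ℕ) (lam : ℝ) (p : ℕ) : Prop :=
  Γ.StronglyReduced ∧ Γ.GrSC lam ∧
  ∀ w : Word S, Word.IsCyclicallyReduced w → Γ.LabelsPath (Word.pow w p) →
    Γ.LabelsClosedPath (Word.pow w n)

/-- The graphical `C'(λ, p)`-condition: `C'(λ)` and any `p`-th power of a cyclically
reduced word read on `Γ` has all its powers read on `Γ`. -/
def GrSCP (Γ : LabGraph S) (lam : ℝ) (p : ℕ) : Prop :=
  Γ.GrSC lam ∧
  ∀ w : Word S, Word.IsCyclicallyReduced w → Γ.LabelsPath (Word.pow w p) →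
    ∀ k : ℕ, Γ.LabelsPath (Word.pow w k)

/-- The relations of `G(Γ)`: labels of closed paths of `Γ`. -/
def rels (Γ : LabGraph S) : Set (FreeGroup S) :=
  { g | ∃ p, Γ.IsClosedPath p ∧ g = FreeGroup.mk (Γ.wordOf p) }

/-- The group `G(Γ)` defined by the labelled graph `Γ`. -/
abbrev Grp (Γ : LabGraph S) : Type u :=
  FreeGroup S ⧸ Subgroup.normalClosure Γ.rels

/-- Evaluation of a word in `G(Γ)`. -/
def evalWord (Γ : LabGraph S) (w : Word S) : Γ.Grp :=
  QuotientGroup.mk (FreeGroup.mk w)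

/-- The canonical generators of `G(Γ)`. -/
def gen (Γ : LabGraph S) : S → Γ.Grp := fun s => Γ.evalWord [(s, true)]

/-- The Burnside quotient `G_n(Γ) = G(Γ)/G(Γ)ⁿ`. -/
abbrev GrpN (Γ : LabGraph S) (n : ℕ) : Type u := BurnsideQuotient Γ.Grp n

/-- The canonical generators of `G_n(Γ)`. -/
def genN (Γ : LabGraph S) (n : ℕ) : S → Γ.GrpN n :=
  fun s => QuotientGroup.mk (Γ.gen s)

/-- The generating set `S ∪ W` of the cone-off space: the canonical generators together
with all elements of `G(Γ)` represented by labels of paths in `Γ`. -/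
def coneGens (Γ : LabGraph S) : Set Γ.Grp :=
  Set.range Γ.gen ∪ { g | ∃ p, Γ.IsPath p ∧ g = Γ.evalWord (Γ.wordOf p) }

/-- The metric of the cone-off space `Ẋ(Γ)`: the word metric on `G(Γ)` with respect to
`S ∪ W`. -/
def coneDist (Γ : LabGraph S) : Γ.Grp → Γ.Grp → ℝ := wordDist Γ.coneGens

def EveryGeneratorOccurs (Γ : LabGraph S) : Prop :=
  ∀ s : S, ∃ e : Γ.E, (Γ.label e).1 = s

def NoIsolatedVertex (Γ : LabGraph S) : Prop := ∀ v : Γ.V, ∃ e : Γ.E, Γ.init e = v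

/-- The `m`-th iterate of an automorphism is the identity. -/
def AutPowId (Γ : LabGraph S) (φ : Γ.Aut) (m : ℕ) : Prop :=
  (∀ v, (⇑φ.vmap)^[m] v = v) ∧ (∀ e, (⇑φ.emap)^[m] e = e)

/-- The automorphism `φ` has order exactly `m`. -/
def AutOrder (Γ : LabGraph S) (φ : Γ.Aut) (m : ℕ) : Prop :=
  Γ.AutPowId φ m ∧ ∀ k, 0 < k → k < m → ¬ Γ.AutPowId φ k

end LabGraph

/-- An automorphism is the identity. -/
def IsAutId {S : Type u} {Γ : LabGraph S} (φ : Γ.Aut) : Prop :=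
  (∀ v, φ.vmap v = v) ∧ (∀ e, φ.emap e = e)

/-- The Cayley graph of a group `G` with respect to a family of generators `σ : S → G`,
as a labelled graph. -/
def CayleyGraph (G : Type v) [Group G] (S : Type u) (σ : S → G) : LabGraph S where
  V := G
  E := G × S × Bool
  init e := e.1
  bar e := (e.1 * (if e.2.2 then σ e.2.1 else (σ e.2.1)⁻¹), e.2.1, !e.2.2)
  bar_ne e h := by
    have h2 := congrArg (fun x => x.2.2) h
    simp at h2
  bar_bar e := by
    obtain ⟨g, s, b⟩ := e
    cases b <;> simp
  label e := e.2
  label_bar_fst _ := rfl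
  label_bar_snd _ := rfl

/-- Relabelling of a labelled graph along a map of alphabets. -/
def LabGraph.relabel {S : Type u} {T : Type u'} (Γ : LabGraph S) (f : S → T) :
    LabGraph T where
  V := Γ.V
  E := Γ.E
  init := Γ.init
  bar := Γ.bar
  bar_ne := Γ.bar_ne
  bar_bar := Γ.bar_bar
  label e := (f (Γ.label e).1, (Γ.label e).2)
  label_bar_fst e := congrArg f (Γ.label_bar_fst e)
  label_bar_snd e := Γ.label_bar_snd e

/-- Every connected component of `Γ` embeds into `Δ` by a label-preserving graph
homomorphism (which can be chosen to send a base vertex to any prescribed vertex). -/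
def ComponentsEmbed {S : Type u} (Γ : LabGraph.{u, v, w} S)
    (Δ : LabGraph.{u, v', w'} S) : Prop :=
  ∀ (v₀ : Γ.V) (x : Δ.V), ∃ f : LabGraph.Hom Γ Δ, f.vmap v₀ = x ∧
    Set.InjOn f.vmap { u | Γ.Reachable v₀ u } ∧
    Set.InjOn f.emap { e | Γ.Reachable v₀ (Γ.init e) }

/-- The path metric on (the vertices of) a labelled graph. -/
def graphDist {S : Type u} (Γ : LabGraph S) (u v : Γ.V) : ℝ :=
  sInf { r : ℝ | ∃ p, Γ.IsPathFrom u v p ∧ r = p.length }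

/-- Diameter of the connected component of `v`. -/
def compDiam {S : Type u} (Γ : LabGraph S) (v : Γ.V) : ℝ :=
  sSup { r : ℝ | ∃ u w, Γ.Reachable v u ∧ Γ.Reachable v w ∧ r = graphDist Γ u w }

/-- An indexing of the connected components of `Γ` by natural numbers. -/
def LabGraph.IsComponentIndex {S : Type u} (Γ : LabGraph S) (idx : Γ.V → ℕ) : Prop :=
  ∀ u v, Γ.Reachable u v ↔ idx u = idx v

/-- The box-space metric on a labelled graph whose components are indexed by `idx`. -/
def LabGraph.boxDist {S : Type u} (Γ : LabGraph S) (idx : Γ.V → ℕ) (u v : Γ.V) : ℝ :=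
  if Γ.Reachable u v then graphDist Γ u v
  else compDiam Γ u + compDiam Γ v + (idx u : ℝ) + (idx v : ℝ)

/-- Coarse embeddings between spaces endowed with distance functions, via the sequence
characterisation. -/
def IsCoarseEmbeddingWith {A : Type v} {B : Type w} (dA : A → A → ℝ) (dB : B → B → ℝ)
    (f : A → B) : Prop :=
  ∀ x y : ℕ → A,
    (Filter.Tendsto (fun k => dA (x k) (y k)) Filter.atTop Filter.atTop ↔
      Filter.Tendsto (fun k => dB (f (x k)) (f (y k))) Filter.atTop Filter.atTop)

/-- Distance between two subsets. -/
def setDist {Y : Type v} (ρ : Y → Y → ℝ) (A B : Set Y) : ℝ :=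
  sInf { r : ℝ | ∃ a ∈ A, ∃ b ∈ B, r = ρ a b }

/-! ## Hyperbolicity, boundary and group actions, relative to a distance function -/

/-- The Gromov product. -/
def gromovProd {Y : Type v} (ρ : Y → Y → ℝ) (x y t : Y) : ℝ :=
  (ρ x t + ρ y t - ρ x y) / 2

/-- `δ`-hyperbolicity via the four point condition. -/
def IsHyperbolicDist {Y : Type v} (ρ : Y → Y → ℝ) (δ : ℝ) : Prop :=
  ∀ x y z t : Y, min (gromovProd ρ x y t) (gromovProd ρ y z t) - δ ≤ gromovProd ρ x z t

/-- Length space (via approximate midpoints). -/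
def IsLengthDist {Y : Type v} (ρ : Y → Y → ℝ) : Prop :=
  ∀ x y : Y, ∀ ε : ℝ, 0 < ε → ∃ m : Y, ρ x m ≤ ρ x y / 2 + ε ∧ ρ m y ≤ ρ x y / 2 + ε

/-- A sequence converges at infinity if its Gromov products tend to infinity. -/
def ConvergesAtInfinity {Y : Type v} (ρ : Y → Y → ℝ) (b : Y) (u : ℕ → Y) : Prop :=
  ∀ M : ℝ, ∃ K : ℕ, ∀ i j : ℕ, K ≤ i → K ≤ j → M ≤ gromovProd ρ (u i) (u j) b

/-- Two sequences converging at infinity define the same boundary point. -/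
def EquivAtInfinity {Y : Type v} (ρ : Y → Y → ℝ) (b : Y) (u v : ℕ → Y) : Prop :=
  ∀ M : ℝ, ∃ K : ℕ, ∀ i j : ℕ, K ≤ i → K ≤ j → M ≤ gromovProd ρ (u i) (v j) b

section GroupAction

variable {G : Type v} [Group G] {Y : Type w}

/-- An element is elliptic if it has a bounded orbit. -/
def EllipticElt (ρ : Y → Y → ℝ) (act : G → Y → Y) (g : G) : Prop :=
  ∃ (x : Y) (C : ℝ), ∀ k : ℤ, ρ (act (g ^ k) x) x ≤ C

/-- A set of group elements is elliptic if it has a bounded orbit. -/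
def EllipticSet (ρ : Y → Y → ℝ) (act : G → Y → Y) (H : Set G) : Prop :=
  ∃ (x : Y) (C : ℝ), ∀ h ∈ H, ρ (act h x) x ≤ C

/-- An element is loxodromic (hyperbolic) if `m ↦ gᵐ • x` is a quasi-isometric
embedding of `ℤ`. -/
def LoxodromicElt (ρ : Y → Y → ℝ) (act : G → Y → Y) (g : G) : Prop :=
  ∃ (x : Y) (lam c : ℝ), 0 < lam ∧ 0 ≤ c ∧ ∀ m n : ℤ,
    lam⁻¹ * |(m : ℝ) - (n : ℝ)| - c ≤ ρ (act (g ^ m) x) (act (g ^ n) x) ∧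
    ρ (act (g ^ m) x) (act (g ^ n) x) ≤ lam * |(m : ℝ) - (n : ℝ)| + c

/-- The action is non-elementary: the limit set of an orbit contains at least three
points of the Gromov boundary. -/
def NonElementaryOn (ρ : Y → Y → ℝ) (act : G → Y → Y) : Prop :=
  ∃ (b : Y) (u₁ u₂ u₃ : ℕ → G),
    ConvergesAtInfinity ρ b (fun k => act (u₁ k) b) ∧
    ConvergesAtInfinity ρ b (fun k => act (u₂ k) b) ∧
    ConvergesAtInfinity ρ b (fun k => act (u₃ k) b) ∧
    ¬ EquivAtInfinity ρ b (fun k => act (u₁ k) b) (fun k => act (u₂ k) b) ∧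
    ¬ EquivAtInfinity ρ b (fun k => act (u₁ k) b) (fun k => act (u₃ k) b) ∧
    ¬ EquivAtInfinity ρ b (fun k => act (u₂ k) b) (fun k => act (u₃ k) b)

/-- A `(d, L, N)`-acylindrical action. -/
def AcylindricalOn (ρ : Y → Y → ℝ) (act : G → Y → Y) (d L : ℝ) (N : ℕ) : Prop :=
  ∀ x y : Y, L ≤ ρ x y →
    { u : G | ρ (act u x) x ≤ d ∧ ρ (act u y) y ≤ d }.Finite ∧
    { u : G | ρ (act u x) x ≤ d ∧ ρ (act u y) y ≤ d }.ncard ≤ N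

/-- A lineal subgroup: the limit set of its orbit consists of exactly two points. -/
def LinealSubgroup (ρ : Y → Y → ℝ) (act : G → Y → Y) (H : Subgroup G) : Prop :=
  ∃ (b : Y) (u v : ℕ → G), (∀ k, u k ∈ H) ∧ (∀ k, v k ∈ H) ∧
    ConvergesAtInfinity ρ b (fun k => act (u k) b) ∧
    ConvergesAtInfinity ρ b (fun k => act (v k) b) ∧
    ¬ EquivAtInfinity ρ b (fun k => act (u k) b) (fun k => act (v k) b) ∧
    ∀ w : ℕ → G, (∀ k, w k ∈ H) → ConvergesAtInfinity ρ b (fun k => act (w k) b) →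
      (EquivAtInfinity ρ b (fun k => act (w k) b) (fun k => act (u k) b) ∨
        EquivAtInfinity ρ b (fun k => act (w k) b) (fun k => act (v k) b))

/-- A maximal lineal subgroup. -/
def MaximalLineal (ρ : Y → Y → ℝ) (act : G → Y → Y) (E : Subgroup G) : Prop :=
  LinealSubgroup ρ act E ∧
  ∀ E' : Subgroup G, LinealSubgroup ρ act E' → E ≤ E' → E = E'

/-- `F` is the maximal finite normal subgroup of `E`. -/
def MaxFiniteNormalIn (F E : Subgroup G) : Prop :=
  F ≤ E ∧ (F : Set G).Finite ∧ (∀ g ∈ E, ∀ f ∈ F, g * f * g⁻¹ ∈ F) ∧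
  ∀ F' : Subgroup G, F' ≤ E → (F' : Set G).Finite →
    (∀ g ∈ E, ∀ f ∈ F', g * f * g⁻¹ ∈ F') → F' ≤ F

end GroupAction

/-- The exponent of the holomorph `Hol(H) = H ⋊ Aut(H)`. -/
def holExponent (H : Type v) [Group H] : ℕ :=
  Monoid.exponent (SemidirectProduct H (MulAut H) (MonoidHom.id (MulAut H)))

/-- `e` is the least common multiple of the exponents of the holomorphs of the maximal
finite normal subgroups of the maximal lineal subgroups (the invariant `e(G, X)`). -/
def IsHolLcm {G : Type v} [Group G] {Y : Type w} (ρ : Y → Y → ℝ) (act : G → Y → Y)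
    (e : ℕ) : Prop :=
  (∀ E F : Subgroup G, MaximalLineal ρ act E → MaxFiniteNormalIn F E →
    holExponent ↥F ∣ e) ∧
  ∀ m : ℕ, (∀ E F : Subgroup G, MaximalLineal ρ act E → MaxFiniteNormalIn F E →
    holExponent ↥F ∣ m) → e ∣ m

/-! ## Relators, geodesic sequences and parallelism -/

/-- A relator: the embedded image of a connected component of `Γ` in `Δ` under a
label-preserving graph homomorphism. -/
def IsRelatorIn {S : Type u} (Γ : LabGraph.{u, v, w} S) (Δ : LabGraph.{u, v', w'} S)
    (R : Set Δ.V) : Prop :=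
  ∃ (f : LabGraph.Hom Γ Δ) (v₀ : Γ.V),
    Set.InjOn f.vmap { u | Γ.Reachable v₀ u } ∧
    R = f.vmap '' { u | Γ.Reachable v₀ u }

/-- A chain of relators with consecutive nonempty intersections. -/
def IsRelChain {S : Type u} (Γ : LabGraph.{u, v, w} S) (Δ : LabGraph.{u, v', w'} S)
    (c : List (Set Δ.V)) : Prop :=
  (∀ R ∈ c, IsRelatorIn Γ Δ R) ∧ List.Chain' (fun R T => (R ∩ T).Nonempty) c

/-- A geodesic sequence of relators. -/
def IsGeoSeq {S : Type u} (Γ : LabGraph.{u, v, w} S) (Δ : LabGraph.{u, v', w'} S)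
    (c : List (Set Δ.V)) : Prop :=
  IsRelChain Γ Δ c ∧ c ≠ [] ∧
  ∀ c' : List (Set Δ.V), IsRelChain Γ Δ c' → c'.head? = c.head? →
    c'.getLast? = c.getLast? → c.length ≤ c'.length

/-- Two sequences of relators are parallel. -/
def AreParallel {V : Type v} (c d : List (Set V)) : Prop :=
  c.length = d.length ∧
  ∀ (i : ℕ) (hi : i < c.length) (hj : i < d.length),
    (c.get ⟨i, hi⟩ ∩ d.get ⟨i, hj⟩).Nonempty

/-- Conclusion of the parallelism proposition: truncations by at most `9ε + 3` terms of
the two sequences are parallel. -/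
def ParallelTruncation {V : Type v} (c d : List (Set V)) (ε : ℝ) : Prop :=
  ∃ k k' l l' : ℕ, 1 ≤ k ∧ 1 ≤ k' ∧ 1 ≤ l ∧ 1 ≤ l' ∧
    (k : ℝ) ≤ 9 * ε + 3 ∧ (k' : ℝ) ≤ 9 * ε + 3 ∧
    (l : ℝ) ≤ 9 * ε + 3 ∧ (l' : ℝ) ≤ 9 * ε + 3 ∧
    k + l = k' + l' ∧
    AreParallel ((c.drop (k - 1)).take (c.length + 2 - l - k))
      ((d.drop (k' - 1)).take (d.length + 2 - l' - k'))

/-- The conclusions of the chord lemma for cyclic configurations of 3 and 4 relators. -/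
def ChordProperty {V : Type v} (Rel : Set V → Prop) : Prop :=
  (∀ R₁ R₂ R₃, Rel R₁ → Rel R₂ → Rel R₃ →
    (R₁ ∩ R₂).Nonempty → (R₂ ∩ R₃).Nonempty → (R₃ ∩ R₁).Nonempty →
    (R₁ ∩ R₂ ∩ R₃).Nonempty) ∧
  (∀ R₁ R₂ R₃ R₄, Rel R₁ → Rel R₂ → Rel R₃ → Rel R₄ →
    (R₁ ∩ R₂).Nonempty → (R₂ ∩ R₃).Nonempty → (R₃ ∩ R₄).Nonempty → (R₄ ∩ R₁).Nonempty →
    (R₁ ∩ R₃).Nonempty ∨ (R₂ ∩ R₄).Nonempty)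

/-- The union of a sequence of sets of vertices is convex: any geodesic between two of
its vertices stays inside the union. -/
def ConvexUnion {S : Type u} (Δ : LabGraph S) (c : List (Set Δ.V)) : Prop :=
  ∀ u v : Δ.V, (∃ R ∈ c, u ∈ R) → (∃ R ∈ c, v ∈ R) →
    ∀ p : List Δ.E, Δ.IsPathFrom u v p → (p.length : ℝ) = graphDist Δ u v →
      ∀ e ∈ p, (∃ R ∈ c, Δ.init e ∈ R) ∧ (∃ R ∈ c, Δ.term e ∈ R)

/-! ## Classical small cancellation -/

/-- A classical piece: a common prefix of two distinct cyclic conjugates of elements of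
`R ∪ R⁻¹`. -/
def IsClassicalPiece {S : Type u} (R : Set (Word S)) (u : Word S) : Prop :=
  ∃ c₁ c₂ : Word S, c₁ ≠ c₂ ∧
    (∃ r ∈ R, Word.IsCyclicConjugate r c₁ ∨ Word.IsCyclicConjugate (Word.inv r) c₁) ∧
    (∃ r ∈ R, Word.IsCyclicConjugate r c₂ ∨ Word.IsCyclicConjugate (Word.inv r) c₂) ∧
    u <+: c₁ ∧ u <+: c₂

/-- The classical `C'(λ)` small cancellation condition. -/
def ClassicalSC {S : Type u} (R : Set (Word S)) (lam : ℝ) : Prop :=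
  (∀ r ∈ R, Word.IsCyclicallyReduced r) ∧
  ∀ u, IsClassicalPiece R u → ∀ r ∈ R, ∀ c, Word.IsCyclicConjugate r c → u <:+: c →
    (u.length : ℝ) < lam * (r.length : ℝ)

/-! ## Free products: syllables and classical small cancellation over free products -/

section FreeProducts

variable {ι : Type u} (M : ι → Type v) [∀ i, Group (M i)]

open Monoid

/-- The list of syllables of the normal form of an element of a free product. -/
def sylList (g : CoprodI M) : List (Σ i, M i) := by
  classical exact (CoprodI.Word.equiv (M := M) g).toList

/-- The syllable length `|g|_*` of an element of a free product. -/
def sylLen (g : CoprodI M) : ℕ := (sylList M g).length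

/-- The product `g * h` is weakly reduced. -/
def WeaklyRedProd (g h : CoprodI M) : Prop :=
  sylLen M g + sylLen M h ≤ sylLen M (g * h) + 1

/-- `g` is cyclically reduced: syllable length at most one, or first and last syllables
in distinct factors. -/
def CyclRed (g : CoprodI M) : Prop :=
  sylLen M g ≤ 1 ∨
    (sylList M g).head?.map Sigma.fst ≠ (sylList M g).getLast?.map Sigma.fst

/-- `g` is weakly cyclically reduced: syllable length at most one, or the product of the
last and first syllables does not vanish. -/
def WeaklyCyclRed (g : CoprodI M) : Prop :=
  sylLen M g ≤ 1 ∨ ∀ (i : ι) (a b : M i),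
    (sylList M g).getLast? = some ⟨i, a⟩ → (sylList M g).head? = some ⟨i, b⟩ →
      a * b ≠ 1

/-- `c` is a weakly cyclic conjugate of `r`. -/
def WeakCyclConj (r c : CoprodI M) : Prop :=
  ∃ u v : CoprodI M, r = u * v ∧ WeaklyRedProd M u v ∧ c = v * u ∧ WeaklyCyclRed M c

/-- A symmetrized subset of a free product. -/
def Symmetrized (R : Set (CoprodI M)) : Prop :=
  (∀ r ∈ R, CyclRed M r) ∧
  ∀ r ∈ R, ∀ c, (WeakCyclConj M r c ∨ WeakCyclConj M r⁻¹ c) → c ∈ R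

/-- A piece for free product small cancellation. -/
def FPPiece (R : Set (CoprodI M)) (u : CoprodI M) : Prop :=
  ∃ r₁ ∈ R, ∃ r₂ ∈ R, r₁ ≠ r₂ ∧
    ∃ v₁ v₂ : CoprodI M, r₁ = u * v₁ ∧ WeaklyRedProd M u v₁ ∧
      r₂ = u * v₂ ∧ WeaklyRedProd M u v₂

/-- The power-free `C'_*(λ)` small cancellation condition over a free product. -/
def PowerFreeSC (R : Set (CoprodI M)) (lam : ℝ) : Prop :=
  (∀ r ∈ R, ∀ u v : CoprodI M, r = u * v → WeaklyRedProd M u v → FPPiece M R u →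
    (sylLen M u : ℝ) < lam * (sylLen M r : ℝ)) ∧
  (∀ r ∈ R, 1 / lam < (sylLen M r : ℝ)) ∧
  (∀ r ∈ R, ¬ ∃ (x : CoprodI M) (k : ℕ), 2 ≤ k ∧ r = x ^ k)

/-- The power-free `C'_*(λ, p)` small cancellation condition over a free product. -/
def PowerFreeSCP (R : Set (CoprodI M)) (lam : ℝ) (p : ℕ) : Prop :=
  PowerFreeSC M R lam ∧
  ∀ r ∈ R, ∀ (w v : CoprodI M) (k : ℕ), CyclRed M w → 1 < sylLen M w →
    r = w ^ k * v → WeaklyRedProd M (w ^ k) v → k ≤ p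

end FreeProducts

/-! ## Graphical small cancellation over free products -/

section FPGraphical

variable {ι : Type u} (M : ι → Type v) [∀ i, Group (M i)] (S : ι → Type u')
  (σ : ∀ i, S i → M i)

open Monoid

/-- The image in the free product of a letter of a word over `Σ i, S i`. -/
def letterFP (x : (Σ i, S i) × Bool) : CoprodI M :=
  if x.2 = true then CoprodI.of (σ x.1.1 x.1.2)
  else (CoprodI.of (σ x.1.1 x.1.2))⁻¹

/-- Evaluation of a word in the free product. -/
def evalFPWord (w : Word (Σ i, S i)) : CoprodI M :=
  (w.map (letterFP M S σ)).prod

/-- The relations of `G(Γ)` over the free product. -/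
def fpRels (Γ : LabGraph (Σ i, S i)) : Set (CoprodI M) :=
  { g | ∃ p, Γ.IsClosedPath p ∧ g = evalFPWord M S σ (Γ.wordOf p) }

/-- The group defined by a labelled graph over a free product. -/
abbrev FPGrp (Γ : LabGraph (Σ i, S i)) :=
  CoprodI M ⧸ Subgroup.normalClosure (fpRels M S σ Γ)

/-- Evaluation of a word in `G(Γ)`. -/
def fpEval (Γ : LabGraph (Σ i, S i)) (w : Word (Σ i, S i)) : FPGrp M S σ Γ :=
  QuotientGroup.mk (evalFPWord M S σ w)

/-- The canonical map of a factor into `G(Γ)`. -/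
def fpOf (Γ : LabGraph (Σ i, S i)) {i : ι} (x : M i) : FPGrp M S σ Γ :=
  QuotientGroup.mk (CoprodI.of x)

/-- The canonical generators of `G(Γ)`. -/
def fpGen (Γ : LabGraph (Σ i, S i)) : (Σ i, S i) → FPGrp M S σ Γ :=
  fun x => fpEval M S σ Γ [(x, true)]

/-- The canonical generators of `G_n(Γ)`. -/
def fpGenN (Γ : LabGraph (Σ i, S i)) (n : ℕ) :
    (Σ i, S i) → BurnsideQuotient (FPGrp M S σ Γ) n :=
  fun x => QuotientGroup.mk (fpGen M S σ Γ x)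

/-- The generating set of the cone-off space in the free product case. -/
def fpConeGens (Γ : LabGraph (Σ i, S i)) : Set (FPGrp M S σ Γ) :=
  Set.range (fpGen M S σ Γ) ∪
    { g | ∃ p, Γ.IsPath p ∧ g = fpEval M S σ Γ (Γ.wordOf p) }

/-- The metric of the cone-off space in the free product case. -/
def fpConeDist (Γ : LabGraph (Σ i, S i)) :
    FPGrp M S σ Γ → FPGrp M S σ Γ → ℝ :=
  wordDist (fpConeGens M S σ Γ)

/-- A word is locally geodesic: it labels a geodesic of the Cayley graph of the free
product. -/
def LocallyGeodesic (w : Word (Σ i, S i)) : Prop :=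
  ∀ w' : Word (Σ i, S i), evalFPWord M S σ w' = evalFPWord M S σ w →
    w.length ≤ w'.length

/-- The Cayley graph of the factor `M i`, as a graph labelled by `Σ j, S j`. -/
def FactorCayley (i : ι) : LabGraph (Σ j, S j) :=
  (CayleyGraph (M i) (S i) (σ i)).relabel fun s => ⟨i, s⟩

/-- An attached Cayley graph: an embedded copy of the Cayley graph of a factor,
saturated for edges labelled in that factor. -/
def IsAttachedCayley {Γ : LabGraph (Σ i, S i)} (i : ι)
    (f : LabGraph.Hom (FactorCayley M S σ i) Γ) : Prop :=
  Function.Injective f.vmap ∧ Function.Injective f.emap ∧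
  ∀ e : Γ.E, (Γ.label e).1.1 = i → (∃ v, f.vmap v = Γ.init e) → ∃ e', f.emap e' = e

/-- `Γ` coincides with its completion and all attached Cayley graphs are embedded. -/
def IsCompleted (Γ : LabGraph (Σ i, S i)) : Prop :=
  (∀ i, ∃ f : LabGraph.Hom (FactorCayley M S σ i) Γ, IsAttachedCayley M S σ i f) ∧
  (∀ (i : ι) (v : Γ.V), (∃ e, Γ.init e = v ∧ (Γ.label e).1.1 = i) →
    ∃ f : LabGraph.Hom (FactorCayley M S σ i) Γ,
      IsAttachedCayley M S σ i f ∧ v ∈ Set.range f.vmap)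

/-- The graphical `C'_*(λ)`-condition over a free product. -/
def FPSC (Γ : LabGraph (Σ i, S i)) (lam : ℝ) : Prop :=
  IsCompleted M S σ Γ ∧
  ∀ γ, Γ.IsSimpleClosedPath γ → evalFPWord M S σ (Γ.wordOf γ) ≠ 1 →
    ∀ w, Γ.IsPiece w → LocallyGeodesic M S σ w → Γ.OccursOn w γ →
      (w.length : ℝ) < lam * (γ.length : ℝ)

/-- Cylinder-freeness: no nontrivial label-preserving automorphism of a component
preserves two disjoint attached Cayley graphs. -/
def CylinderFree (Γ : LabGraph (Σ i, S i)) : Prop :=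
  ∀ (v₀ : Γ.V) (i₁ i₂ : ι)
    (f₁ : LabGraph.Hom (FactorCayley M S σ i₁) (Γ.component v₀))
    (f₂ : LabGraph.Hom (FactorCayley M S σ i₂) (Γ.component v₀)),
    IsAttachedCayley M S σ i₁ f₁ → IsAttachedCayley M S σ i₂ f₂ →
    Disjoint (Set.range f₁.vmap) (Set.range f₂.vmap) →
    ∀ φ : (Γ.component v₀).Aut,
      ⇑φ.vmap '' Set.range f₁.vmap = Set.range f₁.vmap →
      ⇑φ.vmap '' Set.range f₂.vmap = Set.range f₂.vmap →
      IsAutId φ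

/-- The graphical `C'_*(λ, p)`-condition over a free product. -/
def FPSCP (Γ : LabGraph (Σ i, S i)) (lam : ℝ) (p : ℕ) : Prop :=
  FPSC M S σ Γ lam ∧ CylinderFree M S σ Γ ∧
  ∀ w : Word (Σ i, S i), Word.IsCyclicallyReduced w → Γ.LabelsPath (Word.pow w p) →
    ∀ k : ℕ, Γ.LabelsPath (Word.pow w k)

end FPGraphical

/-! ## Finite presentations relative to the Burnside variety, and decision problems -/

/-- Code for a finite presentation relative to the Burnside variety: a number of
generators and a finite list of relator words. -/
abbrev BPres : Type := ℕ × List (List (ℕ × Bool))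

/-- The relations determined by such a code: the listed relators, the generators beyond
the prescribed ones, and all `n`-th powers. -/
def presRels (n : ℕ) (P : BPres) : Set (FreeGroup ℕ) :=
  { g | ∃ w ∈ P.2, g = FreeGroup.mk w } ∪
  { g | ∃ m : ℕ, P.1 ≤ m ∧ g = FreeGroup.of m } ∪
  { g | ∃ x : FreeGroup ℕ, g = x ^ n }

/-- The `n`-periodic group presented by a code. -/
abbrev presGroup (n : ℕ) (P : BPres) : Type :=
  FreeGroup ℕ ⧸ Subgroup.normalClosure (presRels n P)

/-- `G` is finitely presented relative to the Burnside variety `B_n`. -/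
def FinPresRelBurnside (n : ℕ) (G : Type v) [Group G] : Prop :=
  ∃ (S : Type) (R : Set (FreeGroup S)), Finite S ∧ R.Finite ∧
    Nonempty (G ≃* (FreeGroup S ⧸
      Subgroup.normalClosure (R ∪ { g : FreeGroup S | ∃ x : FreeGroup S, g = x ^ n })))

/-! ## Expanders and property A -/

/-- Number of edges from `A` to its complement. -/
def edgeBoundaryCard {V : Type v} (G : SimpleGraph V) (A : Set V) : ℕ :=
  Set.ncard { p : V × V | p.1 ∈ A ∧ p.2 ∉ A ∧ G.Adj p.1 p.2 }

/-- An expander family: finite graphs of uniformly bounded valency, of sizes tending to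
infinity, with Cheeger constants uniformly bounded away from `0`. -/
def IsExpanderFamily (V : ℕ → Type) (G : ∀ k, SimpleGraph (V k)) : Prop :=
  (∀ k, Finite (V k)) ∧
  (∃ D : ℕ, ∀ (k : ℕ) (v : V k), Set.ncard { u | (G k).Adj v u } ≤ D) ∧
  Filter.Tendsto (fun k => Nat.card (V k)) Filter.atTop Filter.atTop ∧
  ∃ c : ℝ, 0 < c ∧ ∀ (k : ℕ) (A : Set (V k)), A.Nonempty →
    2 * A.ncard ≤ Nat.card (V k) →
    c * (A.ncard : ℝ) ≤ (edgeBoundaryCard (G k) A : ℝ)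

/-- Diameter of a simple graph (as a real number). -/
def sgDiam {V : Type v} (G : SimpleGraph V) : ℝ :=
  sSup { r : ℝ | ∃ u v, r = (G.dist u v : ℝ) }

/-- The box-space metric on the disjoint union of a family of finite graphs. -/
def expBoxDist (V : ℕ → Type) (G : ∀ k, SimpleGraph (V k)) (x y : Σ k, V k) : ℝ :=
  if h : x.1 = y.1 then ((G y.1).dist (h ▸ x.2) y.2 : ℝ)
  else sgDiam (G x.1) + sgDiam (G y.1) + (x.1 : ℝ) + (y.1 : ℝ)

/-- Yu's property A for a group endowed with the word metric of a generating set. -/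
def HasPropertyA {Q : Type v} [Group Q] (A : Set Q) : Prop :=
  ∀ R ε : ℝ, 0 < ε → ∃ (B : Q → Set (Q × ℕ)) (Sb : ℝ),
    (∀ g, (B g).Finite ∧ (B g).Nonempty) ∧
    (∀ g h : Q, wordDist A g h ≤ R →
      ((symmDiff (B g) (B h)).ncard : ℝ) ≤ ε * ((B g ∩ B h).ncard : ℝ)) ∧
    ∀ g : Q, ∀ x ∈ B g, wordDist A g x.1 ≤ Sb

end

set_option linter.unusedSectionVars false

namespace PG

/-- `d` is a left-invariant, integer-valued, discretely geodesic metric on `G` satisfying the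
four-point condition with constant `δ`. -/
structure HM {G : Type} [Group G] (d : G → G → ℤ) (δ : ℤ) : Prop where
  self : ∀ x, d x x = 0
  eq_of : ∀ x y, d x y = 0 → x = y
  symm : ∀ x y, d x y = d y x
  tri : ∀ x y z, d x z ≤ d x y + d y z
  inv : ∀ g x y, d (g * x) (g * y) = d x y
  geo : ∀ x y (t : ℤ), 0 ≤ t → t ≤ d x y → ∃ z, d x z = t ∧ d z y = d x y - t
  hyp : ∀ x y z w, d x z + d y w ≤ max (d x y + d z w) (d x w + d y z) + δ

/-- `p` is a coarse closest-point projection of `x` to `Y`. -/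
def Gate {G : Type} (d : G → G → ℤ) (c : ℤ) (Y : Set G) (x p : G) : Prop :=
  p ∈ Y ∧ ∀ y ∈ Y, d x p + d p y ≤ d x y + c

/-- `z` is between `x` and `y` up to the error `e`. -/
def Bt {G : Type} (d : G → G → ℤ) (e : ℤ) (x z y : G) : Prop := d x z + d z y ≤ d x y + e

namespace HM
variable {G : Type} [Group G] {d : G → G → ℤ} {δ : ℤ} (h : HM d δ)
include h

theorem nn (x y : G) : 0 ≤ d x y := by
  have := h.tri x y x; have := h.symm x y; have := h.self x; omega

theorem δnn : 0 ≤ δ := by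
  have := h.hyp 1 1 1 1; have := h.self (1 : G); simp_all

theorem split {e : ℤ} {x z y : G} (hb : Bt d e x z y) (w : G) :
    Bt d (e + δ) x z w ∨ Bt d (e + δ) w z y := by
  unfold Bt at *
  have := h.hyp x z y w
  have := h.symm x z; have := h.symm z y; have := h.symm z w; have := h.symm y w
  rcases le_total (d x z + d y w) (d x w + d z y) with h1 | h1 <;>
    simp only [h1, max_eq_left, max_eq_right] at * <;> [left; right] <;> omega

theorem bt_symm {e : ℤ} {x z y : G} (hb : Bt d e x z y) : Bt d e y z x := by
  unfold Bt at *
  have := h.symm x z; have := h.symm z y; have := h.symm x y; omega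

/-- Two points which are nearly between `x` and `y` at similar distance from `x` are close. -/
theorem close {e e' k : ℤ} {x y z z' : G} (h1 : Bt d e x z y) (h2 : Bt d e' x z' y)
    (hk : |d x z - d x z'| ≤ k) : d z z' ≤ max e e' + k + δ := by
  unfold Bt at *
  have := h.hyp x z y z'
  have := h.symm x z; have := h.symm z y; have := h.symm y z'
  rw [abs_le] at hk
  have a1 := le_max_left e e'
  have a2 := le_max_right e e'
  rcases max_cases (d x z + d y z') (d x z' + d z y) with h1 | h1 <;> omega

theorem bt_inv {e : ℤ} {x z y : G} (g : G) : Bt d e (g * x) (g * z) (g * y) ↔ Bt d e x z y := by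
  simp [Bt, h.inv]

section gates
variable {c : ℤ} {Y : Set G}

theorem gate_unique {x p p' : G} (hp : Gate d c Y x p) (hp' : Gate d c Y x p') : d p p' ≤ c := by
  have := hp.2 _ hp'.1; have := hp'.2 _ hp.1; have := h.symm p p'; omega

theorem gate_self {x p : G} (hx : x ∈ Y) (hp : Gate d c Y x p) : 2 * d x p ≤ c := by
  have := hp.2 _ hx; have := h.self x; have := h.symm x p; omega

theorem gate_cross {x y p q : G} (hp : Gate d c Y x p) (hq : Gate d c Y y q)
    (hpq : 2 * c + δ < 2 * d p q) : d x p + d p q + d q y ≤ d x y + 2 * c + δ := by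
  have := hp.2 _ hq.1; have := hq.2 _ hp.1
  have := h.hyp x p q y
  have := h.symm p y; have := h.symm q y; have := h.symm q p
  rcases max_cases (d x p + d q y) (d x y + d p q) with h1 | h1 <;> omega

theorem gate_lip {x y p q : G} (hp : Gate d c Y x p) (hq : Gate d c Y y q) :
    d p q ≤ d x y + 2 * c + δ := by
  have := h.nn x p; have := h.nn q y; have := h.nn x y; have := h.nn p q
  have h1 := h.gate_unique hp hp
  have := h.self p
  have := h.δnn
  by_cases hpq : 2 * c + δ < 2 * d p q
  · have := h.gate_cross hp hq hpq; omega
  · omega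

/-- The gate of a point between two points of `Y` is close to this point. -/
theorem gate_bt {e : ℤ} {y z y' p : G} (hb : Bt d e y z y') (hy : y ∈ Y) (hy' : y' ∈ Y)
    (hp : Gate d c Y z p) : 2 * d z p ≤ e + 2 * c := by
  unfold Bt at hb
  have := hp.2 _ hy; have := hp.2 _ hy'
  have := h.symm y z; have := h.tri y p y'; have := h.symm y p; omega

/-- The gate `p` of an end point is nearly between the end points if the projections are far. -/
theorem gate_cross_left {x y p q : G} (hp : Gate d c Y x p) (hq : Gate d c Y y q)
    (hpq : 2 * c + δ < 2 * d p q) : Bt d (2 * c + δ) x p y := by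
  have := h.gate_cross hp hq hpq
  have := h.tri p q y
  unfold Bt; omega

theorem gate_cross_right {x y p q : G} (hp : Gate d c Y x p) (hq : Gate d c Y y q)
    (hpq : 2 * c + δ < 2 * d p q) : Bt d (2 * c + δ) x q y := by
  have := h.gate_cross hp hq hpq
  have := h.tri x p q
  unfold Bt; omega

end gates

/-- An exact geodesic point near a point which is nearly between `x` and `y`. -/
theorem exact_near {e : ℤ} {x z y : G} (hb : Bt d e x z y) :
    ∃ z', Bt d 0 x z' y ∧ d z z' ≤ 2 * e + δ := by
  have e0 : 0 ≤ e := by have := h.tri x z y; unfold Bt at hb; omega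
  have := h.nn x z; have := h.nn x y
  obtain ⟨z', h1, h2⟩ := h.geo x y (min (d x z) (d x y)) (by omega) (by omega)
  have hz' : Bt d 0 x z' y := by unfold Bt; omega
  refine ⟨z', hz', ?_⟩
  have := h.close (k := e) hb hz' (by
    rw [h1, abs_le]; unfold Bt at hb; have := h.nn z y; constructor <;> omega)
  rw [max_eq_left e0] at this; omega

/-- A coarse centre of a triangle. -/
theorem center (x y z : G) : ∃ p, Bt d 0 x p y ∧ Bt d (δ + 2) y p z ∧ Bt d (δ + 2) x p z := by
  have := h.nn x y; have := h.nn x z; have := h.nn y z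
  have := h.tri x y z; have := h.tri x z y; have := h.tri y x z
  have := h.symm x y; have := h.symm z y
  obtain ⟨p, h1, h2⟩ := h.geo x y ((d x y + d x z - d y z) / 2) (by omega) (by omega)
  have := h.hyp x y p z
  have s1 := h.symm p y; have s2 := h.symm p x; have s3 := h.symm p z
  refine ⟨p, by unfold Bt; omega, ?_⟩
  have := h.hyp x z y p
  have := h.δnn
  have := h.hyp x p y z
  have : d p z ≤ (d x z + d y z - d x y) / 2 + δ + 1 := by
    rcases max_cases (d x p + d y z) (d x z + d p y) with h1 | h1 <;> omega
  unfold Bt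
  constructor <;> omega

end HM
end PG

namespace PG

/-- A system of coarse projections of objects (points and lines) to lines, together with groups of
rotations about the lines. -/
structure ProjSys {G ι ob : Type} [Group G] [MulAction G ι] [MulAction G ob]
    (L : ι → ob) (R : ι → Subgroup G) (D : ι → ob → ob → ℤ) (N : ι → ℤ) (θ : ℤ) (x : ob) :
    Prop where
  L_smul : ∀ (g : G) i, L (g • i) = g • L i
  L_inj : ∀ i j, L i = L j → i = j
  x_ne : ∀ (g : G) i, g • x ≠ L i
  R_smul : ∀ (g : G) i s, s ∈ R i → g * s * g⁻¹ ∈ R (g • i)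
  R_fix : ∀ i s, s ∈ R i → s • i = i
  self : ∀ i (g : G), D i (g • x) (g • x) ≤ θ
  symm : ∀ i a b, D i a b = D i b a
  tri : ∀ i a b c, a ≠ L i → b ≠ L i → c ≠ L i → D i a c ≤ D i a b + D i b c
  equiv : ∀ (g : G) i a b, D (g • i) (g • a) (g • b) = D i a b
  behr : ∀ i j a, i ≠ j → a ≠ L i → a ≠ L j → θ < D i (L j) a → D j (L i) a ≤ θ
  spin : ∀ i s a, s ∈ R i → s ≠ 1 → a ≠ L i → N i ≤ D i a (s • a)
  N_ge : ∀ i, 100 * θ ≤ N i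
  N_smul : ∀ (g : G) i, N (g • i) = N i
  θ_pos : 0 < θ
  select : ∀ (H : Subgroup G) (S : Set ι), S.Nonempty →
    ∃ l ∈ S, ∃ h ∈ H, ∀ j ∈ S, j ≠ l → D j (h • x) (L l) ≤ θ

/-- `k` can be reduced to `1` by rotations about lines with large projections. -/
inductive Good {G ι ob : Type} [Group G] [MulAction G ob] (R : ι → Subgroup G)
    (D : ι → ob → ob → ℤ) (N : ι → ℤ) (x : ob) : G → Prop
  | one : Good R D N x 1
  | step (k g : G) (i : ι) (hg : g ∈ R i) (hD : N i ≤ D i x (k • x)) (hk : Good R D N x (g * k)) :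
      Good R D N x k

/-- Reduced words, with their first line, over a subgroup and rotations about a set of lines. -/
inductive Red {G ι : Type} [Group G] [MulAction G ι] (R : ι → Subgroup G) (H : Subgroup G)
    (S : Set ι) : ι → G → Prop
  | base (a s k : G) (i : ι) (ha : a ∈ H) (hi : i ∈ S) (hs : s ∈ R i) (hs1 : s ≠ 1) (hk : k ∈ H) :
      Red R H S (a • i) (a * s * k)
  | cons (a s k : G) (i l : ι) (ha : a ∈ H) (hi : i ∈ S) (hs : s ∈ R i) (hs1 : s ≠ 1)
      (hk : Red R H S l k) (hl : l ≠ i) : Red R H S (a • i) (a * s * k)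

namespace ProjSys
variable {G ι ob : Type} [Group G] [MulAction G ι] [MulAction G ob]
    {L : ι → ob} {R : ι → Subgroup G} {D : ι → ob → ob → ℤ} {N : ι → ℤ} {θ : ℤ} {x : ob}
    (P : ProjSys L R D N θ x)
include P

theorem R_smul_le {g : G} {H : Subgroup G} (hg : g ∈ H) (i : ι) : R (g • i) ≤ H ↔ R i ≤ H := by
  constructor
  · intro h s hs
    have := h (P.R_smul g i s hs)
    have := H.mul_mem (H.mul_mem (H.inv_mem hg) this) hg
    simpa [mul_assoc] using this
  · intro h s hs
    have := P.R_smul g⁻¹ _ s hs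
    rw [inv_smul_smul] at this
    have := H.mul_mem (H.mul_mem hg (h this)) (H.inv_mem hg)
    simpa [mul_assoc] using this

theorem equiv' (g : G) (i : ι) (a b : ob) : D (g⁻¹ • i) (g⁻¹ • a) (g⁻¹ • b) = D i a b :=
  P.equiv _ _ _ _

omit [MulAction G ob] P in
theorem red_smul {H : Subgroup G} {S : Set ι} {l : ι} {k a : G} (hr : Red R H S l k) (ha : a ∈ H) :
    Red R H S (a • l) (a * k) := by
  cases hr with
  | base b s k i hb hi hs hs1 hk =>
    rw [← mul_smul, show a * (b * s * k) = (a * b) * s * k by group]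
    exact .base _ _ _ _ (H.mul_mem ha hb) hi hs hs1 hk
  | cons b s k i l hb hi hs hs1 hk hl =>
    rw [← mul_smul, show a * (b * s * k) = (a * b) * s * k by group]
    exact .cons _ _ _ _ _ (H.mul_mem ha hb) hi hs hs1 hk hl

omit [MulAction G ob] P in
theorem red_mem {H : Subgroup G} {S : Set ι} (hS : ∀ h ∈ H, ∀ i ∈ S, h • i ∈ S) {l : ι} {k : G}
    (hr : Red R H S l k) : l ∈ S := by
  cases hr with
  | base b s k i hb hi hs hs1 hk => exact hS _ hb _ hi
  | cons b s k i l hb hi hs hs1 hk hl => exact hS _ hb _ hi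

theorem red_of_mem {H : Subgroup G} {S : Set ι} {k : G}
    (hk : k ∈ H ⊔ ⨆ i ∈ S, R i) : k ∈ H ∨ ∃ l, Red R H S l k := by
  have e : H ⊔ ⨆ i ∈ S, R i = Subgroup.closure ((H : Set G) ∪ ⋃ i ∈ S, (R i : Set G)) := by
    rw [Subgroup.closure_union, Subgroup.closure_eq, Subgroup.closure_iUnion]
    congr 2; ext i; rw [Subgroup.closure_iUnion]; simp
  have key : ∀ g ∈ ((H : Set G) ∪ ⋃ i ∈ S, (R i : Set G)), ∀ k, (k ∈ H ∨ ∃ l, Red R H S l k) →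
      (g * k ∈ H ∨ ∃ l, Red R H S l (g * k)) := by
    rintro g (hg | hg) k hk
    · rcases hk with hk | ⟨l, hk⟩
      · exact .inl (H.mul_mem hg hk)
      · exact .inr ⟨_, red_smul hk hg⟩
    · simp only [Set.mem_iUnion] at hg
      obtain ⟨i, hi, hg⟩ := hg
      by_cases g1 : g = 1
      · simpa [g1] using hk
      rcases hk with hk | ⟨l, hk⟩
      · right; refine ⟨(1 : G) • i, ?_⟩
        have := Red.base (R := R) (H := H) (S := S) 1 g k i H.one_mem hi hg g1 hk
        simpa using this
      · by_cases hl : l = i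
        · cases hk with
          | base b s k i' hb hi' hs hs1 hk =>
            have h1 : b⁻¹ * g * b * s ∈ R i' := by
              refine (R i').mul_mem ?_ hs
              have := P.R_smul b⁻¹ i g hg
              rw [← hl] at this; simpa using this
            rw [show g * (b * s * k) = b * (b⁻¹ * g * b * s) * k by group]
            by_cases h2 : b⁻¹ * g * b * s = 1
            · rw [h2, mul_one]; exact .inl (H.mul_mem hb hk)
            · exact .inr ⟨_, .base _ _ _ _ hb hi' h1 h2 hk⟩
          | cons b s k i' l' hb hi' hs hs1 hk hl' =>
            have h1 : b⁻¹ * g * b * s ∈ R i' := by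
              refine (R i').mul_mem ?_ hs
              have := P.R_smul b⁻¹ i g hg
              rw [← hl] at this; simpa using this
            rw [show g * (b * s * k) = b * (b⁻¹ * g * b * s) * k by group]
            by_cases h2 : b⁻¹ * g * b * s = 1
            · rw [h2, mul_one]; exact .inr ⟨_, red_smul hk hb⟩
            · exact .inr ⟨_, .cons _ _ _ _ _ hb hi' h1 h2 hk hl'⟩
        · right; refine ⟨(1 : G) • i, ?_⟩
          have := Red.cons (R := R) (H := H) (S := S) 1 g k i l H.one_mem hi hg g1 hk hl
          simpa using this
  rw [e] at hk
  have inv : ∀ g ∈ ((H : Set G) ∪ ⋃ i ∈ S, (R i : Set G)),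
      g⁻¹ ∈ ((H : Set G) ∪ ⋃ i ∈ S, (R i : Set G)) := by
    rintro g (hg | hg)
    · exact .inl (H.inv_mem hg)
    · simp only [Set.mem_iUnion] at hg
      obtain ⟨i, hi, hg⟩ := hg
      right; simp only [Set.mem_iUnion]; exact ⟨i, hi, (R i).inv_mem hg⟩
  induction hk using Subgroup.closure_induction_left with
  | one => exact .inl H.one_mem
  | mul_left g hg k _ ih => exact key g hg k ih
  | inv_mul_cancel g hg k _ ih => exact key _ (inv g hg) k ih

/-- A subgroup all of whose elements are reducible by rotations, and whose orbit has small
projections to the lines not rotated by it. -/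
def State (R : ι → Subgroup G) (D : ι → ob → ob → ℤ) (N : ι → ℤ) (θ : ℤ) (x : ob)
    (H : Subgroup G) : Prop :=
  (∀ k ∈ H, Good R D (fun i => N i - 10 * θ) x k) ∧
    ∀ j, ¬ R j ≤ H → ∀ a ∈ H, ∀ b ∈ H, D j (a • x) (b • x) ≤ 6 * θ

section step
variable {H : Subgroup G} (hH : State R D N θ x H) {S : Set ι}
    (hS : ∀ h ∈ H, ∀ i ∈ S, h • i ∈ S) (hout : ∀ i ∈ S, ¬ R i ≤ H)
    (hK : ∀ j, ¬ R j ≤ H → j ∉ S → ∀ a ∈ H, ∀ b ∈ H, D j (a • x) (b • x) ≤ 2 * θ)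
    (hl : ∀ l ∈ S, ∀ j, ¬ R j ≤ H → j ≠ l → ∃ h ∈ H, D j (h • x) (L l) ≤ θ)
include hH hS hout hl

omit hH hS hout in
theorem line_near {B : ℤ} {l j : ι} (hlS : l ∈ S) (hj : ¬ R j ≤ H) (hjl : j ≠ l)
    (hB : ∀ a ∈ H, ∀ b ∈ H, D j (a • x) (b • x) ≤ B) {a : G} (ha : a ∈ H) :
    D j (a • x) (L l) ≤ B + θ := by
  obtain ⟨h, hh, h1⟩ := hl l hlS j hj hjl
  have := P.tri j (a • x) (h • x) (L l) (P.x_ne _ _) (P.x_ne _ _) (fun e => hjl (P.L_inj _ _ e).symm)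
  have := hB a ha h hh
  omega

theorem ping {l : ι} {k : G} (hr : Red R H S l k) :
    ∀ a ∈ H, N l - 8 * θ ≤ D l (a • x) (k • x) := by
  have hθ := P.θ_pos
  have gen : ∀ (a s k : G) (i : ι), a ∈ H → i ∈ S → s ∈ R i → s ≠ 1 →
      (∀ b ∈ H, D i (b • x) (k • x) ≤ 8 * θ) → ∀ b ∈ H,
      N (a • i) - 8 * θ ≤ D (a • i) (b • x) ((a * s * k) • x) := by
    intro a s k i ha hi hs hs1 hk b hb
    have e : D (a • i) (b • x) ((a * s * k) • x) = D i ((a⁻¹ * b) • x) (s • (k • x)) := by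
      rw [← P.equiv' a]; simp [smul_smul, mul_assoc]
    rw [e, P.N_smul]
    have h1 := P.spin i s ((a⁻¹ * b) • x) hs hs1 (P.x_ne _ _)
    have h2 := P.tri i ((a⁻¹ * b) • x) (s • (k • x)) (s • ((a⁻¹ * b) • x))
      (P.x_ne _ _) (by rw [smul_smul]; exact P.x_ne _ _) (by rw [smul_smul]; exact P.x_ne _ _)
    have h3 : D i (s • (k • x)) (s • ((a⁻¹ * b) • x)) = D i (k • x) ((a⁻¹ * b) • x) := by
      conv_lhs => rw [← P.R_fix i s hs]
      rw [P.equiv]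
    have h4 := hk (a⁻¹ * b) (H.mul_mem (H.inv_mem ha) hb)
    rw [P.symm] at h4
    omega
  induction hr with
  | base a s k i ha hi hs hs1 hk =>
    refine gen a s k i ha hi hs hs1 fun b hb => ?_
    have := hH.2 i (hout i hi) b hb k hk
    omega
  | cons a s k i l ha hi hs hs1 hk hli ih =>
    refine gen a s k i ha hi hs hs1 fun b hb => ?_
    have hlS := red_mem hS hk
    have h1 := P.line_near (B := 6 * θ) hl hlS (hout i hi) hli.symm (hH.2 i (hout i hi)) hb
    have h2 := P.line_near (B := 6 * θ) hl hi (hout l hlS) hli (hH.2 l (hout l hlS)) H.one_mem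
    have h3 := ih 1 H.one_mem
    have h4 := P.N_ge l
    have n1 := fun e => hli (P.L_inj _ _ e).symm
    have n2 := fun e => hli (P.L_inj _ _ e)
    have h5 := P.tri l ((1 : G) • x) (L i) (k • x) (P.x_ne _ _) n1 (P.x_ne _ _)
    have h6 := P.behr l i (k • x) hli (P.x_ne _ _) (P.x_ne _ _) (by omega)
    have h7 := P.tri i (b • x) (L l) (k • x) (P.x_ne _ _) n2 (P.x_ne _ _)
    omega

theorem good_red {l : ι} {k : G} (hr : Red R H S l k) :
    ∀ a ∈ H, Good R D (fun i => N i - 10 * θ) x (a * k) := by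
  have hθ := P.θ_pos
  induction hr with
  | base b s k i hb hi hs hs1 hk =>
    intro a ha
    have := P.ping hH hS hout hl
      (Red.base (a * b) s k i (H.mul_mem ha hb) hi hs hs1 hk) 1 H.one_mem
    rw [one_smul] at this
    refine .step _ ((a * b) * s⁻¹ * (a * b)⁻¹) ((a * b) • i)
      (P.R_smul _ _ _ ((R i).inv_mem hs)) ?_ ?_
    · rw [show a * (b * s * k) = a * b * s * k by group]; omega
    · rw [show a * b * s⁻¹ * (a * b)⁻¹ * (a * (b * s * k)) = a * b * k by group]
      exact hH.1 _ (H.mul_mem (H.mul_mem ha hb) hk)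
  | cons b s k i l hb hi hs hs1 hk hli ih =>
    intro a ha
    have := P.ping hH hS hout hl
      (Red.cons (a * b) s k i l (H.mul_mem ha hb) hi hs hs1 hk hli) 1 H.one_mem
    rw [one_smul] at this
    refine .step _ ((a * b) * s⁻¹ * (a * b)⁻¹) ((a * b) • i)
      (P.R_smul _ _ _ ((R i).inv_mem hs)) ?_ ?_
    · rw [show a * (b * s * k) = a * b * s * k by group]; omega
    · rw [show a * b * s⁻¹ * (a * b)⁻¹ * (a * (b * s * k)) = a * b * k by group]
      exact ih _ (H.mul_mem ha hb)

include hK in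
theorem small_red {l : ι} {k : G} (hr : Red R H S l k) :
    ∀ j, ¬ R j ≤ H ⊔ ⨆ i ∈ S, R i → ∀ g : G, (∃ a ∈ H, D l (g • x) (a • x) ≤ 8 * θ) →
      D j (g • x) (L l) ≤ 5 * θ → D j (g • x) (k • x) ≤ 6 * θ := by
  have hθ := P.θ_pos
  have hle : H ≤ H ⊔ ⨆ i ∈ S, R i := le_sup_left
  have hRle : ∀ i ∈ S, R i ≤ H ⊔ ⨆ i ∈ S, R i := fun i hi =>
    le_trans (le_iSup₂ (f := fun i _ => R i) i hi) le_sup_right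
  have hSne : ∀ j, ¬ R j ≤ H ⊔ ⨆ i ∈ S, R i → ∀ i ∈ S, j ≠ i := by
    rintro j hj i hi rfl; exact hj (hRle _ hi)
  have common : ∀ (a s k : G) (i : ι), a ∈ H → i ∈ S → s ∈ R i → s ≠ 1 →
      (∀ b ∈ H, N (a • i) - 8 * θ ≤ D (a • i) (b • x) ((a * s * k) • x)) →
      ∀ j, ¬ R j ≤ H ⊔ ⨆ i ∈ S, R i → ∀ g : G,
      (∃ b ∈ H, D (a • i) (g • x) (b • x) ≤ 8 * θ) → D j (g • x) (L (a • i)) ≤ 5 * θ →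
      (∀ j' (g' : G), ¬ R j' ≤ H ⊔ ⨆ i ∈ S, R i → D j' (g' • x) (L i) ≤ θ →
        N i - 16 * θ ≤ D i (g' • x) (k • x) → D j' (g' • x) (k • x) ≤ 6 * θ) →
      D j (g • x) ((a * s * k) • x) ≤ 6 * θ := by
    intro a s k i ha hi hs hs1 hping j hj g ⟨b, hb, hgb⟩ hgl hrec
    have haS := hS a ha i hi
    have hne := hSne j hj _ haS
    have nl : L j ≠ L (a • i) := fun e => hne (P.L_inj _ _ e)
    have h1 := hping b hb
    have h2 := P.N_ge (a • i)
    have h3 := P.tri (a • i) (b • x) (g • x) ((a * s * k) • x) (P.x_ne _ _) (P.x_ne _ _)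
      (P.x_ne _ _)
    rw [P.symm _ (b • x) (g • x)] at h3
    by_cases hc : θ < D (a • i) (L j) ((a * s * k) • x)
    · have h4 := P.behr (a • i) j _ hne.symm (P.x_ne _ _) (P.x_ne _ _) hc
      have h5 := P.tri j (g • x) (L (a • i)) ((a * s * k) • x) (P.x_ne _ _) nl.symm (P.x_ne _ _)
      omega
    · have h4 := P.tri (a • i) (g • x) (L j) ((a * s * k) • x) (P.x_ne _ _) nl (P.x_ne _ _)
      have h5 := P.behr (a • i) j (g • x) hne.symm (P.x_ne _ _) (P.x_ne _ _)
        (by rw [P.symm]; omega)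
      have fix : (a * s)⁻¹ • (a • i) = i := by
        rw [inv_smul_eq_iff, mul_smul, P.R_fix i s hs]
      have h6 := hrec ((a * s)⁻¹ • j) ((a * s)⁻¹ * g)
        (by rwa [P.R_smul_le (Subgroup.inv_mem _ (Subgroup.mul_mem _ (hle ha) (hRle i hi hs)))])
        (by
          have := P.equiv' (a * s) j (g • x) (L (a • i))
          rw [← P.L_smul, fix, smul_smul] at this
          rw [this, P.symm]; exact h5)
        (by
          have := P.equiv' (a * s) (a • i) (g • x) ((a * s * k) • x)
          rw [fix, smul_smul, smul_smul, inv_mul_cancel_left] at this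
          rw [this]; rw [P.N_smul] at *; omega)
      have := P.equiv' (a * s) j (g • x) ((a * s * k) • x)
      rw [smul_smul, smul_smul, inv_mul_cancel_left] at this
      omega
  induction hr with
  | base a s k i ha hi hs hs1 hk =>
    have hp := P.ping hH hS hout hl (Red.base a s k i ha hi hs hs1 hk)
    intro j hj g hg hgl
    refine common a s k i ha hi hs hs1 hp j hj g hg hgl fun j' g' hj' h1 h2 => ?_
    have hne := hSne j' hj' i hi
    have hjS : j' ∉ S := fun e => hSne j' hj' _ e rfl
    have hjH : ¬ R j' ≤ H := fun e => hj' (e.trans hle)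
    have h3 := P.line_near (B := 2 * θ) hl hi hjH hne (hK j' hjH hjS) hk
    have h4 := P.tri j' (g' • x) (L i) (k • x) (P.x_ne _ _) (fun e => hne (P.L_inj _ _ e).symm)
      (P.x_ne _ _)
    rw [P.symm] at h3
    omega
  | cons a s k i l ha hi hs hs1 hk hli ih =>
    have hp := P.ping hH hS hout hl (Red.cons a s k i l ha hi hs hs1 hk hli)
    intro j hj g hg hgl
    refine common a s k i ha hi hs hs1 hp j hj g hg hgl fun j' g' hj' h1 h2 => ?_
    have hlS := red_mem hS hk
    have hjS : j' ∉ S := fun e => hSne j' hj' _ e rfl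
    have hjH : ¬ R j' ≤ H := fun e => hj' (e.trans hle)
    have n1 : L i ≠ L l := fun e => hli (P.L_inj _ _ e).symm
    have n2 := hSne j' hj' i hi
    have n3 := hSne j' hj' l hlS
    have n2' : L i ≠ L j' := fun e => n2 (P.L_inj _ _ e).symm
    have n3' : L l ≠ L j' := fun e => n3 (P.L_inj _ _ e).symm
    have a1 := P.line_near (B := 2 * θ) hl hi hjH n2 (hK j' hjH hjS) H.one_mem
    have a2 := P.line_near (B := 2 * θ) hl hlS hjH n3 (hK j' hjH hjS) H.one_mem
    have a3 := P.line_near (B := 6 * θ) hl hi (hout l hlS) hli (hH.2 l (hout l hlS)) H.one_mem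
    have a4 := P.ping hH hS hout hl hk 1 H.one_mem
    have a5 := P.N_ge l
    have a6 := P.N_ge i
    have a7 := P.tri l ((1 : G) • x) (L i) (k • x) (P.x_ne _ _) n1 (P.x_ne _ _)
    have a8 := P.behr l i (k • x) hli (P.x_ne _ _) (P.x_ne _ _) (by omega)
    have a9 := P.tri i (g' • x) (L l) (k • x) (P.x_ne _ _) n1.symm (P.x_ne _ _)
    have b1 := P.behr i l (g' • x) hli.symm (P.x_ne _ _) (P.x_ne _ _) (by rw [P.symm]; omega)
    obtain ⟨h, hh, b2⟩ := hl l hlS j' hjH n3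
    obtain ⟨h', hh', b3⟩ := hl i hi j' hjH n2
    have b4 := hK j' hjH hjS h' hh' h hh
    have b5 := P.tri j' (L i) (h' • x) (L l) n2' (P.x_ne _ _) n3'
    have b6 := P.tri j' (h' • x) (h • x) (L l) (P.x_ne _ _) (P.x_ne _ _) n3'
    have b7 := P.tri j' (g' • x) (L i) (L l) (P.x_ne _ _) n2' n3'
    rw [P.symm _ (L i) (h' • x)] at b5
    refine ih j' hj' g' ⟨1, H.one_mem, ?_⟩ (by omega)
    have b8 := P.tri l (g' • x) (L i) ((1 : G) • x) (P.x_ne _ _) n1 (P.x_ne _ _)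
    rw [P.symm _ (L i) ((1 : G) • x), P.symm _ (g' • x) (L i)] at b8
    omega

include hK in
theorem step : State R D N θ x (H ⊔ ⨆ i ∈ S, R i) := by
  have hθ := P.θ_pos
  have hle : H ≤ H ⊔ ⨆ i ∈ S, R i := le_sup_left
  refine ⟨fun k hk => ?_, fun j hj a ha b hb => ?_⟩
  · rcases P.red_of_mem hk with hk | ⟨l, hk⟩
    · exact hH.1 k hk
    · simpa using P.good_red hH hS hout hl hk 1 H.one_mem
  · have key : ∀ j, ¬ R j ≤ H ⊔ ⨆ i ∈ S, R i → ∀ k ∈ H ⊔ ⨆ i ∈ S, R i,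
        D j ((1 : G) • x) (k • x) ≤ 6 * θ := by
      intro j hj k hk
      have hjH : ¬ R j ≤ H := fun e => hj (e.trans hle)
      rcases P.red_of_mem hk with hk | ⟨l, hr⟩
      · exact hH.2 j hjH _ H.one_mem k hk
      · have hlS := red_mem hS hr
        have hRle : ∀ i ∈ S, R i ≤ H ⊔ ⨆ i ∈ S, R i := fun i hi =>
          le_trans (le_iSup₂ (f := fun i _ => R i) i hi) le_sup_right
        have hjS : j ∉ S := fun e => hj (hRle _ e)
        have h1 := P.line_near (B := 2 * θ) hl hlS hjH (by rintro rfl; exact hjS hlS)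
          (hK j hjH hjS) H.one_mem
        have h2 := P.self l 1
        exact P.small_red hH hS hout hK hl hr j hj 1 ⟨1, H.one_mem, by omega⟩ (by omega)
    have := key (a⁻¹ • j) (by rwa [P.R_smul_le (Subgroup.inv_mem _ ha)]) (a⁻¹ * b)
      (Subgroup.mul_mem _ (Subgroup.inv_mem _ ha) hb)
    have e := P.equiv' a j (a • x) (b • x)
    rw [smul_smul, smul_smul, inv_mul_cancel] at e
    omega
end step

/-- Every element of the subgroup generated by all rotations can be reduced. -/
theorem windmill : ∀ k ∈ ⨆ i, R i, Good R D (fun i => N i - 10 * θ) x k := by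
  have hθ := P.θ_pos
  obtain ⟨H, -, hmax⟩ := zorn_le_nonempty₀ {H | State R D N θ x H} (by
    intro c hc hchain H0 hH0
    refine ⟨sSup c, ⟨fun k hk => ?_, fun j hj a ha b hb => ?_⟩, fun z hz => le_sSup hz⟩
    · rw [Subgroup.mem_sSup_of_directedOn ⟨_, hH0⟩ hchain.directedOn] at hk
      obtain ⟨H, hH, hk⟩ := hk
      exact (hc hH).1 k hk
    · rw [Subgroup.mem_sSup_of_directedOn ⟨_, hH0⟩ hchain.directedOn] at ha hb
      obtain ⟨H1, hH1, ha⟩ := ha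
      obtain ⟨H2, hH2, hb⟩ := hb
      obtain ⟨H3, hH3, h1, h2⟩ := hchain.directedOn H1 hH1 H2 hH2
      exact (hc hH3).2 j (fun e => hj (e.trans (le_sSup hH3))) a (h1 ha) b (h2 hb))
    ⊥ (by
      refine ⟨fun k hk => ?_, fun j hj a ha b hb => ?_⟩
      · rw [Subgroup.mem_bot.1 hk]; exact .one
      · rw [Subgroup.mem_bot.1 ha, Subgroup.mem_bot.1 hb]
        have := P.self j 1
        omega)
  have hH : State R D N θ x H := hmax.prop
  have absorb : ∀ S : Set ι, (∀ h ∈ H, ∀ i ∈ S, h • i ∈ S) → (∀ i ∈ S, ¬ R i ≤ H) →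
      (∀ j, ¬ R j ≤ H → j ∉ S → ∀ a ∈ H, ∀ b ∈ H, D j (a • x) (b • x) ≤ 2 * θ) →
      (∀ l ∈ S, ∀ j, ¬ R j ≤ H → j ≠ l → ∃ h ∈ H, D j (h • x) (L l) ≤ θ) → S = ∅ := by
    intro S hS hout hK hl
    have h1 := hmax.le_of_ge (P.step hH hS hout hK hl) le_sup_left
    rw [Set.eq_empty_iff_forall_notMem]
    intro i hi
    exact hout i hi ((le_trans (le_iSup₂ (f := fun i _ => R i) i hi) le_sup_right).trans h1)
  have small : ∀ j, ¬ R j ≤ H → ∀ a ∈ H, ∀ b ∈ H, D j (a • x) (b • x) ≤ 2 * θ := by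
    by_contra hcon
    push Not at hcon
    obtain ⟨j, hj, a, ha, b, hb, hlt⟩ := hcon
    have := absorb {j | ¬ R j ≤ H ∧ ∃ a ∈ H, ∃ b ∈ H, 2 * θ < D j (a • x) (b • x)} ?_ ?_ ?_ ?_
    · exact absurd (show j ∈ (∅ : Set ι) from this ▸ ⟨hj, a, ha, b, hb, hlt⟩) (by simp)
    · rintro h hh i ⟨hi, a, ha, b, hb, hlt⟩
      refine ⟨by rwa [P.R_smul_le hh], h * a, H.mul_mem hh ha, h * b, H.mul_mem hh hb, ?_⟩
      rwa [mul_smul, mul_smul, P.equiv]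
    · exact fun i hi => hi.1
    · intro j hj hjS a ha b hb
      by_contra hlt
      exact hjS ⟨hj, a, ha, b, hb, by omega⟩
    · rintro l ⟨hl, a, ha, b, hb, hlt⟩ j hj hjl
      have nl : L j ≠ L l := fun e => hjl (P.L_inj _ _ e)
      have h1 := P.tri l (a • x) (L j) (b • x) (P.x_ne _ _) nl (P.x_ne _ _)
      by_cases h2 : θ < D l (L j) (b • x)
      · refine ⟨b, hb, ?_⟩
        rw [P.symm]
        exact P.behr l j _ hjl.symm (P.x_ne _ _) (P.x_ne _ _) h2
      · refine ⟨a, ha, ?_⟩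
        rw [P.symm]
        exact P.behr l j _ hjl.symm (P.x_ne _ _) (P.x_ne _ _) (by rw [P.symm]; omega)
  have all : ∀ j, R j ≤ H := by
    by_contra hcon
    push Not at hcon
    obtain ⟨l, hl, h, hh, hsel⟩ := P.select H {j | ¬ R j ≤ H} hcon
    have := absorb {i | ∃ g ∈ H, g • l = i} ?_ ?_ ?_ ?_
    · exact absurd (show l ∈ (∅ : Set ι) from this ▸ ⟨1, H.one_mem, one_smul _ _⟩) (by simp)
    · rintro a ha _ ⟨g, hg, rfl⟩
      exact ⟨a * g, H.mul_mem ha hg, mul_smul _ _ _⟩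
    · rintro _ ⟨g, hg, rfl⟩
      rwa [P.R_smul_le hg]
    · exact fun j hj _ => small j hj
    · rintro _ ⟨g, hg, rfl⟩ j hj hjl
      refine ⟨g * h, H.mul_mem hg hh, ?_⟩
      have := hsel (g⁻¹ • j) (by simpa [P.R_smul_le (H.inv_mem hg)] using hj)
        (by rwa [Ne, inv_smul_eq_iff])
      rw [← P.equiv g, smul_inv_smul, ← P.L_smul, smul_smul] at this
      exact this
  exact fun k hk => hH.1 k (iSup_le all hk)

end ProjSys
end PG

namespace PG

/-- A family of coarsely convex lines in `G` with rotations about them. -/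
structure Fam {G ι : Type} [Group G] [MulAction G ι] (d : G → G → ℤ) (Y : ι → Set G)
    (R : ι → Subgroup G) (N : ι → ℤ) (c N0 : ℤ) : Prop where
  hm : HM d c
  c_pos : 2200 ≤ c
  N_big : 800 * c ≤ N0
  Y_smul : ∀ (g : G) i x, x ∈ Y i → g * x ∈ Y (g • i)
  R_smul : ∀ (g : G) i s, s ∈ R i → g * s * g⁻¹ ∈ R (g • i)
  R_fix : ∀ i s, s ∈ R i → s • i = i
  N_smul : ∀ (g : G) i, N (g • i) = N i
  N_ge : ∀ i, N0 ≤ N i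
  gate : ∀ i x, ∃ p, Gate d 2200 (Y i) x p
  overlap : ∀ i j, i ≠ j → ∀ y ∈ Y j, ∀ y' ∈ Y j, ∀ p p', Gate d 2200 (Y i) y p →
    Gate d 2200 (Y i) y' p' → d p p' ≤ c
  spin : ∀ i s y, s ∈ R i → s ≠ 1 → y ∈ Y i → N i ≤ d y (s * y)

/-- The points of a line or of a one-point object. -/
def pts {G ι : Type} (Y : ι → Set G) : ι ⊕ G → Set G
  | .inl i => Y i
  | .inr g => {g}

/-- The set of distances between projections to `Y i` of points of two objects. -/
def prSet {G ι : Type} (d : G → G → ℤ) (Y : ι → Set G) (c : ℤ) (i : ι) (a b : ι ⊕ G) : Set ℤ :=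
  {t | ∃ x ∈ pts Y a, ∃ y ∈ pts Y b, ∃ p q, Gate d c (Y i) x p ∧ Gate d c (Y i) y q ∧ t = d p q}

namespace Fam
variable {G ι : Type} [Group G] [MulAction G ι] {d : G → G → ℤ} {Y : ι → Set G}
    {R : ι → Subgroup G} {N : ι → ℤ} {c N0 : ℤ} (F : Fam d Y R N c N0)
include F

theorem Y_smul_iff (g : G) (i : ι) (x : G) : g * x ∈ Y (g • i) ↔ x ∈ Y i := by
  refine ⟨fun h => ?_, F.Y_smul g i x⟩
  have := F.Y_smul g⁻¹ _ _ h
  simpa using this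

theorem gate_smul {i : ι} {x p : G} (g : G) (hp : Gate d 2200 (Y i) x p) :
    Gate d 2200 (Y (g • i)) (g * x) (g * p) := by
  refine ⟨F.Y_smul _ _ _ hp.1, fun y hy => ?_⟩
  have := hp.2 (g⁻¹ * y) (by rw [← F.Y_smul_iff g]; simpa using hy)
  rw [← F.hm.inv g x, ← F.hm.inv g p, ← F.hm.inv g x] at this
  simpa using this

theorem behr_pt {i j : ι} (hij : i ≠ j) {x y z p a q b : G} (hy : y ∈ Y j) (hz : z ∈ Y i)
    (hp : Gate d 2200 (Y i) x p) (ha : Gate d 2200 (Y i) y a) (hq : Gate d 2200 (Y j) x q)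
    (hb : Gate d 2200 (Y j) z b) : d p a ≤ 6 * c ∨ d q b ≤ 6 * c := by
  by_contra! hcon
  have hc := F.c_pos
  obtain ⟨b', hb'⟩ := F.gate j p
  obtain ⟨a', ha'⟩ := F.gate i q
  have h1 := F.overlap j i hij.symm z hz p hp.1 b b' hb hb'
  have h2 := F.overlap i j hij y hy q hq.1 a a' ha ha'
  have h3 := F.hm.tri q b' b
  have h4 := F.hm.tri p a' a
  have := F.hm.symm b b'
  have := F.hm.symm a a'
  have h5 := F.hm.gate_cross hq hb' (by omega)
  have h6 := F.hm.gate_cross hp ha' (by omega)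
  have := F.hm.nn b' p
  have := F.hm.nn a' q
  omega

theorem pts_close {i : ι} {a : ι ⊕ G} (ha : a ≠ .inl i) {x x' p p' : G} (hx : x ∈ pts Y a)
    (hx' : x' ∈ pts Y a) (hp : Gate d 2200 (Y i) x p) (hp' : Gate d 2200 (Y i) x' p') : d p p' ≤ c := by
  rcases a with j | g
  · exact F.overlap i j (fun e => ha (by rw [e])) x hx x' hx' _ _ hp hp'
  · rw [pts, Set.mem_singleton_iff] at hx hx'
    subst hx; subst hx'
    exact (F.hm.gate_unique hp hp').trans F.c_pos

theorem pts_ne (a : ι ⊕ G) : (pts Y a).Nonempty := by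
  rcases a with j | g
  · obtain ⟨p, hp⟩ := F.gate j 1; exact ⟨p, hp.1⟩
  · exact ⟨g, rfl⟩

theorem prSet_ne (i : ι) (a b : ι ⊕ G) : (prSet d Y 2200 i a b).Nonempty := by
  obtain ⟨x, hx⟩ := F.pts_ne a
  obtain ⟨y, hy⟩ := F.pts_ne b
  obtain ⟨p, hp⟩ := F.gate i x
  obtain ⟨q, hq⟩ := F.gate i y
  exact ⟨_, x, hx, y, hy, p, q, hp, hq, rfl⟩

theorem prSet_close {i : ι} {a b : ι ⊕ G} (ha : a ≠ .inl i) (hb : b ≠ .inl i) {s t : ℤ}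
    (hs : s ∈ prSet d Y 2200 i a b) (ht : t ∈ prSet d Y 2200 i a b) : s ≤ t + 2 * c := by
  obtain ⟨x, hx, y, hy, p, q, hp, hq, rfl⟩ := hs
  obtain ⟨x', hx', y', hy', p', q', hp', hq', rfl⟩ := ht
  have h1 := F.pts_close ha hx hx' hp hp'
  have h2 := F.pts_close hb hy hy' hq hq'
  have := F.hm.tri p p' q
  have := F.hm.tri p' q' q
  have := F.hm.symm q q'
  omega

theorem prSet_bdd {i : ι} {a b : ι ⊕ G} (ha : a ≠ .inl i) (hb : b ≠ .inl i) :
    BddAbove (prSet d Y 2200 i a b) := by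
  obtain ⟨t, ht⟩ := F.prSet_ne i a b
  exact ⟨t + 2 * c, fun s hs => F.prSet_close ha hb hs ht⟩

theorem sSup_mem {i : ι} {a b : ι ⊕ G} (ha : a ≠ .inl i) (hb : b ≠ .inl i) :
    sSup (prSet d Y 2200 i a b) ∈ prSet d Y 2200 i a b :=
  Int.csSup_mem (F.prSet_ne i a b) (F.prSet_bdd ha hb)

theorem prSet_symm (i : ι) (a b : ι ⊕ G) : prSet d Y 2200 i a b = prSet d Y 2200 i b a := by
  ext t
  constructor <;> rintro ⟨x, hx, y, hy, p, q, hp, hq, rfl⟩ <;>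
    exact ⟨y, hy, x, hx, q, p, hq, hp, F.hm.symm _ _⟩

theorem pts_smul (g : G) (a : ι ⊕ G) (x : G) (hx : x ∈ pts Y a) : g * x ∈ pts Y (g • a) := by
  rcases a with j | y
  · exact F.Y_smul g j x hx
  · rw [pts, Set.mem_singleton_iff] at hx; subst hx; rfl

theorem prSet_smul (g : G) (i : ι) (a b : ι ⊕ G) :
    prSet d Y 2200 (g • i) (g • a) (g • b) = prSet d Y 2200 i a b := by
  have key : ∀ (g : G) i a b, prSet d Y 2200 i a b ⊆ prSet d Y 2200 (g • i) (g • a) (g • b) := by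
    rintro g i a b _ ⟨x, hx, y, hy, p, q, hp, hq, rfl⟩
    exact ⟨_, F.pts_smul g a x hx, _, F.pts_smul g b y hy, _, _, F.gate_smul g hp,
      F.gate_smul g hq, (F.hm.inv _ _ _).symm⟩
  refine (Set.Subset.antisymm (key g i a b) ?_).symm
  have := key g⁻¹ (g • i) (g • a) (g • b)
  simpa only [inv_smul_smul] using this

theorem projSys (x : G) : ProjSys (G := G) (ob := ι ⊕ G) (.inl) R
    (fun i a b => sSup (prSet d Y 2200 i a b)) N (8 * c) (.inr x) where
  L_smul g i := rfl
  L_inj i j h := Sum.inl_injective h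
  x_ne g i := by simp [Sum.smul_inr]
  R_smul := F.R_smul
  R_fix := F.R_fix
  N_smul := F.N_smul
  N_ge i := by have := F.N_ge i; have := F.N_big; omega
  θ_pos := by have := F.c_pos; omega
  self i g := by
    have hc := F.c_pos
    obtain ⟨x', hx, y', hy, p, q, hp, hq, h⟩ := F.sSup_mem (i := i) (a := g • .inr x)
      (b := g • .inr x) (by simp [Sum.smul_inr]) (by simp [Sum.smul_inr])
    rw [h]
    have := F.pts_close (i := i) (a := g • .inr x) (by simp [Sum.smul_inr]) hx hy hp hq
    omega
  symm i a b := by rw [F.prSet_symm]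
  tri i a b e ha hb he := by
    obtain ⟨x, hx, z, hz, p, q, hp, hq, h⟩ := F.sSup_mem ha he
    obtain ⟨y, hy⟩ := F.pts_ne b
    obtain ⟨r, hr⟩ := F.gate i y
    rw [h]
    have h1 := le_csSup (F.prSet_bdd ha hb) ⟨x, hx, y, hy, p, r, hp, hr, rfl⟩
    have h2 := le_csSup (F.prSet_bdd hb he) ⟨y, hy, z, hz, r, q, hr, hq, rfl⟩
    have := F.hm.tri p r q
    omega
  equiv g i a b := by rw [F.prSet_smul]
  behr i j a hij hai haj hlt := by
    have hc := F.c_pos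
    have nj : (Sum.inl j : ι ⊕ G) ≠ .inl i := fun e => hij (Sum.inl_injective e).symm
    have ni : (Sum.inl i : ι ⊕ G) ≠ .inl j := fun e => hij (Sum.inl_injective e)
    obtain ⟨y, hy, x, hx, p, q, hp, hq, h⟩ := F.sSup_mem nj hai
    obtain ⟨z, hz, x', hx', r, s, hr, hs, h'⟩ := F.sSup_mem ni haj
    rw [h] at hlt
    rw [h']
    obtain ⟨s', hs'⟩ := F.gate j x
    have := F.pts_close haj hx hx' hs' hs
    have := F.hm.symm p q
    have := F.hm.symm r s'
    have := F.hm.tri r s' s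
    rcases F.behr_pt hij hy hz hq hp hs' hr with h1 | h1 <;> omega
  spin i s a hs hs1 ha := by
    obtain ⟨x, hx⟩ := F.pts_ne a
    obtain ⟨p, hp⟩ := F.gate i x
    refine (F.spin i s p hs hs1 hp.1).trans (le_csSup (F.prSet_bdd ha ?_) ?_)
    · intro e
      apply ha
      rw [smul_eq_iff_eq_inv_smul] at e
      rw [e, Sum.smul_inl, F.R_fix i _ ((R i).inv_mem hs)]
    · have := F.gate_smul s hp
      rw [F.R_fix i s hs] at this
      exact ⟨x, hx, _, F.pts_smul s a x hx, p, _, hp, this, rfl⟩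
  select H S hS := by
    have hc := F.c_pos
    have hex : ∃ m : ℕ, ∃ l ∈ S, ∃ h ∈ H, ∃ z ∈ Y l, d (h * x) z = m := by
      obtain ⟨l, hl⟩ := hS
      obtain ⟨z, hz⟩ := F.gate l 1
      exact ⟨(d (1 * x) z).toNat, l, hl, 1, H.one_mem, z, hz.1,
        (Int.toNat_of_nonneg (F.hm.nn _ _)).symm⟩
    classical
    obtain ⟨l, hl, h, hh, z, hz, hm⟩ := Nat.find_spec hex
    refine ⟨l, hl, h, hh, fun j hj hjl => ?_⟩
    have nl : (Sum.inl l : ι ⊕ G) ≠ .inl j := fun e => hjl (Sum.inl_injective e).symm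
    have nx : (h • Sum.inr x : ι ⊕ G) ≠ .inl j := by simp [Sum.smul_inr]
    obtain ⟨y, hy, w, hw, p, q, hp, hq, e⟩ := F.sSup_mem nx nl
    rw [e]
    rw [Sum.smul_inr, pts, Set.mem_singleton_iff] at hy
    subst hy
    obtain ⟨q', hq'⟩ := F.gate j z
    have := F.pts_close nl hw hz hq hq'
    have := F.hm.tri p q' q
    have := F.hm.symm q q'
    by_contra hlt
    have h1 := F.hm.gate_cross hp hq' (by omega)
    have := F.hm.nn q' z
    have := Nat.find_min' hex (m := (d (h * x) p).toNat)
      ⟨j, hj, h, hh, p, hp.1, (Int.toNat_of_nonneg (F.hm.nn _ _)).symm⟩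
    have := Int.toNat_of_nonneg (F.hm.nn (h * x) p)
    simp only [smul_eq_mul] at *
    omega

/-- A chosen projection to the `i`-th line. -/
noncomputable def pr (i : ι) (x : G) : G := (F.gate i x).choose

theorem pr_gate (i : ι) (x : G) : Gate d 2200 (Y i) x (F.pr i x) := (F.gate i x).choose_spec

/-- The distance of the projections of two points to the `i`-th line. -/
noncomputable def dI (i : ι) (x y : G) : ℤ := d (F.pr i x) (F.pr i y)

theorem dI_tri (i : ι) (x y z : G) : F.dI i x z ≤ F.dI i x y + F.dI i y z := F.hm.tri _ _ _

theorem dI_symm (i : ι) (x y : G) : F.dI i x y = F.dI i y x := F.hm.symm _ _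

theorem dI_self (i : ι) (x : G) : F.dI i x x = 0 := F.hm.self _

theorem dI_lip (i : ι) (x y : G) : F.dI i x y ≤ d x y + 3 * c := by
  have hc := F.c_pos
  have := F.hm.gate_lip (F.pr_gate i x) (F.pr_gate i y); unfold dI; omega

theorem dI_gate {i : ι} {x y p q : G} (hp : Gate d 2200 (Y i) x p) (hq : Gate d 2200 (Y i) y q) :
    |F.dI i x y - d p q| ≤ 2 * c := by
  have hc := F.c_pos
  have := F.hm.gate_unique hp (F.pr_gate i x)
  have := F.hm.gate_unique hq (F.pr_gate i y)
  have := F.hm.tri p (F.pr i x) q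
  have := F.hm.tri (F.pr i x) (F.pr i y) q
  have := F.hm.tri (F.pr i x) p (F.pr i y)
  have := F.hm.tri p q (F.pr i y)
  have := F.hm.symm p (F.pr i x)
  have := F.hm.symm q (F.pr i y)
  unfold dI; rw [abs_le]; constructor <;> omega

theorem dI_smul (g : G) (i : ι) (x y : G) :
    |F.dI (g • i) (g * x) (g * y) - F.dI i x y| ≤ 2 * c := by
  have := F.dI_gate (F.gate_smul g (F.pr_gate i x)) (F.gate_smul g (F.pr_gate i y))
  rwa [F.hm.inv] at this

theorem dI_near {i : ι} {x y : G} (hx : x ∈ Y i) (hy : y ∈ Y i) : |F.dI i x y - d x y| ≤ c := by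
  have hc := F.c_pos
  have := F.hm.gate_self hx (F.pr_gate i x)
  have := F.hm.gate_self hy (F.pr_gate i y)
  have := F.hm.tri x (F.pr i x) y
  have := F.hm.tri (F.pr i x) (F.pr i y) y
  have := F.hm.tri (F.pr i x) x (F.pr i y)
  have := F.hm.tri x y (F.pr i y)
  have := F.hm.symm x (F.pr i x)
  have := F.hm.symm y (F.pr i y)
  unfold dI; rw [abs_le]; constructor <;> omega

end Fam

/-- `k` can be reduced to `1` by rotations about lines on which the projections of `x` and `k x`
are far apart. -/
inductive GoodF {G ι : Type} [Group G] (R : ι → Subgroup G) (D : ι → G → G → ℤ) (N : ι → ℤ)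
    (x : G) : G → Prop
  | one : GoodF R D N x 1
  | step (k g : G) (i : ι) (hg : g ∈ R i) (hD : N i ≤ D i x (k * x))
      (hk : GoodF R D N x (g * k)) : GoodF R D N x k

namespace Fam
variable {G ι : Type} [Group G] [MulAction G ι] {d : G → G → ℤ} {Y : ι → Set G}
    {R : ι → Subgroup G} {N : ι → ℤ} {c N0 : ℤ} (F : Fam d Y R N c N0)
include F

theorem good (x k : G) (hk : k ∈ ⨆ i, R i) : GoodF R F.dI (fun i => N i - 100 * c) x k := by
  have hc := F.c_pos
  induction (F.projSys x).windmill k hk with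
  | one => exact .one
  | step k g i hg hD hk ih =>
    refine .step k g i hg ?_ (ih ?_)
    · obtain ⟨x', hx, y', hy, p, q, hp, hq, h⟩ := F.sSup_mem (i := i) (a := .inr x)
        (b := k • .inr x) (by simp) (by simp [Sum.smul_inr])
      rw [h] at hD
      rw [pts, Set.mem_singleton_iff] at hx
      rw [Sum.smul_inr, pts, Set.mem_singleton_iff] at hy
      subst hx; subst hy
      have := F.dI_gate hp hq
      rw [abs_le] at this
      simp only [smul_eq_mul] at this
      omega
    · exact Subgroup.mul_mem _ (Subgroup.mem_iSup_of_mem i hg) ‹_›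

theorem normal : (⨆ i, R i).Normal := by
  refine ⟨fun s hs g => ?_⟩
  have : ⨆ i, R i ≤ (⨆ i, R i).comap (MulAut.conj g).toMonoidHom := by
    refine iSup_le fun i s hs => ?_
    exact Subgroup.mem_iSup_of_mem _ (F.R_smul g i s hs)
  exact this hs

/-- Nontrivial elements of the kernel move all points far away. -/
theorem kernel_far (x k : G) (hk : k ∈ ⨆ i, R i) (h1 : k ≠ 1) : N0 - 103 * c ≤ d x (k * x) := by
  cases F.good x k hk with
  | one => exact absurd rfl h1
  | step _ g i hg hD hk =>
    have := F.dI_lip i x (k * x)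
    have := F.N_ge i
    omega

end Fam
end PG

namespace PG

/-- `γ` is a path of length `n` from `x` to `y` for the relation `E`. -/
def IsPath {G : Type} (E : G → G → Prop) (γ : ℕ → G) (n : ℕ) (x y : G) : Prop :=
  γ 0 = x ∧ γ n = y ∧ ∀ m < n, E (γ m) (γ (m + 1))

/-- The path metric of the relation `E`. -/
noncomputable def pathD {G : Type} (E : G → G → Prop) (x y : G) : ℤ :=
  (sInf {n : ℕ | ∃ γ, IsPath E γ n x y} : ℕ)

section path
variable {G : Type} {E : G → G → Prop}

theorem pathD_le {γ : ℕ → G} {n : ℕ} {x y : G} (h : IsPath E γ n x y) : pathD E x y ≤ n := by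
  unfold pathD
  exact_mod_cast Nat.sInf_le (s := {n : ℕ | ∃ γ, IsPath E γ n x y}) ⟨γ, h⟩

theorem IsPath.sub {γ : ℕ → G} {n : ℕ} {x y : G} (h : IsPath E γ n x y) {a b : ℕ} (hab : a ≤ b)
    (hb : b ≤ n) : IsPath E (fun m => γ (a + m)) (b - a) (γ a) (γ b) :=
  ⟨rfl, by simp only [Nat.add_sub_cancel' hab], fun m hm => h.2.2 (a + m) (by omega)⟩

theorem IsPath.trans {γ γ' : ℕ → G} {n n' : ℕ} {x y z : G} (h : IsPath E γ n x y)
    (h' : IsPath E γ' n' y z) :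
    IsPath E (fun m => if m ≤ n then γ m else γ' (m - n)) (n + n') x z := by
  refine ⟨by simp [h.1], ?_, fun m hm => ?_⟩
  · by_cases h0 : n' = 0
    · subst h0; simp [h.2.1, ← h'.1, h'.2.1]
    · simp [show ¬ n + n' ≤ n by omega, h'.2.1]
  · rcases lt_trichotomy m n with h1 | h1 | h1
    · simpa [h1.le, show m + 1 ≤ n by omega] using h.2.2 m h1
    · subst h1
      have := h'.2.2 0 (by omega)
      rw [h'.1] at this
      simpa [h.2.1] using this
    · have := h'.2.2 (m - n) (by omega)
      simpa [show ¬ m ≤ n by omega, show ¬ m + 1 ≤ n by omega,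
        show m + 1 - n = m - n + 1 by omega] using this

theorem IsPath.reverse (hs : ∀ x y, E x y → E y x) {γ : ℕ → G} {n : ℕ} {x y : G}
    (h : IsPath E γ n x y) : IsPath E (fun m => γ (n - m)) n y x := by
  refine ⟨by simp [h.2.1], by simp [h.1], fun m hm => hs _ _ ?_⟩
  have := h.2.2 (n - (m + 1)) (by omega)
  rwa [show n - (m + 1) + 1 = n - m by omega] at this

theorem isPath_edge {x y : G} (h : E x y) : IsPath E (fun m => if m = 0 then x else y) 1 x y :=
  ⟨by simp, by simp, fun m hm => by simpa [show m = 0 by omega] using h⟩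

variable (hc : ∀ x y, ∃ n γ, IsPath E γ n x y)
include hc

theorem pathD_spec (x y : G) : ∃ n : ℕ, pathD E x y = n ∧ ∃ γ, IsPath E γ n x y :=
  ⟨_, rfl, Nat.sInf_mem (s := {n : ℕ | ∃ γ, IsPath E γ n x y}) (hc x y)⟩

theorem pathD_tri (x y z : G) : pathD E x z ≤ pathD E x y + pathD E y z := by
  obtain ⟨n, h, γ, hγ⟩ := pathD_spec hc x y
  obtain ⟨n', h', γ', hγ'⟩ := pathD_spec hc y z
  have := pathD_le (hγ.trans hγ')
  push_cast at this; omega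

/-- Vertices of a shortest path. -/
theorem pathD_sub {γ : ℕ → G} {n : ℕ} {x y : G} (h : IsPath E γ n x y) (hn : pathD E x y = n)
    {a b : ℕ} (hab : a ≤ b) (hb : b ≤ n) : pathD E (γ a) (γ b) = (b : ℤ) - a := by
  have h1 := pathD_le (h.sub hab hb)
  have h2 := pathD_le (h.sub (Nat.zero_le a) (hab.trans hb))
  have h3 := pathD_le (h.sub hb le_rfl)
  rw [h.1] at h2
  rw [h.2.1] at h3
  have h4 := pathD_tri hc x (γ a) y
  have h5 := pathD_tri hc (γ a) (γ b) y
  push_cast [hab, hb, hab.trans hb] at *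
  omega

end path

theorem pathD_nn {G : Type} (E : G → G → Prop) (x y : G) : 0 ≤ pathD E x y := by
  unfold pathD; positivity

/-- A path metric satisfies all the conditions but hyperbolicity. -/
theorem pathD_HM {G : Type} [Group G] {E : G → G → Prop} (hc : ∀ x y, ∃ n γ, IsPath E γ n x y)
    (hs : ∀ x y, E x y → E y x) (hi : ∀ g x y, E x y → E (g * x) (g * y)) {δ : ℤ}
    (hyp : ∀ x y z w, pathD E x z + pathD E y w ≤
      max (pathD E x y + pathD E z w) (pathD E x w + pathD E y z) + δ) : HM (pathD E) δ := by
  have hle : ∀ x y, pathD E x y ≤ pathD E y x := fun x y => by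
    obtain ⟨n, h, γ, hγ⟩ := pathD_spec hc y x
    rw [h]; exact pathD_le (hγ.reverse hs)
  have hil : ∀ g x y, pathD E (g * x) (g * y) ≤ pathD E x y := fun g x y => by
    obtain ⟨n, h, γ, hγ⟩ := pathD_spec hc x y
    rw [h]
    exact pathD_le (γ := fun m => g * γ m)
      ⟨congrArg (g * ·) hγ.1, congrArg (g * ·) hγ.2.1, fun m hm => hi _ _ _ (hγ.2.2 m hm)⟩
  refine ⟨fun x => ?_, fun x y h => ?_, fun x y => le_antisymm (hle x y) (hle y x),
    pathD_tri hc, fun g x y => le_antisymm (hil g x y) ?_, fun x y t h0 ht => ?_, hyp⟩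
  · have := pathD_le (E := E) (γ := fun _ => x) (n := 0) (x := x) (y := x)
      ⟨rfl, rfl, fun m hm => absurd hm (by omega)⟩
    have := pathD_nn E x x
    push_cast at *; omega
  · obtain ⟨n, h', γ, hγ⟩ := pathD_spec hc x y
    have : n = 0 := by omega
    subst this
    rw [← hγ.1, ← hγ.2.1]
  · simpa using hil g⁻¹ (g * x) (g * y)
  · obtain ⟨n, h', γ, hγ⟩ := pathD_spec hc x y
    have h1 := pathD_sub hc hγ h' (Nat.zero_le t.toNat) (by omega)
    have h2 := pathD_sub hc hγ h' (a := t.toNat) (b := n) (by omega) le_rfl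
    rw [hγ.1] at h1
    rw [hγ.2.1] at h2
    push_cast at h1
    refine ⟨γ t.toNat, by omega, by omega⟩

/-- Two points are adjacent if they are at distance at most `M` or lie on a line indexed by `W`. -/
def cEdge {G ι : Type} (d : G → G → ℤ) (Y : ι → Set G) (M : ℤ) (W : Set ι) (x y : G) : Prop :=
  d x y ≤ M ∨ ∃ i ∈ W, x ∈ Y i ∧ y ∈ Y i

/-- The cone-off metric. -/
noncomputable def cone {G ι : Type} (d : G → G → ℤ) (Y : ι → Set G) (M : ℤ) : G → G → ℤ :=
  pathD (cEdge d Y M Set.univ)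

theorem cone_nn {G ι : Type} (d : G → G → ℤ) (Y : ι → Set G) (M : ℤ) (x y : G) :
    0 ≤ cone d Y M x y := pathD_nn _ _ _

theorem cone_line {G ι : Type} {d : G → G → ℤ} {Y : ι → Set G} {M : ℤ} {i : ι} {x y : G}
    (hx : x ∈ Y i) (hy : y ∈ Y i) : cone d Y M x y ≤ 1 :=
  pathD_le (isPath_edge (.inr ⟨i, trivial, hx, hy⟩))

namespace Fam
variable {G ι : Type} [Group G] [MulAction G ι] {d : G → G → ℤ} {Y : ι → Set G}
    {R : ι → Subgroup G} {N : ι → ℤ} {c N0 : ℤ} (F : Fam d Y R N c N0) {M : ℤ} (hM : 100 * c ≤ M)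
include F

theorem cEdge_symm (W : Set ι) (x y : G) (h : cEdge d Y M W x y) : cEdge d Y M W y x := by
  rcases h with h | ⟨i, hi, h1, h2⟩
  · left; rwa [F.hm.symm]
  · exact .inr ⟨i, hi, h2, h1⟩

theorem cEdge_inv (g x y : G) (h : cEdge d Y M Set.univ x y) :
    cEdge d Y M Set.univ (g * x) (g * y) := by
  rcases h with h | ⟨i, _, h1, h2⟩
  · left; rwa [F.hm.inv]
  · exact .inr ⟨g • i, trivial, F.Y_smul _ _ _ h1, F.Y_smul _ _ _ h2⟩

include hM

theorem exists_path (k : ℕ) (x y : G) (h : d x y ≤ k * M) :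
    ∃ γ, IsPath (cEdge d Y M Set.univ) γ k x y := by
  have := F.c_pos
  induction k generalizing x with
  | zero =>
    have : x = y := F.hm.eq_of x y (by have := F.hm.nn x y; push_cast at h; omega)
    exact ⟨fun _ => x, rfl, this, fun m hm => absurd hm (by omega)⟩
  | succ k ih =>
    have := F.hm.nn x y
    push_cast at h
    obtain ⟨z, h1, h2⟩ := F.hm.geo x y (min M (d x y)) (by omega) (by omega)
    have h0 : 0 ≤ (k : ℤ) * M := mul_nonneg (by positivity) (by omega)
    obtain ⟨γ, hγ⟩ := ih z (by rw [h2]; rcases min_cases M (d x y) with h3 | h3 <;> linarith)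
    have := (isPath_edge (E := cEdge d Y M Set.univ) (x := x) (y := z) (.inl (by omega))).trans hγ
    rw [add_comm] at this
    exact ⟨_, this⟩

theorem conn (x y : G) : ∃ n γ, IsPath (cEdge d Y M Set.univ) γ n x y := by
  have := F.c_pos
  have := F.hm.nn x y
  refine ⟨(d x y).toNat, F.exists_path hM _ x y ?_⟩
  rw [Int.toNat_of_nonneg this]; nlinarith

theorem cone_le (x y : G) : M * cone d Y M x y ≤ d x y + M := by
  have := F.c_pos
  have h0 := F.hm.nn x y
  have hMp : 0 < M := by omega
  have h1 : d x y ≤ (d x y / M + 1) * M := by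
    have := Int.mul_ediv_add_emod (d x y) M
    have := Int.emod_lt_of_pos (d x y) hMp
    nlinarith
  have h2 : 0 ≤ d x y / M := Int.ediv_nonneg h0 hMp.le
  obtain ⟨γ, hγ⟩ := F.exists_path hM (d x y / M + 1).toNat x y (by
    rwa [Int.toNat_of_nonneg (by omega)])
  have h3 := pathD_le hγ
  rw [Int.toNat_of_nonneg (by omega)] at h3
  have := Int.mul_ediv_self_le (x := d x y) hMp.ne'
  unfold cone
  nlinarith

theorem cone_tri (x y z : G) : cone d Y M x z ≤ cone d Y M x y + cone d Y M y z :=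
  pathD_tri (F.conn hM) x y z

theorem cone_symm (x y : G) : cone d Y M x y = cone d Y M y x := by
  have hle : ∀ x y, cone d Y M x y ≤ cone d Y M y x := fun x y => by
    obtain ⟨n, h, γ, hγ⟩ := pathD_spec (F.conn hM) y x
    unfold cone
    rw [h]; exact pathD_le (hγ.reverse (F.cEdge_symm _))
  exact le_antisymm (hle _ _) (hle _ _)

/-- A point between the end points of a path of length at most `2 ^ k` is close to the path. -/
theorem near_path {γ : ℕ → G} {z : G} (k : ℕ) {a b : ℕ} (hab : a ≤ b) (hb : b ≤ a + 2 ^ k)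
    (hγ : ∀ m, a ≤ m → m < b → cEdge d Y M Set.univ (γ m) (γ (m + 1))) {e : ℤ}
    (hz : Bt d e (γ a) z (γ b)) :
    ∃ m, a ≤ m ∧ m ≤ b ∧ M * cone d Y M z (γ m) ≤ 2 * M + 2 * c + e + k * c := by
  have hc := F.c_pos
  induction k generalizing a b e with
  | zero =>
    have he : 0 ≤ e := by have := F.hm.tri (γ a) z (γ b); unfold Bt at hz; omega
    have key : d (γ a) z ≤ M + e → M * cone d Y M z (γ a) ≤ 2 * M + e := fun h => by
      have := F.cone_le hM z (γ a)
      have := F.hm.symm z (γ a); omega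
    refine ⟨a, le_rfl, hab, ?_⟩
    rcases eq_or_lt_of_le hab with h | h
    · subst h
      have := key (by
        have := F.hm.self (γ a); have := F.hm.nn (γ a) z
        have := F.hm.symm z (γ a); unfold Bt at hz; omega)
      push_cast; omega
    · have hb' : b = a + 1 := by simp at hb; omega
      subst hb'
      rcases hγ a le_rfl (by omega) with h1 | ⟨i, -, h1, h2⟩
      · have := key (by have := F.hm.nn z (γ (a + 1)); unfold Bt at hz; omega)
        push_cast; omega
      · obtain ⟨p, hp⟩ := F.gate i z
        have h3 := F.hm.gate_bt hz h1 h2 hp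
        have h4 := F.cone_le hM z p
        have h5 := F.cone_tri hM z p (γ a)
        have h6 := cone_line (d := d) (M := M) hp.1 h1
        push_cast
        nlinarith
  | succ k ih =>
    have he : 0 ≤ e := by have := F.hm.tri (γ a) z (γ b); unfold Bt at hz; omega
    rw [pow_succ] at hb
    rcases le_or_gt b (a + 2 ^ k) with h | h
    · obtain ⟨m, h1, h2, h3⟩ := ih hab h hγ hz
      refine ⟨m, h1, h2, h3.trans ?_⟩
      push_cast; nlinarith
    · rcases F.hm.split hz (γ (a + 2 ^ k)) with h1 | h1
      · obtain ⟨m, h1, h2, h3⟩ := ih (Nat.le_add_right _ _) le_rfl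
          (fun m h2 h3 => hγ m h2 (by omega)) h1
        refine ⟨m, h1, by omega, h3.trans ?_⟩
        push_cast; nlinarith
      · obtain ⟨m, h1, h2, h3⟩ := ih h.le (by omega) (fun m h2 h3 => hγ m (by omega) h3) h1
        refine ⟨m, by omega, by omega, h3.trans ?_⟩
        push_cast; nlinarith

end Fam
end PG

namespace PG
namespace Fam
variable {G ι : Type} [Group G] [MulAction G ι] {d : G → G → ℤ} {Y : ι → Set G}
    {R : ι → Subgroup G} {N : ι → ℤ} {c N0 : ℤ} (F : Fam d Y R N c N0) {M : ℤ} (hM : 100 * c ≤ M)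
include F hM

theorem cone_self (x : G) : cone d Y M x x = 0 := by
  have := F.cone_le hM x x
  have := F.hm.self x
  have := cone_nn d Y M x x
  have := F.c_pos
  have h := F.cone_tri hM x x x
  obtain ⟨γ, h⟩ := F.exists_path hM 0 x x (by simp [F.hm.self])
  have := pathD_le h
  unfold cone at *
  push_cast at *; omega

theorem cone_one {x y : G} (h : d x y ≤ M) : cone d Y M x y ≤ 1 :=
  pathD_le (isPath_edge (.inl h))

/-- Points on a geodesic, moving towards one end, at a prescribed distance in the cone-off. -/
theorem exact_cone {x z : G} {t : ℤ} (ht : 0 ≤ t) (h : t ≤ cone d Y M z x) :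
    ∃ w, Bt d 0 x w z ∧ cone d Y M z w = t := by
  have hc := F.c_pos
  have hnn := F.hm.nn z x
  obtain ⟨m, hm⟩ : ∃ m : ℕ, d z x = m := ⟨_, (Int.toNat_of_nonneg hnn).symm⟩
  induction m generalizing x with
  | zero =>
    have : z = x := F.hm.eq_of _ _ (by simpa using hm)
    subst this
    refine ⟨z, by unfold Bt; omega, ?_⟩
    have := F.cone_self hM z; omega
  | succ m ih =>
    rcases eq_or_lt_of_le h with h1 | h1
    · refine ⟨x, ?_, h1.symm⟩
      have := F.hm.self x; unfold Bt; omega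
    · obtain ⟨x', h2, h3⟩ := F.hm.geo z x m (by positivity) (by omega)
      have h4 := F.cone_one hM (x := x') (y := x) (by push_cast at *; omega)
      have h5 := F.cone_tri hM z x' x
      obtain ⟨w, hw, hw'⟩ := ih (by omega) (F.hm.nn _ _) h2
      refine ⟨w, ?_, hw'⟩
      have := F.hm.tri x x' w
      have := F.hm.symm x z
      have := F.hm.symm x' z
      have := F.hm.symm x x'
      unfold Bt at *; push_cast at *; omega

/-- Points of geodesics are close to shortest paths in the cone-off. -/
theorem star0 {γ : ℕ → G} {n : ℕ} {x y z : G} (h : IsPath (cEdge d Y M Set.univ) γ n x y)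
    (hn : cone d Y M x y = n) (hz : Bt d 0 x z y) : ∃ m ≤ n, cone d Y M z (γ m) ≤ 2 := by
  classical
  have hc := F.c_pos
  by_contra! hcon
  let P : ℕ → Prop := fun D => ∃ z, Bt d 0 x z y ∧ ∀ m ≤ n, (D : ℤ) ≤ cone d Y M z (γ m)
  have P3 : P 3 := ⟨z, hz, fun m hm => by have := hcon m hm; push_cast; omega⟩
  have hbd : ∀ D, P D → D ≤ (d x y + 1).toNat := by
    rintro D ⟨z, hz, h1⟩
    have h2 := h1 0 (Nat.zero_le _)
    rw [h.1] at h2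
    have := F.cone_le hM z x
    have := F.hm.nn z y
    have := F.hm.symm x z
    have := F.hm.nn x y
    unfold Bt at hz
    have : (D : ℤ) ≤ d x y + 1 := by nlinarith
    omega
  set D := Nat.findGreatest P (d x y + 1).toNat with hD
  have hPD : P D := Nat.findGreatest_spec (hbd 3 P3) P3
  have hD3 : 3 ≤ D := Nat.le_findGreatest (hbd 3 P3) P3
  have hall : ∀ z, Bt d 0 x z y → ∃ m ≤ n, cone d Y M z (γ m) ≤ D := by
    intro z hz
    by_contra! hcon
    have hP : P (D + 1) := ⟨z, hz, fun m hm => by have := hcon m hm; push_cast; omega⟩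
    have := Nat.le_findGreatest (hbd _ hP) hP
    omega
  clear_value D
  obtain ⟨z, hz, hzD⟩ := hPD
  -- a point towards either end together with a path to `γ` staying far from `z`
  have side : ∀ x' m', m' ≤ n → γ m' = x' → (∀ w, Bt d 0 x' w z → Bt d 0 x w y) →
      ∃ w m, m ≤ n ∧ Bt d 0 x' w z ∧ cone d Y M z w ≤ 2 * D ∧ ∃ (l : ℕ) (β : ℕ → G),
        IsPath (cEdge d Y M Set.univ) β l w (γ m) ∧ l ≤ D ∧
        ∀ i ≤ l, (D : ℤ) ≤ cone d Y M z (β i) := by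
    intro x' m' hm' hx' hB
    rcases le_or_gt (2 * (D : ℤ)) (cone d Y M z x') with h1 | h1
    · obtain ⟨w, h2, h3⟩ := F.exact_cone hM (by positivity) h1
      obtain ⟨m, h4, h5⟩ := hall w (hB w h2)
      obtain ⟨l, h6, β, h7⟩ := pathD_spec (F.conn hM) w (γ m)
      refine ⟨w, m, h4, h2, h3.le, l, β, h7, by unfold cone at h5; omega, fun i hi => ?_⟩
      have h8 := pathD_sub (F.conn hM) h7 h6 (Nat.zero_le i) hi
      rw [h7.1] at h8
      have h9 := F.cone_tri hM z (β i) w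
      have h10 := F.cone_symm hM (β i) w
      unfold cone at *
      push_cast at *; omega
    · refine ⟨x', m', hm', ?_, h1.le, 0, fun _ => x', ⟨rfl, hx'.symm, fun m hm =>
        absurd hm (by omega)⟩, by omega, fun i _ => ?_⟩
      · have := F.hm.self x'; unfold Bt; omega
      · rw [← hx']; exact hzD m' hm'
  obtain ⟨z1, m1, hm1, hz1, hd1, l1, β1, hβ1, hl1, hf1⟩ := side x 0 (Nat.zero_le _) h.1 (by
    intro w hw
    have := F.hm.tri w z y
    have := F.hm.tri x z y
    unfold Bt at *; omega)
  obtain ⟨z2, m2, hm2, hz2, hd2, l2, β2, hβ2, hl2, hf2⟩ := side y n le_rfl h.2.1 (by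
    intro w hw
    have := F.hm.tri x z w
    have := F.hm.symm y w
    have := F.hm.symm y z
    have := F.hm.symm w z
    unfold Bt at *; omega)
  have hB : Bt d 0 z1 z z2 := by
    have := F.hm.tri x z1 y
    have := F.hm.tri z1 z2 y
    have := F.hm.symm y z2
    have := F.hm.symm y z
    have := F.hm.symm z2 z
    unfold Bt at *; omega
  -- contradiction from a long enough path staying far from `z`
  have fin : ∀ (a b : ℕ) (β : ℕ → G), a ≤ b → b - a ≤ 6 * D →
      (∀ m, a ≤ m → m < b → cEdge d Y M Set.univ (β m) (β (m + 1))) →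
      (∀ m, a ≤ m → m ≤ b → (D : ℤ) ≤ cone d Y M z (β m)) → Bt d (2 * c) (β a) z (β b) →
      False := by
    intro a b β hab hlen hβ hf hb
    have hp : D < 2 ^ D := Nat.lt_two_pow_self
    obtain ⟨m, h1, h2, h3⟩ := F.near_path hM (D + 3) hab (by rw [pow_add]; omega) hβ hb
    have h4 := hf m h1 h2
    push_cast at h3
    have h5 : (3 : ℤ) ≤ D := by exact_mod_cast hD3
    have h6 : M * D ≤ 2 * M + 2 * c + 2 * c + (D + 3) * c := by nlinarith
    nlinarith
  have len : ∀ a b, a ≤ b → b ≤ n → cone d Y M (γ a) (γ b) ≤ 6 * D → b - a ≤ 6 * D := by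
    intro a b hab hb h1
    have := pathD_sub (F.conn hM) h hn hab hb
    unfold cone at h1
    omega
  have hv : cone d Y M (γ m1) (γ m2) ≤ 6 * D := by
    have a1 := pathD_le hβ1
    have a2 := pathD_le hβ2
    have a3 := F.cone_tri hM (γ m1) z1 (γ m2)
    have a4 := F.cone_tri hM z1 z (γ m2)
    have a5 := F.cone_tri hM z z2 (γ m2)
    have a6 := F.cone_symm hM z1 (γ m1)
    have a7 := F.cone_symm hM z1 z
    unfold cone at *
    omega
  rcases F.hm.split hB (γ m1) with h1 | h1
  · refine fin 0 l1 β1 (Nat.zero_le _) (by omega) (fun m _ hm => hβ1.2.2 m hm)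
      (fun m _ hm => hf1 m hm) ?_
    rw [hβ1.1, hβ1.2.1]; unfold Bt at *; omega
  rcases F.hm.split h1 (γ m2) with h2 | h2
  · rcases le_total m1 m2 with h3 | h3
    · exact fin m1 m2 γ h3 (len _ _ h3 hm2 hv) (fun m _ hm => h.2.2 m (by omega))
        (fun m _ hm => hzD m (by omega)) (by unfold Bt at *; omega)
    · exact fin m2 m1 γ h3 (len _ _ h3 hm1 (by rwa [F.cone_symm hM]))
        (fun m _ hm => h.2.2 m (by omega))
        (fun m _ hm => hzD m (by omega)) (by have := F.hm.bt_symm h2; unfold Bt at *; omega)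
  · refine fin 0 l2 β2 (Nat.zero_le _) (by omega) (fun m _ hm => hβ2.2.2 m hm)
      (fun m _ hm => hf2 m hm) ?_
    rw [hβ2.1, hβ2.2.1]
    have := F.hm.bt_symm h2; unfold Bt at *; omega

theorem star {γ : ℕ → G} {n : ℕ} {x y z : G} {e : ℤ}
    (h : IsPath (cEdge d Y M Set.univ) γ n x y) (hn : cone d Y M x y = n) (hz : Bt d e x z y)
    (he : 2 * e + c ≤ M) : ∃ m ≤ n, cone d Y M z (γ m) ≤ 3 := by
  obtain ⟨z', h1, h2⟩ := F.hm.exact_near hz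
  obtain ⟨m, h3, h4⟩ := F.star0 hM h hn h1
  have := F.cone_one hM (h2.trans he)
  have := F.cone_tri hM z z' (γ m)
  exact ⟨m, h3, by omega⟩

/-- Betweenness survives in the cone-off. -/
theorem cone_bt {x y z : G} {e : ℤ} (hz : Bt d e x z y) (he : 2 * e + c ≤ M) :
    Bt (cone d Y M) 6 x z y := by
  obtain ⟨n, h, γ, hγ⟩ := pathD_spec (F.conn hM) x y
  obtain ⟨m, h3, h4⟩ := F.star hM hγ h hz he
  have h1 := pathD_sub (F.conn hM) hγ h (Nat.zero_le m) h3
  have h2 := pathD_sub (F.conn hM) hγ h h3 le_rfl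
  rw [hγ.1] at h1
  rw [hγ.2.1] at h2
  have := F.cone_tri hM x (γ m) z
  have := F.cone_tri hM z (γ m) y
  have := F.cone_symm hM (γ m) z
  unfold Bt cone at *
  push_cast at *; omega

theorem cone_hyp (x y z w : G) : cone d Y M x z + cone d Y M y w ≤
    max (cone d Y M x y + cone d Y M z w) (cone d Y M x w + cone d Y M y z) + 20 := by
  have hc := F.c_pos
  obtain ⟨p, h1, h2, h3⟩ := F.hm.center x y z
  have b1 := F.cone_bt hM h1 (by omega)
  have b2 := F.cone_bt hM h2 (by omega)
  have := F.cone_tri hM x p z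
  have := F.cone_tri hM y p w
  have := F.cone_symm hM y p
  have := F.cone_symm hM p z
  have := F.cone_symm hM p w
  rcases F.hm.split h3 w with h | h <;> have := F.cone_bt hM h (by omega) <;>
    unfold Bt at *
  · have := le_max_right (cone d Y M x y + cone d Y M z w) (cone d Y M x w + cone d Y M y z)
    omega
  · have := le_max_left (cone d Y M x y + cone d Y M z w) (cone d Y M x w + cone d Y M y z)
    have := F.cone_symm hM w z
    have := F.cone_symm hM w p
    omega

theorem cone_HM : HM (cone d Y M) 20 :=
  pathD_HM (F.conn hM) (F.cEdge_symm _) F.cEdge_inv (F.cone_hyp hM)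

/-- Projections of the end points of an edge not on the line. -/
theorem edge_dI {i : ι} {x y : G} (h : cEdge d Y M {i}ᶜ x y) : F.dI i x y ≤ M + 3 * c := by
  have hc := F.c_pos
  rcases h with h | ⟨j, hj, h1, h2⟩
  · have := F.dI_lip i x y; omega
  · have := F.overlap i j (fun e => hj e.symm) x h1 y h2 _ _ (F.pr_gate i x) (F.pr_gate i y)
    unfold dI; omega

theorem far_dI {i : ι} {γ : ℕ → G} {n : ℕ} {x y : G}
    (h : IsPath (cEdge d Y M Set.univ) γ n x y) (hn : cone d Y M x y = n)
    (hf : ∀ m ≤ n, ∀ w ∈ Y i, 3 < cone d Y M (γ m) w) : F.dI i x y ≤ 2 * c := by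
  have hc := F.c_pos
  by_contra! hlt
  have hb := F.hm.gate_cross_left (F.pr_gate i x) (F.pr_gate i y) (by unfold dI at hlt; omega)
  obtain ⟨m, h1, h2⟩ := F.star hM h hn hb (by omega)
  have := hf m h1 _ (F.pr_gate i x).1
  rw [F.cone_symm hM] at this
  omega

theorem path_dI {i : ι} {γ : ℕ → G} {n : ℕ} {x y : G} (h : IsPath (cEdge d Y M {i}ᶜ) γ n x y) :
    F.dI i x y ≤ n * (M + 3 * c) := by
  obtain ⟨rfl, rfl, h⟩ := h
  induction n with
  | zero => simp [F.dI_self]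
  | succ n ih =>
    have := ih fun m hm => h m (by omega)
    have := F.edge_dI hM (h n (by omega))
    have := F.dI_tri i (γ 0) (γ n) (γ (n + 1))
    push_cast; nlinarith

/-- Bounded geodesic image: a shortest path of the cone-off which does not use a line has a
small projection to it. -/
theorem bgi {i : ι} {γ : ℕ → G} {n : ℕ} {x y : G} (h : IsPath (cEdge d Y M Set.univ) γ n x y)
    (hn : cone d Y M x y = n) (hi : IsPath (cEdge d Y M {i}ᶜ) γ n x y) :
    F.dI i x y ≤ 10 * M := by
  classical
  have hc := F.c_pos
  by_cases hex : ∃ m, m ≤ n ∧ ∃ w ∈ Y i, cone d Y M (γ m) w ≤ 3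
  swap
  · push Not at hex
    have := F.far_dI hM h hn hex; omega
  have hex' : ∃ m, m ≤ n ∧ ∃ w ∈ Y i, cone d Y M (γ (n - m)) w ≤ 3 := by
    obtain ⟨m, h1, h2⟩ := hex
    exact ⟨n - m, by omega, by rwa [show n - (n - m) = m by omega]⟩
  obtain ⟨ha, w, hw, haw⟩ := Nat.find_spec hex
  obtain ⟨hb, w', hw', hbw⟩ := Nat.find_spec hex'
  have hmin := fun m => Nat.find_min hex (m := m)
  have hmin' := fun m => Nat.find_min hex' (m := m)
  generalize Nat.find hex = a at *
  generalize Nat.find hex' = b' at *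
  have hab : a + b' ≤ n := by
    by_contra hlt
    exact hmin' (n - a) (by omega) ⟨by omega, w, hw, by rwa [show n - (n - a) = a by omega]⟩
  have pre : F.dI i x (γ a) ≤ M + 5 * c := by
    rcases Nat.eq_zero_or_pos a with h0 | h0
    · subst h0; rw [h.1, F.dI_self]; omega
    · have h1 := h.sub (Nat.zero_le (a - 1)) (by omega)
      have h2 := F.far_dI hM (i := i) h1 (pathD_sub (F.conn hM) h hn (Nat.zero_le _) (by omega)|>.trans
        (by omega)) (fun m hm w hw => by
          have := hmin m (by omega)
          push Not at this
          simpa using this (by omega) w hw)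
      have h3 := F.edge_dI hM (hi.2.2 (a - 1) (by omega))
      rw [show a - 1 + 1 = a by omega] at h3
      rw [h.1] at h2
      have := F.dI_tri i x (γ (a - 1)) (γ a)
      omega
  have post : F.dI i (γ (n - b')) y ≤ M + 5 * c := by
    rcases Nat.eq_zero_or_pos b' with h0 | h0
    · subst h0; rw [Nat.sub_zero, h.2.1, F.dI_self]; omega
    · have h1 := h.sub (a := n - b' + 1) (b := n) (by omega) le_rfl
      have h2 := F.far_dI hM (i := i) h1
        (pathD_sub (F.conn hM) h hn (by omega) le_rfl |>.trans (by omega))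
        (fun m hm w hw => by
          have := hmin' (n - (n - b' + 1 + m)) (by omega)
          push Not at this
          have := this (by omega) w hw
          rwa [show n - (n - (n - b' + 1 + m)) = n - b' + 1 + m by omega] at this)
      have h3 := F.edge_dI hM (hi.2.2 (n - b') (by omega))
      rw [h.2.1] at h2
      have := F.dI_tri i (γ (n - b')) (γ (n - b' + 1)) y
      omega
  have hsub := pathD_sub (F.conn hM) h hn (a := a) (b := n - b') (by omega) (by omega)
  have h7 : cone d Y M (γ a) (γ (n - b')) ≤ 7 := by
    have := F.cone_tri hM (γ a) w (γ (n - b'))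
    have := F.cone_tri hM w w' (γ (n - b'))
    have := F.cone_symm hM w' (γ (n - b'))
    have := cone_line (d := d) (M := M) hw hw'
    omega
  have mid := F.path_dI hM (hi.sub (a := a) (b := n - b') (by omega) (by omega))
  have := F.dI_tri i x (γ a) y
  have := F.dI_tri i (γ a) (γ (n - b')) y
  have h8 : ((n - b' - a : ℕ) : ℤ) ≤ 7 := by
    unfold cone at h7; push_cast [show b' ≤ n by omega, show a ≤ n - b' by omega] at *; omega
  nlinarith

/-- The parts of a shortest path before and after an edge in a line have small projections to
this line. -/
theorem edge_sides {i : ι} {γ : ℕ → G} {n : ℕ} {x y : G}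
    (h : IsPath (cEdge d Y M Set.univ) γ n x y) (hn : cone d Y M x y = n) {m : ℕ} (hm : m < n)
    (h2 : γ m ∈ Y i) (h3 : γ (m + 1) ∈ Y i) :
    F.dI i x (γ m) ≤ 10 * M ∧ F.dI i (γ (m + 1)) y ≤ 10 * M := by
  have uniq : ∀ m' < n, m' ≠ m → cEdge d Y M {i}ᶜ (γ m') (γ (m' + 1)) := by
    intro m' hm' hne
    rcases h.2.2 m' hm' with h5 | ⟨j, -, h5, h6⟩
    · exact .inl h5
    · refine .inr ⟨j, ?_, h5, h6⟩
      rintro rfl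
      rcases lt_or_gt_of_ne hne with h7 | h7
      · have := pathD_sub (F.conn hM) h hn (a := m') (b := m + 1) (by omega) (by omega)
        have := cone_line (d := d) (M := M) h5 h3
        unfold cone at *; push_cast at *; omega
      · have := pathD_sub (F.conn hM) h hn (a := m) (b := m' + 1) (by omega) (by omega)
        have := cone_line (d := d) (M := M) h2 h6
        unfold cone at *; push_cast at *; omega
  refine ⟨?_, ?_⟩
  · have h4 := h.sub (Nat.zero_le m) hm.le
    have h5 := F.bgi hM (i := i) h4 ((pathD_sub (F.conn hM) h hn (Nat.zero_le _) hm.le).trans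
      (by omega)) ⟨h4.1, h4.2.1, fun m' hm' => by
        simpa [add_assoc] using uniq (0 + m') (by omega) (by omega)⟩
    rwa [h.1] at h5
  · have h4 := h.sub (a := m + 1) (b := n) (by omega) le_rfl
    have h5 := F.bgi hM (i := i) h4 ((pathD_sub (F.conn hM) h hn (by omega) le_rfl).trans
      (by omega)) ⟨h4.1, h4.2.1, fun m' hm' =>
        uniq (m + 1 + m') (by omega) (by omega)⟩
    rwa [h.2.1] at h5

/-- A shortest path contains an edge in each line to which its projection is large. -/
theorem line_edge {i : ι} {γ : ℕ → G} {n : ℕ} {x y : G}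
    (h : IsPath (cEdge d Y M Set.univ) γ n x y) (hn : cone d Y M x y = n)
    (hlt : 10 * M < F.dI i x y) : ∃ m < n, γ m ∈ Y i ∧ γ (m + 1) ∈ Y i := by
  by_contra! hcon
  have := F.bgi hM (i := i) h hn ⟨h.1, h.2.1, fun m hm => by
    rcases h.2.2 m hm with h2 | ⟨j, -, h2, h3⟩
    · exact .inl h2
    · refine .inr ⟨j, ?_, h2, h3⟩
      rintro rfl
      exact hcon m hm h2 h3⟩
  omega

theorem cone_inv (g x y : G) : cone d Y M (g * x) (g * y) = cone d Y M x y :=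
  (F.cone_HM hM).inv g x y

/-- Rotating one end about a line met by a shortest path does not increase the distance. -/
theorem bend {i : ι} {x y g : G} (hg : g ∈ R i) (hlt : 10 * M < F.dI i x y) :
    cone d Y M x (g * y) ≤ cone d Y M x y := by
  obtain ⟨n, hn, γ, h⟩ := pathD_spec (F.conn hM) x y
  obtain ⟨m, hm, h1, h2⟩ := F.line_edge hM h hn hlt
  have a1 := pathD_sub (F.conn hM) h hn (Nat.zero_le m) hm.le
  have a2 := pathD_sub (F.conn hM) h hn (a := m + 1) (b := n) (by omega) le_rfl
  rw [h.1] at a1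
  rw [h.2.1] at a2
  have a3 := F.Y_smul g i _ h2
  rw [F.R_fix i g hg] at a3
  have a4 := cone_line (d := d) (M := M) h1 a3
  have a5 := F.cone_tri hM x (γ m) (g * y)
  have a6 := F.cone_tri hM (γ m) (g * γ (m + 1)) (g * y)
  have a7 := F.cone_inv hM g (γ (m + 1)) y
  unfold cone at *
  push_cast at *; omega

end Fam
end PG

namespace PG

/-- The metric induced by the cone-off metric on a quotient group. -/
noncomputable def quoD {G Q ι : Type} [Group G] [Group Q] (π : G →* Q) (d : G → G → ℤ)
    (Y : ι → Set G) (M : ℤ) : Q → Q → ℤ :=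
  pathD fun a b => ∃ x y, π x = a ∧ π y = b ∧ cEdge d Y M Set.univ x y

/-- `π` is a quotient map by the subgroup generated by all rotations. -/
structure IsQuo {G Q ι : Type} [Group G] [Group Q] (π : G →* Q) (R : ι → Subgroup G) : Prop where
  surj : Function.Surjective π
  ker : ∀ g, π g = 1 ↔ g ∈ ⨆ i, R i

namespace Fam
variable {G ι : Type} [Group G] [MulAction G ι] {d : G → G → ℤ} {Y : ι → Set G}
    {R : ι → Subgroup G} {N : ι → ℤ} {c N0 : ℤ} (F : Fam d Y R N c N0) {M : ℤ} (hM : 100 * c ≤ M)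
    {Q : Type} [Group Q] {π : G →* Q} (hπ : IsQuo π R)
include F hM

omit F hM [MulAction G ι] in
include hπ in
theorem _root_.PG.IsQuo.eq_iff {x y : G} : π x = π y ↔ ∃ k ∈ ⨆ i, R i, y = k * x := by
  constructor
  · intro h
    refine ⟨y * x⁻¹, (hπ.ker _).1 (by simp [h]), by simp⟩
  · rintro ⟨k, hk, rfl⟩
    simp [(hπ.ker k).2 hk]

/-- Closing up a polygon whose end points differ by a product of rotations. -/
theorem polygon (m : ℕ) (hN : m * (10 * M) + 100 * c < N0) (x k : G) (hk : k ∈ ⨆ i, R i)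
    (ξ : ℕ → G) (h0 : ξ 0 = x) (hm : ξ m = k * x) :
    ∃ ζ : ℕ → G, ζ 0 = x ∧ ζ m = x ∧ (∀ j, ∃ s ∈ ⨆ i, R i, ζ j = s * ξ j) ∧
      ∀ j < m, cone d Y M (ζ j) (ζ (j + 1)) ≤ cone d Y M (ξ j) (ξ (j + 1)) := by
  have hgood := F.good x k hk
  clear hk
  induction hgood generalizing ξ with
  | one => exact ⟨ξ, h0, by simpa using hm, fun j => ⟨1, Subgroup.one_mem _, by simp⟩,
      fun j _ => le_rfl⟩
  | step k g i hg hD _ ih =>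
    obtain ⟨j, hj, hlt⟩ : ∃ j < m, 10 * M < F.dI i (ξ j) (ξ (j + 1)) := by
      by_contra! hcon
      have : ∀ j ≤ m, F.dI i x (ξ j) ≤ j * (10 * M) := by
        intro j
        induction j with
        | zero => intro _; rw [h0, F.dI_self]; simp
        | succ j ih =>
          intro hj
          have := ih (by omega)
          have := hcon j (by omega)
          have := F.dI_tri i x (ξ j) (ξ (j + 1))
          push_cast; linarith
      have := this m le_rfl
      rw [hm] at this
      have := F.N_ge i
      omega
    obtain ⟨ζ, h1, h2, h3, h4⟩ := ih (fun l => if l ≤ j then ξ l else g * ξ l) (by simp [h0])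
      (by simp [show ¬ m ≤ j by omega, hm, mul_assoc])
    refine ⟨ζ, h1, h2, fun l => ?_, fun l hl => (h4 l hl).trans ?_⟩
    · obtain ⟨s, hs, e⟩ := h3 l
      rw [e]
      by_cases hlj : l ≤ j
      · exact ⟨s, hs, by simp [hlj]⟩
      · exact ⟨s * g, Subgroup.mul_mem _ hs (Subgroup.mem_iSup_of_mem i hg),
          by simp [hlj, mul_assoc]⟩
    · rcases lt_trichotomy l j with h5 | h5 | h5
      · simp [h5.le, show l + 1 ≤ j by omega]
      · subst h5
        simpa using F.bend hM hg hlt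
      · simp [show ¬ l ≤ j by omega, show ¬ l + 1 ≤ j by omega, F.cone_inv hM]

/-- If no projection is large then multiplying by products of rotations does not shorten. -/
theorem no_shortcut {x y : G} (h : ∀ i, F.dI i x y + 10 * M + 100 * c < N i) (k : G)
    (hk : k ∈ ⨆ i, R i) : cone d Y M x y ≤ cone d Y M x (k * y) := by
  induction F.good y k hk with
  | one => simp
  | step k g i hg hD hk' ih =>
    have := F.dI_tri i y x (k * y)
    have := F.dI_symm i x y
    have := h i
    have h1 := F.bend hM hg (x := x) (y := k * y) (by omega)
    rw [← mul_assoc] at h1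
    exact (ih (Subgroup.mul_mem _ (Subgroup.mem_iSup_of_mem i hg) ‹_›)).trans h1

include hπ

theorem quo_lift {a b : Q} (x : G) (hx : π x = a)
    (h : ∃ x y, π x = a ∧ π y = b ∧ cEdge d Y M Set.univ x y) :
    ∃ y, π y = b ∧ cEdge d Y M Set.univ x y := by
  obtain ⟨x', y, h1, h2, h3⟩ := h
  obtain ⟨k, hk, rfl⟩ := hπ.eq_iff.1 (h1.trans hx.symm)
  refine ⟨k * y, ?_, F.cEdge_inv _ _ _ h3⟩
  rw [map_mul, (hπ.ker k).2 hk, one_mul, h2]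

theorem quo_le (x y : G) : quoD π d Y M (π x) (π y) ≤ cone d Y M x y := by
  obtain ⟨n, hn, γ, h⟩ := pathD_spec (F.conn hM) x y
  unfold cone
  rw [hn]
  exact pathD_le (γ := fun m => π (γ m)) ⟨congrArg π h.1, congrArg π h.2.1,
    fun m hm => ⟨_, _, rfl, rfl, h.2.2 m hm⟩⟩

theorem quo_conn (a b : Q) : ∃ n γ, IsPath (fun a b => ∃ x y, π x = a ∧ π y = b ∧
    cEdge d Y M Set.univ x y) γ n a b := by
  obtain ⟨x, rfl⟩ := hπ.surj a
  obtain ⟨y, rfl⟩ := hπ.surj b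
  obtain ⟨n, γ, h⟩ := F.conn hM x y
  exact ⟨n, fun m => π (γ m), congrArg π h.1, congrArg π h.2.1,
    fun m hm => ⟨_, _, rfl, rfl, h.2.2 m hm⟩⟩

/-- Shortest paths lift. -/
theorem exists_lift (x : G) (b : Q) :
    ∃ y, π y = b ∧ cone d Y M x y = quoD π d Y M (π x) b := by
  obtain ⟨n, hn, γ, h⟩ := pathD_spec (F.quo_conn hM hπ) (π x) b
  choose! f hf1 hf2 using fun (m : ℕ) (z : G) (hm : m < n) (hz : π z = γ m) =>
    F.quo_lift hM hπ z hz (h.2.2 m hm)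
  let β : ℕ → G := fun m => Nat.rec x (fun m z => f m z) m
  have hβ : ∀ m ≤ n, π (β m) = γ m := by
    intro m
    induction m with
    | zero => intro _; exact h.1.symm
    | succ m ih => intro hm; exact hf1 m _ (by omega) (ih (by omega))
  have hp : IsPath (cEdge d Y M Set.univ) β n x (β n) :=
    ⟨rfl, rfl, fun m hm => hf2 m _ hm (hβ m hm.le)⟩
  have h1 : π (β n) = b := (hβ n le_rfl).trans h.2.1
  refine ⟨β n, h1, le_antisymm ?_ ?_⟩
  · have := pathD_le hp
    unfold cone quoD; rw [hn]; exact this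
  · rw [← h1]; exact F.quo_le hM hπ _ _

theorem quo_eq {x y : G} (h : ∀ i, F.dI i x y + 10 * M + 100 * c < N i) :
    quoD π d Y M (π x) (π y) = cone d Y M x y := by
  refine le_antisymm (F.quo_le hM hπ x y) ?_
  obtain ⟨y', h1, h2⟩ := F.exists_lift hM hπ x (π y)
  obtain ⟨k, hk, rfl⟩ := hπ.eq_iff.1 h1.symm
  rw [← h2]
  exact F.no_shortcut hM h k hk

theorem quo_HM (hN : 40 * M + 100 * c < N0) : HM (quoD π d Y M) 20 := by
  refine pathD_HM (F.quo_conn hM hπ) ?_ ?_ fun a b e f => ?_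
  · rintro a b ⟨x, y, h1, h2, h3⟩
    exact ⟨y, x, h2, h1, F.cEdge_symm _ _ _ h3⟩
  · rintro g a b ⟨x, y, h1, h2, h3⟩
    obtain ⟨g, rfl⟩ := hπ.surj g
    exact ⟨g * x, g * y, by simp [h1], by simp [h2], F.cEdge_inv _ _ _ h3⟩
  · change quoD π d Y M a e + quoD π d Y M b f ≤ max (quoD π d Y M a b + quoD π d Y M e f)
      (quoD π d Y M a f + quoD π d Y M b e) + 20
    have qs : quoD π d Y M a f = quoD π d Y M f a := by
      have hs : ∀ a b : Q, quoD π d Y M a b ≤ quoD π d Y M b a := fun a b => by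
        obtain ⟨n, hn, γ, h⟩ := pathD_spec (F.quo_conn hM hπ) b a
        unfold quoD; rw [hn]
        refine pathD_le (h.reverse ?_)
        rintro a b ⟨x, y, h1, h2, h3⟩
        exact ⟨y, x, h2, h1, F.cEdge_symm _ _ _ h3⟩
      exact le_antisymm (hs _ _) (hs _ _)
    obtain ⟨x0, rfl⟩ := hπ.surj a
    obtain ⟨x1, rfl, d1⟩ := F.exists_lift hM hπ x0 b
    obtain ⟨x2, rfl, d2⟩ := F.exists_lift hM hπ x1 e
    obtain ⟨x3, rfl, d3⟩ := F.exists_lift hM hπ x2 f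
    obtain ⟨x4, h4, d4⟩ := F.exists_lift hM hπ x3 (π x0)
    obtain ⟨k, hk, rfl⟩ := hπ.eq_iff.1 h4.symm
    obtain ⟨ζ, z0, z4, hz, hd⟩ := F.polygon hM 4 (by push_cast; omega) x0 k hk
      (fun j => match j with | 0 => x0 | 1 => x1 | 2 => x2 | 3 => x3 | _ => k * x0) rfl rfl
    have hπz : ∀ j, π (ζ j) = π ((fun j => match j with
        | 0 => x0 | 1 => x1 | 2 => x2 | 3 => x3 | _ => k * x0 : ℕ → G) j) := fun j => by
      obtain ⟨s, hs, e⟩ := hz j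
      rw [e, map_mul, (hπ.ker s).2 hs, one_mul]
    have e1 := hd 0 (by norm_num)
    have e2 := hd 1 (by norm_num)
    have e3 := hd 2 (by norm_num)
    have e4 := hd 3 (by norm_num)
    have p1 := hπz 1
    have p2 := hπz 2
    have p3 := hπz 3
    simp only [zero_add, Nat.reduceAdd] at e1 e2 e3 e4 p1 p2 p3
    rw [z0] at e1
    rw [z4] at e4
    have q1 := F.quo_le hM hπ x0 (ζ 2)
    have q2 := F.quo_le hM hπ (ζ 1) (ζ 3)
    rw [p2] at q1
    rw [p1, p3] at q2
    have h := F.cone_hyp hM x0 (ζ 1) (ζ 2) (ζ 3)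
    have s1 := F.cone_symm hM x0 (ζ 3)
    rcases max_cases (cone d Y M x0 (ζ 1) + cone d Y M (ζ 2) (ζ 3))
      (cone d Y M x0 (ζ 3) + cone d Y M (ζ 1) (ζ 2)) with h5 | h5 <;>
    rcases max_cases (quoD π d Y M (π x0) (π x1) + quoD π d Y M (π x2) (π x3))
      (quoD π d Y M (π x0) (π x3) + quoD π d Y M (π x1) (π x2)) with h6 | h6 <;> omega

end Fam
end PG

namespace PG

/-- The orbit of `z` under the powers of `u` is a quasi-axis with additive error `c`. -/
structure Ax {G : Type} [Group G] (d : G → G → ℤ) (c : ℤ) (u z : G) : Prop where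
  sup : ∀ j k : ℕ, d z (u ^ j * z) + d z (u ^ k * z) ≤ d z (u ^ (j + k) * z) + c
  low : ∀ j : ℕ, (j : ℤ) ≤ d z (u ^ j * z)

namespace Ax
variable {G : Type} [Group G] {d : G → G → ℤ} {c : ℤ} {g z : G}

theorem dist_pow (hm : HM d c) {m j : ℕ} (h : m ≤ j) :
    d (g ^ m * z) (g ^ j * z) = d z (g ^ (j - m) * z) := by
  obtain ⟨k, rfl⟩ := Nat.exists_eq_add_of_le h
  rw [pow_add, mul_assoc, hm.inv, Nat.add_sub_cancel_left]

/-- A point near the quasi-axis is near one of the fundamental segments. -/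
theorem on_axis (hm : HM d c) (h : ∀ j k : ℕ, d z (g ^ j * z) + d z (g ^ k * z) ≤
    d z (g ^ (j + k) * z) + c) {e : ℤ} {P : G} {j : ℕ} (he : 0 ≤ e)
    (hb : Bt d e z P (g ^ j * z)) :
    ∃ m : ℕ, d (g ^ m * z) P + d P (g ^ (m + 1) * z) ≤ d z (g * z) + 2 * e + 3 * c := by
  have hc := hm.δnn
  have hex : ∃ m : ℕ, Bt d (e + c) z P (g ^ m * z) := ⟨j, by unfold Bt at *; omega⟩
  classical
  cases hm1 : Nat.find hex with
  | zero =>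
    have := Nat.find_spec hex
    rw [hm1] at this
    refine ⟨0, ?_⟩
    have h1 := hm.tri P z (g * z)
    have h2 := hm.self z
    have h3 := hm.symm z P
    simp only [Bt, pow_zero, one_mul, zero_add, pow_one] at *
    omega
  | succ m =>
    have hs := Nat.find_spec hex
    have hn := Nat.find_min hex (m := m) (by omega)
    have hj : Nat.find hex ≤ j := Nat.find_min' hex (by unfold Bt at *; omega)
    rw [hm1] at hs hj
    have := (hm.split hb (g ^ m * z)).resolve_left hn
    refine ⟨m, ?_⟩
    have h1 := h (j - m) m
    rw [Nat.sub_add_cancel (by omega)] at h1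
    have h2 := hm.tri z (g ^ m * z) (g ^ (m + 1) * z)
    rw [dist_pow hm (by omega : m ≤ m + 1), Nat.add_sub_cancel_left, pow_one] at h2
    unfold Bt at *
    rw [dist_pow hm (by omega : m ≤ j)] at this
    have := hm.tri z P (g ^ j * z)
    omega

theorem move_near (hm : HM d c) (h : ∀ j k : ℕ, d z (g ^ j * z) + d z (g ^ k * z) ≤
    d z (g ^ (j + k) * z) + c) {e : ℤ} {P : G} {j : ℕ} (he : 0 ≤ e)
    (hb : Bt d e z P (g ^ j * z)) : d P (g * P) ≤ d z (g * z) + 2 * e + 3 * c := by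
  obtain ⟨m, hm1⟩ := on_axis hm h he hb
  have h1 := hm.tri P (g ^ (m + 1) * z) (g * P)
  have : d (g ^ (m + 1) * z) (g * P) = d (g ^ m * z) P := by
    rw [pow_succ', mul_assoc, hm.inv]
  omega

theorem mul_le (h : ∀ j k : ℕ, d z (g ^ j * z) + d z (g ^ k * z) ≤
    d z (g ^ (j + k) * z) + c) (m k : ℕ) :
    (m + 1) * d z (g ^ k * z) ≤ d z (g ^ ((m + 1) * k) * z) + m * c := by
  induction m with
  | zero => simp
  | succ m ih =>
    have := h ((m + 1) * k) k
    rw [show (m + 1) * k + k = (m + 1 + 1) * k by ring] at this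
    push_cast
    linarith

end Ax

namespace Fam
variable {G ι : Type} [Group G] [MulAction G ι] {d : G → G → ℤ} {Y : ι → Set G}
    {R : ι → Subgroup G} {N : ι → ℤ} {c N0 : ℤ} (F : Fam d Y R N c N0)
include F

theorem crossing {g z : G} (h : Ax d c g z) {i : ι} (hi : g • i ≠ i) {j : ℕ}
    (hlt : 2 * c < F.dI i z (g ^ j * z)) : ∃ P ∈ Y i, ∃ r ∈ Y i,
    (∃ m : ℕ, d (g ^ m * z) P + d P (g ^ (m + 1) * z) ≤ d z (g * z) + 9 * c) ∧
    Bt d c P r (g * P) ∧ F.dI i z (g ^ j * z) - 15 * c ≤ d P r ∧ d P r + d r (g * P) ≤ d z (g * z) + 10 * c := by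
  have hc := F.c_pos
  set P := F.pr i z with hP
  set P' := F.pr i (g ^ j * z) with hP'
  have gP := F.pr_gate i z
  have gP' := F.pr_gate i (g ^ j * z)
  change 2 * c < d P P' at hlt
  rw [← hP] at gP
  rw [← hP'] at gP'
  have k1 := Ax.move_near F.hm h.sup (by omega) (F.hm.gate_cross_left gP gP' (by omega))
  have k2 := Ax.move_near F.hm h.sup (by omega) (F.hm.gate_cross_right gP gP' (by omega))
  have k3 := F.hm.gate_cross gP gP' (by omega)
  have g1 := F.pr_gate i (g * P)
  have g2 := F.pr_gate i (g * P')
  have k4 := F.overlap i (g • i) hi.symm (g * P) (F.Y_smul _ _ _ gP.1) (g * P')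
    (F.Y_smul _ _ _ gP'.1) _ _ g1 g2
  have k5 := F.hm.tri z (g * P') (g ^ (j + 1) * z)
  have k6 : d (g * P') (g ^ (j + 1) * z) = d P' (g ^ j * z) := by
    rw [pow_succ', mul_assoc, F.hm.inv]
  have k7 := h.sup j 1
  rw [pow_one] at k7
  have k8 := F.hm.tri z P (g * P')
  have k9 := g1.2 _ gP.1
  have k10 := g2.2 _ gP'.1
  have s1 := F.hm.symm (g * P) P
  have s2 := F.hm.symm (g * P') P'
  have s3 := F.hm.symm (g * P) (F.pr i (g * P))
  have s4 := F.hm.symm (g * P') (F.pr i (g * P'))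
  have s5 := F.hm.symm P (F.pr i (g * P))
  have k11 := F.hm.tri P (F.pr i (g * P)) (g * P')
  have k12 := F.hm.tri (F.pr i (g * P)) (F.pr i (g * P')) (g * P')
  have k13 := F.hm.nn (F.pr i (g * P')) P'
  obtain ⟨m, hm⟩ := Ax.on_axis F.hm h.sup (by omega) (F.hm.gate_cross_left gP gP' (by omega))
  refine ⟨P, gP.1, _, g1.1, ⟨m, by omega⟩, by unfold Bt; omega, ?_, ?_⟩
  · change d P P' - 15 * c ≤ _
    omega
  · omega

theorem crossing_le {g z : G} (h : Ax d c g z) {i : ι} (hi : g • i ≠ i) (j : ℕ) :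
    F.dI i z (g ^ j * z) ≤ d z (g * z) + 25 * c := by
  have hc := F.c_pos
  have := F.hm.nn z (g * z)
  by_cases hlt : 2 * c < F.dI i z (g ^ j * z)
  · obtain ⟨P, -, r, -, -, -, h1, h2⟩ := F.crossing h hi hlt
    have := F.hm.nn r (g * P)
    omega
  · omega

variable {M : ℤ} (hM : 100 * c ≤ M)
include hM

theorem cone_sup {g z : G} (h : Ax d c g z) (j k : ℕ) :
    cone d Y M z (g ^ j * z) + cone d Y M z (g ^ k * z) ≤
      cone d Y M z (g ^ (j + k) * z) + 6 := by
  have hc := F.c_pos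
  have h1 := h.sup j k
  have : Bt (cone d Y M) 6 z (g ^ j * z) (g ^ (j + k) * z) := by
    refine F.cone_bt hM (e := c) ?_ (by omega)
    unfold Bt
    rw [Ax.dist_pow F.hm (by omega), Nat.add_sub_cancel_left]
    exact h1
  unfold Bt at this
  rwa [pow_add, mul_assoc, F.cone_inv hM, ← mul_assoc, ← pow_add] at this

/-- The quasi-axis stays a quasi-axis in the cone-off. -/
theorem cone_low {g z : G} (h : Ax d c g z) (hi : ∀ i : ι, g • i ≠ i) :
    7 ≤ cone d Y M z (g ^ (200 * M).toNat * z) := by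
  have hc := F.c_pos
  have ha := F.hm.nn z (g * z)
  by_contra! hlt
  set k0 := (200 * M).toNat with hk0
  have hk : (k0 : ℤ) = 200 * M := by omega
  obtain ⟨n, hn, γ, hγ⟩ := pathD_spec (F.conn hM) z (g ^ k0 * z)
  have hedge : ∀ m < n, d (γ m) (γ (m + 1)) ≤ d z (g * z) + 26 * c + 20 * M := by
    intro m hmn
    rcases hγ.2.2 m hmn with h1 | ⟨i, -, h2, h3⟩
    · omega
    · have e1 := F.edge_sides hM hγ hn hmn h2 h3
      have e2 := F.crossing_le h (hi i) k0
      have e3 := F.dI_tri i (γ m) z (γ (m + 1))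
      have e4 := F.dI_tri i z (g ^ k0 * z) (γ (m + 1))
      have e5 := F.dI_symm i (γ m) z
      have e6 := F.dI_symm i (γ (m + 1)) (g ^ k0 * z)
      have e7 := F.dI_near h2 h3
      rw [abs_le] at e7
      omega
  have htot : ∀ m ≤ n, d z (γ m) ≤ m * (d z (g * z) + 26 * c + 20 * M) := by
    intro m
    induction m with
    | zero => intro _; simp [hγ.1, F.hm.self]
    | succ m ih =>
      intro hmn
      have h1 := ih (by omega)
      have h2 := hedge m (by omega)
      have h3 := F.hm.tri z (γ m) (γ (m + 1))
      push_cast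
      linarith
  have h1 := htot n le_rfl
  rw [hγ.2.1] at h1
  have hn6 : (n : ℤ) ≤ 6 := by unfold cone at hlt; omega
  have h2 := h.low k0
  have h3 := Ax.mul_le h.sup (k0 - 1) 1
  rw [pow_one, mul_one, show k0 - 1 + 1 = k0 by omega] at h3
  have h4 : ((k0 - 1 : ℕ) : ℤ) = 200 * M - 1 := by omega
  rw [h4] at h3
  have h5 : (n : ℤ) * (d z (g * z) + 26 * c + 20 * M) ≤ 6 * (d z (g * z) + 26 * c + 20 * M) :=
    mul_le_mul_of_nonneg_right hn6 (by omega)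
  generalize d z (g * z) = a at *
  generalize d z (g ^ k0 * z) = b at *
  by_cases hac : a ≤ 2 * c
  · omega
  · nlinarith

variable {Q : Type} [Group Q] {π : G →* Q} (hπ : IsQuo π R)
include hπ

theorem quo_axis {g z : G}
    (hl : ∀ i (j : ℕ), F.dI i z (g ^ j * z) + 10 * M + 100 * c < N i) (j : ℕ) :
    quoD π d Y M (π z) (π g ^ j * π z) = cone d Y M z (g ^ j * z) := by
  rw [← map_pow, ← map_mul]
  exact F.quo_eq hM hπ fun i => hl i j

end Fam
end PG

namespace PG

/-- A family of lines together with the dynamical information which is needed to control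
the quotient by the rotations. -/
structure FamX {G ι : Type} [Group G] [MulAction G ι] (d : G → G → ℤ) (Y : ι → Set G)
    (R : ι → Subgroup G) (N : ι → ℤ) (t : ι → G → G → ℤ) (n : ℕ) (c N0 C A : ℤ) : Prop
    extends Fam d Y R N c N0 where
  C_nn : 0 ≤ C
  A_nn : 0 ≤ A
  min_ax : ∀ g x, (∀ y, d x (g * x) ≤ d y (g * y)) → g ^ n = 1 ∨ (∃ i : ι, g • i = i) ∨ Ax d c g x
  line_ax : ∀ u p q D, u ≠ 1 → 0 ≤ D → d p (u * p) ≤ D → d q (u * q) ≤ D →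
    (∀ z, Bt d 0 p z q → C * D + A ≤ d p z → C * D + A ≤ d z q → Ax d c u z) ∨
    ∃ i : ι, u • i = i ∧ ∀ z, Bt d 0 p z q → C * D + A ≤ d p z → C * D + A ≤ d z q →
      ∃ y ∈ Y i, d z y ≤ c
  comm : ∀ u v p q z D, 0 ≤ D → d p (u * p) ≤ D → d q (u * q) ≤ D → d p (v * p) ≤ D →
    d q (v * q) ≤ D → Bt d 0 p z q → C * D + A ≤ d p z → C * D + A ≤ d z q → u * v = v * u
  fix_pow : ∀ g (i : ι), g • i = i → g ^ n ∈ R i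
  t_abs : ∀ i, ∀ y ∈ Y i, ∀ y' ∈ Y i, |(|t i y y'|) - d y y'| ≤ c
  t_add : ∀ i, ∀ y ∈ Y i, ∀ y' ∈ Y i, ∀ y'' ∈ Y i, |t i y y' + t i y' y'' - t i y y''| ≤ c
  t_smul : ∀ (g : G) i, ∀ y ∈ Y i, ∀ y' ∈ Y i, |t (g • i) (g * y) (g * y') - t i y y'| ≤ c
  t_rot : ∀ i, ∀ y ∈ Y i, ∀ y' ∈ Y i, ∃ r ∈ R i, ∃ r' ∈ R i, ∃ τ, 0 ≤ τ ∧ τ ≤ N i ∧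
    |t i y (r * y') - τ| ≤ c ∧ |t i y (r' * y') - (τ - N i)| ≤ c

/-- Elements are either torsion or have uniformly positive translation length. -/
def Low {G : Type} [Group G] (d : G → G → ℤ) (n : ℕ) (T : ℤ) : Prop :=
  ∀ g : G, g ^ n = 1 ∨ ∀ (x : G) (j : ℕ), (j : ℤ) ≤ T * d x (g ^ j * x)

theorem low_of_orbit {G : Type} [Group G] {D : G → G → ℤ} {δ : ℤ} (hm : HM D δ) {g z : G} {k0 : ℕ}
    (hsup : ∀ j k : ℕ, D z (g ^ j * z) + D z (g ^ k * z) ≤ D z (g ^ (j + k) * z) + 6)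
    (h0 : 7 ≤ D z (g ^ k0 * z)) (x : G) (j : ℕ) : (j : ℤ) ≤ k0 * D x (g ^ j * x) := by
  have h1 : ∀ m : ℕ, (m : ℤ) ≤ D z (g ^ (m * k0) * z) := by
    intro m
    cases m with
    | zero => simpa using hm.nn _ _
    | succ m =>
      have := Ax.mul_le hsup m k0
      have h2 : ((m : ℤ) + 1) * 7 ≤ (m + 1) * D z (g ^ k0 * z) :=
        mul_le_mul_of_nonneg_left h0 (by positivity)
      push_cast
      linarith
  have h2 : ∀ m : ℕ, D x (g ^ (m * j) * x) ≤ m * D x (g ^ j * x) := by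
    intro m
    induction m with
    | zero => simp [hm.self]
    | succ m ih =>
      have := hm.tri x (g ^ (m * j) * x) (g ^ ((m + 1) * j) * x)
      rw [add_mul, pow_add, mul_assoc, hm.inv, one_mul] at this
      rw [add_mul, pow_add, mul_assoc, one_mul]
      push_cast
      linarith
  by_contra! hlt
  have h3 := h1 ((2 * D z x + 1).toNat * j)
  have h4 := h2 ((2 * D z x + 1).toNat * k0)
  rw [mul_right_comm] at h4
  have h5 := hm.tri z x (g ^ ((2 * D z x + 1).toNat * j * k0) * z)
  have h6 := hm.tri x (g ^ ((2 * D z x + 1).toNat * j * k0) * x)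
    (g ^ ((2 * D z x + 1).toNat * j * k0) * z)
  rw [hm.inv, hm.symm x z] at h6
  have h7 := hm.nn z x
  push_cast at h3 h4
  rw [Int.toNat_of_nonneg (by omega)] at h3 h4
  nlinarith

namespace FamX
variable {G ι : Type} [Group G] [MulAction G ι] {d : G → G → ℤ} {Y : ι → Set G}
    {R : ι → Subgroup G} {N : ι → ℤ} {t : ι → G → G → ℤ} {n : ℕ} {c N0 C A : ℤ}
    (F : FamX d Y R N t n c N0 C A)
    {M : ℤ} (hM : 100 * c ≤ M) {Q : Type} [Group Q] {π : G →* Q} (hπ : IsQuo π R)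
include F

theorem rot (i : ι) {y y' : G} (hy : y ∈ Y i) (hy' : y' ∈ Y i) :
    ∃ r ∈ R i, 2 * d y (r * y') ≤ N i + 4 * c := by
  obtain ⟨r, hr, r', hr', τ, h0, h1, h2, h3⟩ := F.t_rot i y hy y' hy'
  have hY : ∀ s ∈ R i, s * y' ∈ Y i := fun s hs => by
    have := F.Y_smul s i y' hy'; rwa [F.R_fix i s hs] at this
  have a1 := F.t_abs i y hy _ (hY r hr)
  have a2 := F.t_abs i y hy _ (hY r' hr')
  rw [abs_le] at a1 a2 h2 h3
  by_cases hτ : 2 * τ ≤ N i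
  · refine ⟨r, hr, ?_⟩
    have : |t i y (r * y')| ≤ τ + c := by rw [abs_le]; omega
    omega
  · refine ⟨r', hr', ?_⟩
    have : |t i y (r' * y')| ≤ N i - τ + c := by rw [abs_le]; omega
    omega

include hM hπ

theorem quo_low (hN : 100 * M ≤ N0) : Low (quoD π d Y M) n (200 * M) := by
  have hc := F.c_pos
  intro a
  rw [or_iff_not_imp_left]
  intro han
  obtain ⟨g0, hg0⟩ := hπ.surj a
  have hex : ∃ k : ℕ, ∃ g b, π g = b * a * b⁻¹ ∧ d 1 g = k := by
    refine ⟨(d 1 g0).toNat, g0, 1, by simp [hg0], ?_⟩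
    have := F.hm.nn 1 g0; omega
  classical
  obtain ⟨g, b, hg, hgk⟩ := Nat.find_spec hex
  have hmin : ∀ g' b', π g' = b' * a * b'⁻¹ → d 1 g ≤ d 1 g' := by
    intro g' b' h'
    have := Nat.find_min' hex (m := (d 1 g').toNat) ⟨g', b', h', by
      have := F.hm.nn 1 g'; omega⟩
    have := F.hm.nn 1 g'
    omega
  have hconj : ∀ k : ℕ, π g ^ k = b * a ^ k * b⁻¹ := by intro k; rw [hg, conj_pow]
  have hgn : g ^ n ∉ ⨆ i, R i := by
    intro h
    rw [← hπ.ker, map_pow, hconj] at h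
    exact han (by simpa using h)
  have hi : ∀ i : ι, g • i ≠ i := fun i h =>
    hgn (Subgroup.mem_iSup_of_mem i (F.fix_pow g i h))
  have hax : Ax d c g 1 := by
    have hy : ∀ y, d 1 (g * 1) ≤ d y (g * y) := fun y => by
      have := hmin (y⁻¹ * g * y) ((π y)⁻¹ * b) (by simp [hg, mul_assoc])
      have e : d 1 (y⁻¹ * g * y) = d y (g * y) := by rw [← F.hm.inv y]; simp [mul_assoc]
      rwa [e, show d 1 g = d 1 (g * 1) by rw [mul_one]] at this
    rcases F.min_ax g 1 hy with h | ⟨i, h⟩ | h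
    · exact absurd (h ▸ Subgroup.one_mem _) hgn
    · exact absurd h (hi i)
    · exact h
  have hl : ∀ i (j : ℕ), F.dI i 1 (g ^ j * 1) + 10 * M + 100 * c < N i := by
    intro i j
    by_contra! hlt
    have hNi := F.N_ge i
    obtain ⟨P, hP, r, hr, -, -, h1, h2⟩ := F.crossing hax (hi i) (j := j) (by omega)
    obtain ⟨ρ, hρ, h3⟩ := F.rot i hP hr
    have h4 := F.hm.tri P (ρ * r) (ρ * (g * P))
    rw [F.hm.inv] at h4
    have h5 := hmin (P⁻¹ * ρ * g * P) ((π P)⁻¹ * b) (by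
      simp [hg, mul_assoc, (hπ.ker ρ).2 (Subgroup.mem_iSup_of_mem i hρ)])
    have e : d 1 (P⁻¹ * ρ * g * P) = d P (ρ * (g * P)) := by
      rw [← F.hm.inv P]; simp [mul_assoc]
    rw [e] at h5
    simp only [mul_one] at h1 h2 hlt
    omega
  have hq := F.quo_axis hM hπ hl
  have hHM := F.quo_HM hM hπ (by omega)
  intro x j
  have := low_of_orbit hHM (g := π g) (z := π 1) (k0 := (200 * M).toNat)
    (fun j k => by rw [hq, hq, hq]; exact F.cone_sup hM hax j k)
    (by rw [hq]; exact F.cone_low hM hax hi) (b * x) j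
  rw [hconj, Int.toNat_of_nonneg (by omega)] at this
  rwa [← hHM.inv b, show b * (a ^ j * x) = b * a ^ j * b⁻¹ * (b * x) by group]

end FamX
end PG

namespace PG

theorem exists_gap (m : ℕ) (τ N : ℕ → ℤ) (hN : ∀ a < m, 0 < N a) :
    ∃ h : ℤ, 0 ≤ h ∧ h ≤ m ∧ ∀ a < m, (m + 1) * τ a ≤ h * N a ∨ (h + 1) * N a ≤ (m + 1) * τ a := by
  classical
  have hcard : ((Finset.range m).image fun a => (m + 1) * τ a / N a).card <
      (Finset.Icc (0 : ℤ) m).card := by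
    refine lt_of_le_of_lt Finset.card_image_le ?_
    simp
  obtain ⟨h, h1, h2⟩ := Finset.exists_mem_notMem_of_card_lt_card hcard
  rw [Finset.mem_Icc] at h1
  refine ⟨h, h1.1, h1.2, fun a ha => ?_⟩
  by_contra! hcon
  refine h2 (Finset.mem_image.2 ⟨a, Finset.mem_range.2 ha, ?_⟩)
  have hNa := hN a ha
  refine le_antisymm ?_ ?_
  · exact Int.lt_add_one_iff.1 ((Int.ediv_lt_iff_lt_mul hNa).2 hcon.2)
  · exact (Int.le_ediv_iff_mul_le hNa).2 hcon.1.le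

namespace FamX
variable {G ι : Type} [Group G] [MulAction G ι] {d : G → G → ℤ} {Y : ι → Set G}
    {R : ι → Subgroup G} {N : ι → ℤ} {t : ι → G → G → ℤ} {n : ℕ} {c N0 C A : ℤ}
    (F : FamX d Y R N t n c N0 C A)
    {M : ℤ} (hM : 100 * c ≤ M) {Q : Type} [Group Q] {π : G →* Q} (hπ : IsQuo π R)
include F

/-- The signed coordinate along the `i`-th line. -/
noncomputable def tI (i : ι) (x y : G) : ℤ := t i (F.pr i x) (F.pr i y)

theorem tI_add (i : ι) (x y z : G) : |F.tI i x y + F.tI i y z - F.tI i x z| ≤ c :=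
  F.t_add i _ (F.pr_gate i x).1 _ (F.pr_gate i y).1 _ (F.pr_gate i z).1

theorem tI_abs (i : ι) (x y : G) : |(|F.tI i x y|) - F.dI i x y| ≤ c :=
  F.t_abs i _ (F.pr_gate i x).1 _ (F.pr_gate i y).1

/-- Every crossing of a line by a geodesic from `p` to `q` has coordinates in a fixed window. -/
def Win (M : ℤ) (m : ℕ) (h : ℤ) (p q : G) : Prop := ∀ i, F.dI i p q ≤ 30 * M ∨
  ∃ P ∈ Y i, ∃ P' ∈ Y i, F.dI i p P ≤ 10 * M ∧ F.dI i P' q ≤ 10 * M ∧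
    -((m - h) * N i) ≤ (m + 1) * (t i P P' + 2 * c) ∧ (m + 1) * (t i P P' - 2 * c) ≤ h * N i

include hM

theorem win_t {m : ℕ} {h : ℤ} {p q : G} (h0 : 0 ≤ h) (hm : h ≤ m) (hw : F.Win M m h p q) (g : G)
    (i : ι) : -((m - h) * N i) ≤ (m + 1) * (F.tI i (g * p) (g * q) + 40 * M) ∧
      (m + 1) * (F.tI i (g * p) (g * q) - 40 * M) ≤ h * N i := by
  have hc := F.c_pos
  have hNi := F.N_ge i
  have hNb := F.N_big
  have hsm : ∀ x y, |F.dI i (g * x) (g * y) - F.dI (g⁻¹ • i) x y| ≤ 2 * c := fun x y => by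
    have := F.dI_smul g (g⁻¹ • i) x y
    rwa [smul_inv_smul] at this
  rcases hw (g⁻¹ • i) with h1 | ⟨P, hP, P', hP', h1, h2, h3, h4⟩
  · have a1 := hsm p q
    have a2 := F.tI_abs i (g * p) (g * q)
    rw [abs_le] at a1 a2
    have a3 : |F.tI i (g * p) (g * q)| ≤ 40 * M := by omega
    rw [abs_le] at a3
    have b1 : 0 ≤ (m - h) * N i := mul_nonneg (by omega) (by omega)
    have b2 : 0 ≤ h * N i := mul_nonneg (by omega) (by omega)
    have b3 : 0 ≤ (m + 1) * (F.tI i (g * p) (g * q) + 40 * M) :=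
      mul_nonneg (by omega) (by omega)
    have b4 : (m + 1) * (F.tI i (g * p) (g * q) - 40 * M) ≤ 0 :=
      mul_nonpos_of_nonneg_of_nonpos (by omega) (by omega)
    omega
  · have gP : g * P ∈ Y i := by rw [← F.Y_smul_iff g] at hP; rwa [smul_inv_smul] at hP
    have gP' : g * P' ∈ Y i := by rw [← F.Y_smul_iff g] at hP'; rwa [smul_inv_smul] at hP'
    have a1 := hsm p P
    have a2 := hsm P' q
    have a3 := F.hm.gate_self gP (F.pr_gate i _)
    have a4 := F.hm.gate_self gP' (F.pr_gate i _)
    have a5 := F.hm.tri (F.pr i (g * p)) (F.pr i (g * P)) (g * P)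
    have a6 := F.hm.tri (g * P') (F.pr i (g * P')) (F.pr i (g * q))
    have a7 := F.hm.symm (F.pr i (g * P)) (g * P)
    change _ ≤ F.dI i (g * p) (g * P) + _ at a5
    change _ ≤ _ + F.dI i (g * P') (g * q) at a6
    have p1 := (F.pr_gate i (g * p)).1
    have q1 := (F.pr_gate i (g * q)).1
    have b1 := F.t_abs i _ p1 _ gP
    have b2 := F.t_abs i _ gP' _ q1
    have b3 := F.t_add i _ p1 _ gP _ gP'
    have b4 := F.t_add i _ p1 _ gP' _ q1
    have b5 := F.t_smul g _ _ hP _ hP'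
    rw [smul_inv_smul] at b5
    rw [F.N_smul] at h3 h4
    change |_ + _ - F.tI i (g * p) (g * q)| ≤ c at b4
    rw [abs_le] at a1 a2 b1 b2 b3 b4 b5
    have e1 : |t i (F.pr i (g * p)) (g * P)| ≤ 11 * M := by omega
    have e2 : |t i (g * P') (F.pr i (g * q))| ≤ 11 * M := by omega
    rw [abs_le] at e1 e2
    refine ⟨h3.trans ?_, le_trans ?_ h4⟩ <;>
      exact mul_le_mul_of_nonneg_left (by omega) (by omega)

include hπ

theorem exists_win {m : ℕ} {p q : G} (h1 : cone d Y M p q = m)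
    (h2 : quoD π d Y M (π p) (π q) = m) :
    ∃ (q' : G) (h : ℤ), π q' = π q ∧ cone d Y M p q' = m ∧ 0 ≤ h ∧ h ≤ m ∧ F.Win M m h p q' := by
  have hc := F.c_pos
  obtain ⟨m', hm', γ, hγ⟩ := pathD_spec (F.conn hM) p q
  have : m' = m := by unfold cone at h1; omega
  subst this
  have hedge : ∀ a, ∃ (ρ ρ' : G) (τ ν : ℤ), a < m' → ρ ∈ ⨆ i, R i ∧ ρ' ∈ ⨆ i, R i ∧ 0 < ν ∧
      0 ≤ τ ∧ τ ≤ ν ∧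
      ((d (γ a) (γ (a + 1)) ≤ M ∧ ρ = 1 ∧ ρ' = 1) ∨ ∃ i, ν = N i ∧ γ a ∈ Y i ∧
        ρ * γ (a + 1) ∈ Y i ∧ ρ' * γ (a + 1) ∈ Y i ∧
        |t i (γ a) (ρ * γ (a + 1)) - τ| ≤ c ∧ |t i (γ a) (ρ' * γ (a + 1)) - (τ - ν)| ≤ c) := by
    intro a
    by_cases ha : a < m'
    swap
    · exact ⟨1, 1, 0, 0, fun h => absurd h ha⟩
    rcases hγ.2.2 a ha with h | ⟨i, -, hy, hy'⟩
    · exact ⟨1, 1, 0, 1, fun _ => ⟨Subgroup.one_mem _, Subgroup.one_mem _, by norm_num, le_rfl,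
        by norm_num, .inl ⟨h, rfl, rfl⟩⟩⟩
    · obtain ⟨r, hr, r', hr', τ, t0, t1, t2, t3⟩ := F.t_rot i _ hy _ hy'
      have hY : ∀ s ∈ R i, s * γ (a + 1) ∈ Y i := fun s hs => by
        have := F.Y_smul s i _ hy'; rwa [F.R_fix i s hs] at this
      have := F.N_ge i
      have := F.N_big
      exact ⟨r, r', τ, N i, fun _ => ⟨Subgroup.mem_iSup_of_mem i hr, Subgroup.mem_iSup_of_mem i hr',
        by omega, t0, t1, .inr ⟨i, rfl, hy, hY r hr, hY r' hr', t2, t3⟩⟩⟩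
  choose ρ ρ' τ ν hE using hedge
  obtain ⟨h, h0, hm, hgap⟩ := exists_gap m' τ ν fun a ha => (hE a ha).2.2.1
  classical
  set s : ℕ → G := fun a => if (m' + 1) * τ a ≤ h * ν a then ρ a else ρ' a with hs
  set k : ℕ → G := fun a => Nat.rec 1 (fun b g => g * s b) a with hk
  have k0 : k 0 = 1 := rfl
  have ks : ∀ a, k (a + 1) = k a * s a := fun a => rfl
  have hkK : ∀ a ≤ m', k a ∈ ⨆ i, R i := by
    intro a
    induction a with
    | zero => intro _; exact Subgroup.one_mem _
    | succ a ih =>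
      intro ha
      rw [ks]
      refine Subgroup.mul_mem _ (ih (by omega)) ?_
      simp only [hs]
      split_ifs
      · exact (hE a (by omega)).1
      · exact (hE a (by omega)).2.1
  set γ' : ℕ → G := fun a => k a * γ a with hγ'
  have hWE : ∀ a < m', d (γ' a) (γ' (a + 1)) ≤ M ∨ ∃ i, γ' a ∈ Y i ∧ γ' (a + 1) ∈ Y i ∧
      -((m' - h) * N i) ≤ (m' + 1) * (t i (γ' a) (γ' (a + 1)) + 2 * c) ∧
      (m' + 1) * (t i (γ' a) (γ' (a + 1)) - 2 * c) ≤ h * N i := by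
    intro a ha
    obtain ⟨-, -, hν, τ0, τ1, hh⟩ := hE a ha
    have e : γ' (a + 1) = k a * (s a * γ (a + 1)) := by simp only [hγ', ks, mul_assoc]
    rw [e]
    rcases hh with ⟨hd, r1, r2⟩ | ⟨i, rfl', hy, hy1, hy2, t1, t2⟩
    · left
      simp only [hγ', hs, r1, r2, ite_self, one_mul]
      rwa [F.hm.inv]
    · right
      have hsy : s a * γ (a + 1) ∈ Y i := by simp only [hs]; split_ifs <;> assumption
      refine ⟨k a • i, F.Y_smul _ _ _ hy, F.Y_smul _ _ _ hsy, ?_⟩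
      have t3 := F.t_smul (k a) i _ hy _ hsy
      rw [F.N_smul, ← rfl']
      simp only [hγ']
      rw [abs_le] at t1 t2 t3
      generalize t (k a • i) (k a * γ a) (k a * (s a * γ (a + 1))) = T at *
      by_cases hif : (m' + 1) * τ a ≤ h * ν a
      · simp only [hs, if_pos hif] at t3
        constructor
        · have b1 : 0 ≤ (m' - h) * ν a := mul_nonneg (by omega) (by omega)
          have b2 : 0 ≤ (m' + 1) * (T + 2 * c) := mul_nonneg (by omega) (by omega)
          omega
        · have b2 : (m' + 1) * (T - 2 * c) ≤ (m' + 1) * τ a :=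
            mul_le_mul_of_nonneg_left (by omega) (by omega)
          omega
      · simp only [hs, if_neg hif] at t3
        have hif2 := (hgap a ha).resolve_left hif
        constructor
        · have b2 : (m' + 1) * (τ a - ν a) ≤ (m' + 1) * (T + 2 * c) :=
            mul_le_mul_of_nonneg_left (by omega) (by omega)
          linarith
        · have b1 : 0 ≤ h * ν a := mul_nonneg (by omega) (by omega)
          have b2 : (m' + 1) * (T - 2 * c) ≤ 0 :=
            mul_nonpos_of_nonneg_of_nonpos (by omega) (by omega)
          omega
  have hp : IsPath (cEdge d Y M Set.univ) γ' m' p (k m' * q) := by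
    refine ⟨by simp [hγ', k0, hγ.1], by simp [hγ', hγ.2.1], fun a ha => ?_⟩
    rcases hWE a ha with h | ⟨i, h3, h4, -⟩
    · exact .inl h
    · exact .inr ⟨i, trivial, h3, h4⟩
  have hq : π (k m' * q) = π q := by simp [(hπ.ker _).2 (hkK m' le_rfl)]
  have hlen : cone d Y M p (k m' * q) = m' := by
    refine le_antisymm (pathD_le hp) ?_
    have := F.quo_le hM hπ p (k m' * q)
    rw [hq] at this
    omega
  refine ⟨k m' * q, h, hq, hlen, h0, hm, fun i => ?_⟩
  by_cases hbig : F.dI i p (k m' * q) ≤ 30 * M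
  · exact .inl hbig
  obtain ⟨a, ha, y1, y2⟩ := F.line_edge hM hp hlen (i := i) (by omega)
  obtain ⟨s1, s2⟩ := F.edge_sides hM hp hlen ha y1 y2
  have u1 := F.dI_tri i p (γ' a) (k m' * q)
  have u2 := F.dI_tri i (γ' a) (γ' (a + 1)) (k m' * q)
  rcases hWE a ha with h3 | ⟨j, z1, z2, h3, h4⟩
  · have := F.dI_lip i (γ' a) (γ' (a + 1))
    omega
  · by_cases hij : i = j
    · subst hij
      exact .inr ⟨_, y1, _, y2, s1, s2, h3, h4⟩
    · have := F.overlap i j hij _ z1 _ z2 _ _ (F.pr_gate i _) (F.pr_gate i _)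
      change F.dI i (γ' a) (γ' (a + 1)) ≤ c at this
      omega

omit hπ in
/-- Closing up a quadrilateral with two opposite sides given by a windowed geodesic. -/
theorem close_up {m : ℕ} {h : ℤ} {p q : G} (h0 : 0 ≤ h) (hm : h ≤ m) (hw : F.Win M m h p q)
    (hN : (m + 1) * (200 * M) ≤ N0) {D1 : ℤ} {x k : G}
    (hk : GoodF R F.dI (fun i => N i - 100 * c) x k) (u0 w : G) (hx : x = u0 * w * q)
    (h1 : cone d Y M (w * p) (u0 * w * p) ≤ D1) (h2 : cone d Y M (w * q) (k * u0 * w * q) ≤ D1)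
    (hww : w ∈ ⨆ i, R i) :
    ∃ u1 k1 w1 : G, k1 ∈ ⨆ i, R i ∧ w1 ∈ ⨆ i, R i ∧ u1 = w1⁻¹ * u0 * k1 * w1 ∧
      cone d Y M p (u1 * p) ≤ D1 ∧ cone d Y M q (u1 * q) ≤ D1 := by
  have hc := F.c_pos
  induction hk generalizing u0 w with
  | one =>
    refine ⟨w⁻¹ * u0 * w, 1, w, Subgroup.one_mem _, hww, by group, ?_, ?_⟩
    · rw [← F.cone_inv hM w]; simpa [mul_assoc] using h1
    · rw [← F.cone_inv hM w]; simpa [mul_assoc] using h2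
  | step k g i hg hD hk ih =>
    subst hx
    have hgK : g ∈ ⨆ i, R i := Subgroup.mem_iSup_of_mem i hg
    by_cases hA : 10 * M < F.dI i (u0 * w * p) (w * p)
    · have hb := F.bend hM hg hA
      obtain ⟨u1, k1, w1, hk1, hw1, hu, c1, c2⟩ := ih (u0 * g⁻¹) (g * w) (by group) (by
          rw [F.cone_symm hM] at h1 ⊢
          refine le_trans (le_of_eq_of_le ?_ hb) h1
          congr 1 <;> group) (by
          rw [← F.cone_inv hM g] at h2
          refine le_of_eq_of_le ?_ h2
          congr 1 <;> group) (Subgroup.mul_mem _ hgK hww)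
      exact ⟨u1, g⁻¹ * k1, w1, Subgroup.mul_mem _ (Subgroup.inv_mem _ hgK) hk1, hw1,
        by rw [hu]; group, c1, c2⟩
    by_cases hB : 10 * M < F.dI i (w * q) (k * (u0 * w * q))
    · have hb := F.bend hM hg hB
      refine ih u0 w rfl h1 (le_trans (le_of_eq_of_le ?_ hb) (le_of_eq_of_le ?_ h2)) hww
      · congr 1; group
      · congr 1; group
    exfalso
    have hNi := F.N_ge i
    obtain ⟨a1, a2⟩ := F.win_t hM h0 hm hw w i
    obtain ⟨b1, b2⟩ := F.win_t hM h0 hm hw (u0 * w) i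
    have t1 := F.tI_add i (u0 * w * q) (u0 * w * p) (w * p)
    have t2 := F.tI_add i (u0 * w * q) (w * p) (w * q)
    have t3 := F.tI_add i (u0 * w * q) (w * q) (k * (u0 * w * q))
    have t4 := F.tI_add i (u0 * w * q) (u0 * w * p) (u0 * w * q)
    have t5 := F.tI_abs i (u0 * w * q) (u0 * w * q)
    rw [F.dI_self] at t5
    have t6 := F.tI_abs i (u0 * w * q) (k * (u0 * w * q))
    have t7 := F.tI_abs i (u0 * w * p) (w * p)
    have t8 := F.tI_abs i (w * q) (k * (u0 * w * q))
    generalize F.tI i (u0 * w * q) (u0 * w * p) = s1 at *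
    generalize F.tI i (u0 * w * p) (w * p) = s2 at *
    generalize F.tI i (u0 * w * q) (w * p) = s3 at *
    generalize F.tI i (w * p) (w * q) = s4 at *
    generalize F.tI i (u0 * w * q) (w * q) = s5 at *
    generalize F.tI i (w * q) (k * (u0 * w * q)) = s6 at *
    generalize F.tI i (u0 * w * q) (k * (u0 * w * q)) = s7 at *
    generalize F.tI i (u0 * w * p) (u0 * w * q) = s8 at *
    generalize F.tI i (u0 * w * q) (u0 * w * q) = s9 at *
    replace hD : N i - 100 * c ≤ F.dI i (u0 * w * q) (k * (u0 * w * q)) := hD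
    have q2 : |s2| ≤ 11 * M := by rw [abs_le] at t7; omega
    have q6 : |s6| ≤ 11 * M := by rw [abs_le] at t8; omega
    have q7 : N i - 101 * c ≤ |s7| := by rw [abs_le] at t6; omega
    have q9 : |s9| ≤ c := by rw [abs_le] at t5; omega
    rw [abs_le] at t1 t2 t3 t4 q2 q6 q9
    have key : N i - 30 * M ≤ |s4 - s8| := by
      rcases abs_cases s7 with ⟨e, h⟩ | ⟨e, h⟩ <;> rcases abs_cases (s4 - s8) with ⟨e', h'⟩ | ⟨e', h'⟩ <;>
        omega
    have hm0 : (0 : ℤ) ≤ m := by omega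
    rcases abs_cases (s4 - s8) with ⟨e', -⟩ | ⟨e', -⟩ <;> rw [e'] at key <;> nlinarith

end FamX
end PG

namespace PG

/-- Elements displacing two far away points by at most `D` are loxodromic, their quasi-axes pass
near the geodesic between these points, and any two of them commute. -/
structure Thin {G : Type} [Group G] (d : G → G → ℤ) (n : ℕ) (D A : ℤ) : Prop where
  pow_ne : ∀ u p q z, u ≠ 1 → d p (u * p) ≤ D → d q (u * q) ≤ D → Bt d 0 p z q → A ≤ d p z →
    A ≤ d z q → u ^ n ≠ 1
  sup : ∀ u p q z, u ≠ 1 → d p (u * p) ≤ D → d q (u * q) ≤ D → Bt d 0 p z q → A ≤ d p z →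
    A ≤ d z q → ∀ j k : ℕ, d z (u ^ j * z) + d z (u ^ k * z) ≤ d z (u ^ (j + k) * z) + 200
  comm : ∀ u v p q z, d p (u * p) ≤ D → d q (u * q) ≤ D → d p (v * p) ≤ D → d q (v * q) ≤ D →
    Bt d 0 p z q → A ≤ d p z → A ≤ d z q → u * v = v * u

theorem HM.disp {G : Type} [Group G] {d : G → G → ℤ} {δ : ℤ} (h : HM d δ) {e D : ℤ} {u p z q : G}
    (hz : Bt d e p z q) (hp : d p (u * p) ≤ D) (hq : d q (u * q) ≤ D) :
    d z (u * z) ≤ e + 3 * D + δ := by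
  have h1 := (h.bt_inv u).2 hz
  have a1 := h.tri p (u * p) (u * z)
  have a2 := h.tri (u * p) p (u * z)
  have a3 := h.tri (u * z) (u * q) q
  have a4 := h.symm p (u * p)
  have a5 := h.symm q (u * q)
  have a6 := h.inv u p z
  have a7 := h.inv u p q
  have a8 := h.inv u z q
  have a9 := h.nn p (u * p)
  have h2 : Bt d (e + 2 * D) p (u * z) q := by unfold Bt at *; omega
  have := h.close (k := D) hz h2 (by rw [abs_le]; omega)
  have : max e (e + 2 * D) ≤ e + 2 * D := max_le (by omega) le_rfl
  omega

namespace FamX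
variable {G ι : Type} [Group G] [MulAction G ι] {d : G → G → ℤ} {Y : ι → Set G}
    {R : ι → Subgroup G} {N : ι → ℤ} {t : ι → G → G → ℤ} {n : ℕ} {c N0 C A : ℤ}
    (F : FamX d Y R N t n c N0 C A)
include F

theorem ax_near {u z : G} {i : ι} (h : Ax d c u z) (hi : u • i = i) :
    2 * d z (F.pr i z) ≤ 7 * c := by
  have hc := F.c_pos
  have gP := F.pr_gate i z
  set P := F.pr i z with hP
  have hpow : ∀ k : ℕ, u ^ k • i = i := fun k => by
    induction k with
    | zero => simp
    | succ k ih => rw [pow_succ', mul_smul, ih, hi]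
  have gk : ∀ k : ℕ, Gate d 2200 (Y i) (u ^ k * z) (u ^ k * P) := fun k => by
    have := F.gate_smul (u ^ k) gP
    rwa [hpow] at this
  have a0 := F.hm.nn z P
  set j := (2 * d z P + 2 * c).toNat with hj
  have h1 := h.low j
  have h2 := h.sup j j
  have h3 := F.hm.tri z P (u ^ j * z)
  have h4 := F.hm.tri P (u ^ j * P) (u ^ j * z)
  have h5 := F.hm.inv (u ^ j) P z
  have h6 := F.hm.symm P z
  have h7 := F.hm.gate_cross gP (gk j) (by omega)
  have h8 := F.hm.tri z P (u ^ (j + j) * z)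
  have h9 := F.hm.tri P (u ^ (j + j) * P) (u ^ (j + j) * z)
  have h10 := F.hm.inv (u ^ (j + j)) P z
  have h11 := F.hm.tri P (u ^ j * P) (u ^ (j + j) * P)
  have h12 : d (u ^ j * P) (u ^ (j + j) * P) = d P (u ^ j * P) := by
    rw [pow_add, mul_assoc, F.hm.inv]
  omega

variable {M : ℤ} (hM : 100 * c ≤ M) {Q : Type} [Group Q] {π : G →* Q} (hπ : IsQuo π R)
include hM

theorem near_cone {i : ι} {z z' y y' : G} (hy : y ∈ Y i) (hy' : y' ∈ Y i) (h : d z y ≤ M)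
    (h' : d z' y' ≤ M) : cone d Y M z z' ≤ 3 := by
  have h1 := F.cone_one hM h
  have h2 := F.cone_one hM h'
  have h3 := cone_line (d := d) (M := M) hy hy'
  have h4 := F.cone_tri hM z y z'
  have h5 := F.cone_tri hM y y' z'
  have h6 := F.cone_symm hM z' y'
  omega

/-- A point in the middle of a geodesic lies between displaced end points. -/
theorem bt_move {p q p' q' y : G} {e D1 : ℤ} (he2 : 2 * e + 5 * c ≤ M)
    (hy : Bt d e p y q) (hp : cone d Y M p p' ≤ D1) (hq : cone d Y M q q' ≤ D1)
    (h1 : D1 + 6 < cone d Y M p y) (h2 : D1 + 6 < cone d Y M y q) : Bt d (e + 2 * c) p' y q' := by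
  have hc := F.c_pos
  rcases F.hm.split hy p' with h | h
  · have := F.cone_bt hM h (by omega)
    unfold Bt at this
    have := cone_nn d Y M y p'
    omega
  rcases F.hm.split h q' with h | h
  · unfold Bt at *; omega
  · have := F.cone_bt hM h (by omega)
    unfold Bt at this
    have := cone_nn d Y M q' y
    have := F.cone_symm hM q' q
    omega

theorem bt_move' {p q p' y : G} {D1 : ℤ}
    (hy : Bt d 0 p y q) (hp : cone d Y M p p' ≤ D1)
    (h1 : D1 + 6 < cone d Y M p y) : Bt d c p' y q := by
  have hc := F.c_pos
  rcases F.hm.split hy p' with h | h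
  · have := F.cone_bt hM h (by omega)
    unfold Bt at this
    have := cone_nn d Y M y p'
    omega
  · unfold Bt at *; omega

theorem fwd {u p q y z : G} {D1 : ℤ} (hp : cone d Y M p (u * p) ≤ D1)
    (hq : cone d Y M q (u * q) ≤ D1) (hch : d p y + d y z + d z q ≤ d p q)
    (h1 : D1 + 6 < cone d Y M p y) (h2 : D1 + 6 < cone d Y M z q)
    (h3 : D1 + 6 < cone d Y M p z)
    (hs : d y z ≤ d p y - d (u * p) y + 5 * c) :
    cone d Y M y z ≤ 3 * D1 + 32 := by
  have hc := F.c_pos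
  have e0 := F.hm.tri y z q
  have e1 := F.hm.tri p y z
  have by0 : Bt d 0 p y q := by unfold Bt; omega
  have bz0 : Bt d 0 p z q := by unfold Bt; omega
  have bz := F.bt_move hM (by omega) bz0 hp hq h3 h2
  have buy := (F.hm.bt_inv u).2 by0
  have byz : Bt d 0 p y z := by unfold Bt; have := F.hm.tri p z q; omega
  have byz' := F.bt_move' hM byz hp h1
  have a1 := F.hm.inv u p y
  have a2 := F.hm.tri (u * p) y z
  have a3 := F.hm.close (k := |d (u * p) z - d (u * p) (u * y)|) bz buy le_rfl
  have a4 : max (0 + 2 * c) 0 = 2 * c := by rw [max_eq_left] <;> omega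
  have a5 := F.hm.tri (u * p) y (u * y)
  have key : Bt d (14 * c) y z (u * y) := by
    unfold Bt at *
    rcases abs_cases (d (u * p) z - d (u * p) (u * y)) with ⟨h, h'⟩ | ⟨h, h'⟩ <;> omega
  have k1 := F.cone_bt hM key (by omega)
  have k2 := (F.cone_HM hM).disp (F.cone_bt hM by0 (by omega)) hp hq
  unfold Bt at k1
  have := cone_nn d Y M z (u * y)
  omega

/-- The shift of `u` along a geodesic is almost constant, and bounds the displacement. -/
theorem shift {u p q y0 y1 w : G} {D1 : ℤ} (hp : cone d Y M p (u * p) ≤ D1)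
    (hq : cone d Y M q (u * q) ≤ D1) (h0 : D1 + 13 ≤ cone d Y M p y0)
    (h1 : D1 + 13 ≤ cone d Y M y1 q)
    (hw : d p y0 + d y0 w + d w y1 + d y1 q ≤ d p q) :
    D1 + 7 ≤ cone d Y M p w ∧ D1 + 7 ≤ cone d Y M w q ∧ Bt d (2 * c) (u * p) w (u * q) ∧
    0 ≤ (d p w - d (u * p) w) - (d p y0 - d (u * p) y0) ∧
    (d p w - d (u * p) w) - (d p y0 - d (u * p) y0) ≤ c ∧
    d w (u * w) ≤ |d p y0 - d (u * p) y0| + 4 * c := by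
  have hc := F.c_pos
  have e1 := F.hm.tri p y0 w
  have e2 := F.hm.tri w y1 q
  have e3 := F.hm.tri p w q
  have b1 : Bt d 0 p y0 w := by unfold Bt; omega
  have b2 : Bt d 0 w y1 q := by unfold Bt; omega
  have b3 : Bt d 0 p w q := by unfold Bt; omega
  have c1 := F.cone_bt hM b1 (by omega)
  have c2 := F.cone_bt hM b2 (by omega)
  have n1 := cone_nn d Y M y0 w
  have n2 := cone_nn d Y M w y1
  have g1 : D1 + 7 ≤ cone d Y M p w := by unfold Bt at c1; omega
  have g2 : D1 + 7 ≤ cone d Y M w q := by unfold Bt at c2; omega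
  have b4 := F.bt_move hM (by omega) b3 hp hq (by omega) (by omega)
  have b5 := F.bt_move' hM b1 hp (by omega)
  have a1 := F.hm.tri (u * p) y0 w
  have a2 := F.hm.inv u p w
  have a3 := F.hm.close (k := |d (u * p) w - d (u * p) (u * w)|) b4 ((F.hm.bt_inv u).2 b3) le_rfl
  have a4 : max (0 + 2 * c) 0 = 2 * c := by rw [max_eq_left] <;> omega
  refine ⟨g1, g2, by rwa [zero_add] at b4, ?_, ?_, ?_⟩
  · unfold Bt at *; omega
  · unfold Bt at *; omega
  · unfold Bt at *
    rcases abs_cases (d (u * p) w - d (u * p) (u * w)) with ⟨h, h'⟩ | ⟨h, h'⟩ <;>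
    rcases abs_cases (d p y0 - d (u * p) y0) with ⟨k, k'⟩ | ⟨k, k'⟩ <;> omega

theorem small_step {u p q y0 y1 w w' : G} {D1 : ℤ} (hp : cone d Y M p (u * p) ≤ D1)
    (hq : cone d Y M q (u * q) ≤ D1) (h0 : D1 + 13 ≤ cone d Y M p y0)
    (h1 : D1 + 13 ≤ cone d Y M y1 q)
    (hw : d p y0 + d y0 w + d w w' + d w' y1 + d y1 q ≤ d p q)
    (hS : d w w' ≤ |d p y0 - d (u * p) y0|) : cone d Y M w w' ≤ 3 * D1 + 32 := by
  have hc := F.c_pos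
  have e1 := F.hm.tri y0 w w'
  have e2 := F.hm.tri w w' y1
  have e3 := F.hm.tri p y0 w
  have e4 := F.hm.tri p y0 w'
  have e5 := F.hm.tri w' y1 q
  have e6 := F.hm.tri w y1 q
  obtain ⟨a1, a2, a3, a4, a5, -⟩ := F.shift hM hp hq h0 h1 (w := w) (by omega)
  obtain ⟨b1, b2, b3, b4, b5, -⟩ := F.shift hM hp hq h0 h1 (w := w') (by omega)
  rcases abs_cases (d p y0 - d (u * p) y0) with ⟨k, k'⟩ | ⟨k, k'⟩
  · exact F.fwd hM hp hq (by omega) (by omega) (by omega) (by omega) (by omega)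
  · rw [F.cone_symm hM]
    have s1 := F.hm.symm q w'
    have s2 := F.hm.symm w' w
    have s3 := F.hm.symm w p
    have s4 := F.hm.symm q p
    have s5 := F.hm.symm (u * q) w'
    have f1 := F.hm.tri p w' q
    have f2 := F.hm.tri (u * p) w' (u * q)
    have f3 := F.hm.inv u p q
    refine F.fwd hM hq hp (by omega) ?_ ?_ ?_ ?_
    · rw [F.cone_symm hM]; omega
    · rw [F.cone_symm hM]; omega
    · rw [F.cone_symm hM]; omega
    · unfold Bt at b3; omega

theorem many_steps {p q y0 y1 : G} {S E : ℤ} (hS0 : 0 ≤ S)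
    (hS : ∀ w w', d p y0 + d y0 w + d w w' + d w' y1 + d y1 q ≤ d p q → d w w' ≤ S →
      cone d Y M w w' ≤ E) (k : ℕ) {w w' : G}
    (hw : d p y0 + d y0 w + d w w' + d w' y1 + d y1 q ≤ d p q) (hk : d w w' ≤ k * S) :
    cone d Y M w w' ≤ k * E := by
  induction k generalizing w' with
  | zero =>
    have := F.hm.nn w w'
    have := F.hm.eq_of w w' (by push_cast at hk; omega)
    subst this
    rw [F.cone_self hM]; simp
  | succ k ih =>
    have hn := F.hm.nn w w'
    push_cast at hk ⊢
    rw [add_mul, one_mul] at hk ⊢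
    obtain ⟨v, v1, v2⟩ := F.hm.geo w w' (max 0 (d w w' - S)) (by omega) (by omega)
    have e1 := F.hm.tri y0 w v
    have e2 := F.hm.tri v w' y1
    have hkS : 0 ≤ k * S := mul_nonneg (by omega) hS0
    have a1 := ih (w' := v) (by omega) (by omega)
    have a2 := hS v w' (by omega) (by omega)
    have a3 := F.cone_tri hM w v w'
    omega

end FamX
end PG

namespace PG
/-- The order of two points near a geodesic. -/
theorem HM.order {G : Type} [Group G] {d : G → G → ℤ} {c : ℤ} (hm : HM d c) {p q a b : G} {e e' : ℤ} (he : e' ≤ e)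
    (ha : Bt d e p a q) (hb : Bt d e' p b q) :
    d p a + d a b + d b q ≤ d p q + e + e' + c ∨ d p b + d a b + d a q ≤ d p q + 2 * e + c := by
  have h := hm.close ha hb le_rfl
  rw [max_eq_left he] at h
  unfold Bt at *
  rcases abs_cases (d p a - d p b) with ⟨k, k'⟩ | ⟨k, k'⟩ <;> omega

namespace FamX
variable {G ι : Type} [Group G] [MulAction G ι] {d : G → G → ℤ} {Y : ι → Set G}
    {R : ι → Subgroup G} {N : ι → ℤ} {t : ι → G → G → ℤ} {n : ℕ} {c N0 C A : ℤ}
    (F : FamX d Y R N t n c N0 C A)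
    {M : ℤ} (hM : 100 * c ≤ M) {Q : Type} [Group Q] {π : G →* Q} (hπ : IsQuo π R)
include F hM

set_option maxHeartbeats 800000 in
theorem thin_core {p q u v : G} {A1 D1 : ℤ} (hA1 : (C + 1) * (3 * D1 + 32) + 4 * D1 + 100 ≤ A1)
    (hMA : 4 * c * C + A ≤ M) (hpq : cone d Y M p q = 2 * A1)
    (hpu : cone d Y M p (u * p) ≤ D1) (hqu : cone d Y M q (u * q) ≤ D1)
    (hpv : cone d Y M p (v * p) ≤ D1) (hqv : cone d Y M q (v * q) ≤ D1) :
    ∃ z, Bt d 0 p z q ∧ cone d Y M p z = A1 ∧ (u ≠ 1 → Ax d c u z ∧ ∀ i : ι, u • i ≠ i) ∧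
      u * v = v * u := by
  have hc := F.c_pos
  have hC := F.C_nn
  have hA := F.A_nn
  have hD1 : 0 ≤ D1 := (cone_nn d Y M _ _).trans hpu
  set E := 3 * D1 + 32 with hE
  have hCE : 0 ≤ (C + 1) * E := mul_nonneg (by omega) (by omega)
  have CS := F.cone_symm hM
  have CT := F.cone_tri hM
  obtain ⟨z, hz, hz1⟩ := F.exact_cone hM (t := A1) (x := q) (z := p) (by omega) (by omega)
  obtain ⟨y0, hy0, hy01⟩ := F.exact_cone hM (t := D1 + 13) (x := z) (z := p) (by omega) (by omega)
  have zq := CT p z q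
  obtain ⟨y1, hy1, hy11⟩ := F.exact_cone hM (t := D1 + 13) (x := z) (z := q) (by omega)
    (by rw [CS q z]; omega)
  have zy1 := CT z y1 q
  have sy1 := CS q y1
  obtain ⟨w, hw, hw1⟩ := F.exact_cone hM (t := 4) (x := y1) (z := z) (by omega) (by omega)
  have zw := CT z w y1
  have zy0 := CT p y0 z
  have s1 := F.hm.symm q z
  have s2 := F.hm.symm z p
  have s3 := F.hm.symm q p
  have s4 := F.hm.symm z y0
  have s5 := F.hm.symm y0 p
  have s6 := F.hm.symm y1 q
  have s7 := F.hm.symm y1 w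
  have s8 := F.hm.symm w z
  have s9 := F.hm.symm y1 z
  unfold Bt at hz hy0 hy1 hw
  have hch : d p y0 + d y0 z + d z w + d w y1 + d y1 q ≤ d p q := by omega
  have t1 := F.hm.tri y0 z w
  have t2 := F.hm.tri z w y1
  have t3 := F.hm.tri y0 z y1
  have t4 := F.hm.tri p y0 q
  have t5 := F.hm.tri y0 y1 q
  have t6 := F.hm.tri y0 w q
  have t7 := F.hm.tri w y1 q
  have t8 := F.hm.tri y0 z q
  have t9 := F.hm.tri z y1 q
  have hy0q : D1 + 13 ≤ cone d Y M p y0 := hy01.ge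
  have hy1q : D1 + 13 ≤ cone d Y M y1 q := by omega
  set S := max M (max |d p y0 - d (u * p) y0| |d p y0 - d (v * p) y0|) with hS
  have S1 : M ≤ S := le_max_left _ _
  have S2 : |d p y0 - d (u * p) y0| ≤ S := (le_max_left _ _).trans (le_max_right _ _)
  have S3 : |d p y0 - d (v * p) y0| ≤ S := (le_max_right _ _).trans (le_max_right _ _)
  have step : ∀ w w', d p y0 + d y0 w + d w w' + d w' y1 + d y1 q ≤ d p q → d w w' ≤ S →
      cone d Y M w w' ≤ E := by
    intro w w' h h'
    rcases le_max_iff.1 h' with h' | h'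
    · have := F.cone_one hM h'; omega
    rcases le_max_iff.1 h' with h' | h'
    · exact F.small_step hM hpu hqu hy0q hy1q h h'
    · exact F.small_step hM hpv hqv hy0q hy1q h h'
  clear_value S
  have long : ∀ w w', d p y0 + d y0 w + d w w' + d w' y1 + d y1 q ≤ d p q →
      (C + 1) * E < cone d Y M w w' → C * (S + 4 * c) + A ≤ d w w' := by
    intro w w' h h'
    by_contra! hlt
    have hk : (((C + 1).toNat : ℕ) : ℤ) = C + 1 := by omega
    have := F.many_steps hM (by omega) step (C + 1).toNat h (by rw [hk]; nlinarith)
    rw [hk] at this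
    omega
  have self0 := F.hm.self y0
  have self1 := F.hm.self y1
  have selfw := F.hm.self w
  have selfz := F.hm.self z
  have L1 := long y0 z (by omega) (by omega)
  have L2 := long w y1 (by omega) (by omega)
  have nzw := F.hm.nn z w
  have dy0u := (F.shift hM hpu hqu hy0q hy1q (w := y0) (by omega)).2.2.2.2.2
  have dy1u := (F.shift hM hpu hqu hy0q hy1q (w := y1) (by omega)).2.2.2.2.2
  have dy0v := (F.shift hM hpv hqv hy0q hy1q (w := y0) (by omega)).2.2.2.2.2
  have dy1v := (F.shift hM hpv hqv hy0q hy1q (w := y1) (by omega)).2.2.2.2.2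
  have bz : Bt d 0 y0 z y1 := by unfold Bt; omega
  have bw : Bt d 0 y0 w y1 := by unfold Bt; omega
  refine ⟨z, by unfold Bt; omega, hz1, fun hu1 => ?_, ?_⟩
  · have hax : Ax d c u z ∧ Ax d c u w := by
      rcases F.line_ax u y0 y1 (S + 4 * c) hu1 (by omega) (by omega) (by omega) with h | ⟨i, -, h⟩
      · exact ⟨h z bz (by omega) (by omega), h w bw (by omega) (by omega)⟩
      · obtain ⟨y, hy, hy'⟩ := h z bz (by omega) (by omega)
        obtain ⟨x, hx, hx'⟩ := h w bw (by omega) (by omega)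
        have := F.near_cone hM (z := z) (z' := w) hy hx (by omega) (by omega)
        omega
    refine ⟨hax.1, fun i hi => ?_⟩
    have a1 := F.ax_near hax.1 hi
    have a2 := F.ax_near hax.2 hi
    have := F.near_cone hM (z := z) (z' := w) (F.pr_gate i z).1 (F.pr_gate i w).1 (by omega) (by omega)
    omega
  · exact F.comm u v y0 y1 z (S + 4 * c) (by omega) (by omega) (by omega) (by omega) (by omega)
      bz (by omega) (by omega)

theorem no_cross {p q u z : G} {A1 D1 h : ℤ} {m : ℕ} (hA1 : 10 * D1 + 200 ≤ A1)
    (hpq : cone d Y M p q = 2 * A1)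
    (hp : cone d Y M p (u * p) ≤ D1) (hq : cone d Y M q (u * q) ≤ D1)
    (h0 : 0 ≤ h) (hm : h ≤ m) (hw : F.Win M m h p q) (hN : (m + 1) * (200 * M) ≤ N0)
    (hz : Bt d 0 p z q) (hz1 : cone d Y M p z = A1) (hax : Ax d c u z) (hfix : ∀ i : ι, u • i ≠ i)
    (i : ι) (j : ℕ) : F.dI i z (u ^ j * z) + 10 * M + 100 * c < N i := by
  have hc := F.c_pos
  have hD1 : 0 ≤ D1 := (cone_nn d Y M _ _).trans hp
  have hNi := F.N_ge i
  have hNb : 200 * M ≤ N0 := by nlinarith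
  by_contra! hlt
  obtain ⟨P0, hP0, r0, hr0, ⟨k, hk⟩, hb, hd1, hd2⟩ := F.crossing hax (hfix i) (j := j) (by omega)
  obtain ⟨P, rfl⟩ : ∃ P, P0 = u ^ k * P := ⟨(u ^ k)⁻¹ * P0, by group⟩
  obtain ⟨r, rfl⟩ : ∃ r, r0 = u ^ k * r := ⟨(u ^ k)⁻¹ * r0, by group⟩
  obtain ⟨i', rfl⟩ : ∃ i', i = u ^ k • i' := ⟨(u ^ k)⁻¹ • i, by simp⟩
  rw [F.Y_smul_iff] at hP0 hr0
  rw [F.N_smul] at hlt hNi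
  rw [pow_succ, mul_assoc (u ^ k), F.hm.inv, F.hm.inv] at hk
  rw [show u * (u ^ k * P) = u ^ k * (u * P) by
    rw [← mul_assoc, ← mul_assoc, (Commute.self_pow u k).eq], F.hm.bt_inv] at hb
  rw [F.hm.inv] at hd1
  have CT := F.cone_tri hM
  have zq := CT p z q
  have e1 := F.hm.tri z P (u * z)
  have buz : Bt d (2 * c) p (u * z) q := by
    have := F.bt_move hM (by omega) ((F.hm.bt_inv u).2 hz) (p' := p) (q' := q) (D1 := D1)
      (by rwa [F.cone_symm hM]) (by rwa [F.cone_symm hM]) (by rw [F.cone_inv hM]; omega)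
      (by rw [F.cone_inv hM]; omega)
    rwa [zero_add] at this
  have cuz := (F.cone_HM hM).disp (F.cone_bt hM hz (by omega)) hp hq
  have czP := F.cone_bt hM (e := 9 * c) (x := z) (y := u * z) (z := P) (by unfold Bt; omega) (by omega)
  unfold Bt at czP
  have nn1 := cone_nn d Y M P (u * z)
  have bP : Bt d (14 * c) p P q := by
    have a1 := F.hm.tri p (u * z) P
    have a2 := F.hm.tri p z P
    have a3 := F.hm.tri P (u * z) q
    have a4 := F.hm.tri P z q
    have a5 := F.hm.symm P z
    have a6 := F.hm.symm P (u * z)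
    have a7 := F.hm.symm z (u * z)
    rcases F.hm.order (e := 2 * c) (by omega) buz hz with h | h <;> unfold Bt <;> omega
  have cP1 := CT p P z
  have cP2 := CT z P q
  have cP3 := F.cone_symm hM P z
  have buP : Bt d (16 * c) p (u * P) q := by
    have := F.bt_move hM (by omega) ((F.hm.bt_inv u).2 bP) (p' := p) (q' := q) (D1 := D1)
      (by rwa [F.cone_symm hM]) (by rwa [F.cone_symm hM]) (by rw [F.cone_inv hM]; omega)
      (by rw [F.cone_inv hM]; omega)
    convert this using 1
    ring
  have gp := F.pr_gate i' p
  have gq := F.pr_gate i' q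
  have key : N i' - 10 * M - 160 * c ≤ F.dI i' p q := by
    have a1 := gp.2 _ hP0
    have a2 := gq.2 _ hP0
    have a3 := gp.2 _ hr0
    have a4 := gq.2 _ hr0
    have a5 := F.hm.tri p (F.pr i' p) q
    have a6 := F.hm.tri (F.pr i' p) (F.pr i' q) q
    change d (F.pr i' p) q ≤ F.dI i' p q + _ at a6
    have a7 := F.hm.symm q (F.pr i' q)
    have a8 := F.hm.tri p r (u * P)
    have a9 := F.hm.tri r (u * P) q
    have b1 := F.hm.tri (u * P) r q
    have b2 := F.hm.tri p (u * P) r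
    have b3 := F.hm.symm (u * P) r
    have b4 := F.hm.symm (u * P) P
    have b5 := F.hm.symm r q
    have b6 := F.hm.symm P q
    have b7 := F.hm.nn (F.pr i' p) P
    have b8 := F.hm.nn (F.pr i' p) r
    have b9 := F.hm.nn (F.pr i' q) P
    have b10 := F.hm.nn (F.pr i' q) r
    unfold Bt at hb
    rcases F.hm.order (e := 16 * c) (e' := 14 * c) (by omega) buP bP with h | h <;> omega
  obtain ⟨w1, w2⟩ := F.win_t hM h0 hm hw 1 i'
  rw [one_mul, one_mul] at w1 w2
  have ht := F.tI_abs i' p q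
  rw [abs_le] at ht
  rcases abs_cases (F.tI i' p q) with ⟨e, -⟩ | ⟨e, -⟩ <;> rw [e] at ht <;> nlinarith

include hπ

theorem lift_elem {p q : G} {g : Q} {D1 h : ℤ} {m : ℕ} (h0 : 0 ≤ h) (hm : h ≤ m)
    (hw : F.Win M m h p q) (hN : (m + 1) * (200 * M) ≤ N0)
    (hp : quoD π d Y M (π p) (g * π p) ≤ D1) (hq : quoD π d Y M (π q) (g * π q) ≤ D1) :
    ∃ u, π u = g ∧ cone d Y M p (u * p) ≤ D1 ∧ cone d Y M q (u * q) ≤ D1 := by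
  obtain ⟨y0, h1, h2⟩ := F.exists_lift hM hπ p (g * π p)
  obtain ⟨y1, h3, h4⟩ := F.exists_lift hM hπ q (g * π q)
  have hu0 : π (y0 * p⁻¹) = g := by simp [h1]
  obtain ⟨k, hk, rfl⟩ := hπ.eq_iff.1 (show π (y0 * p⁻¹ * q) = π y1 by rw [h3, map_mul, hu0])
  obtain ⟨u, k1, w1, hk1, hw1, hu, c1, c2⟩ := F.close_up hM h0 hm hw hN
    (F.good (y0 * p⁻¹ * q) k hk) (y0 * p⁻¹) 1 (D1 := D1) (by simp)
    (by rw [one_mul, mul_one, inv_mul_cancel_right, h2]; exact hp)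
    (by rw [one_mul, mul_one, mul_assoc k, h4]; exact hq) (Subgroup.one_mem _)
  refine ⟨u, ?_, c1, c2⟩
  rw [hu]
  simp only [map_mul, map_inv, (hπ.ker _).2 hk1, (hπ.ker _).2 hw1, hu0]
  simp

theorem quo_thin {D A1 : ℤ} (hD : 0 ≤ D)
    (hA1 : (C + 1) * (3 * (3 * D + 20) + 32) + 10 * (3 * D + 20) + 200 ≤ A1)
    (hMA : 4 * c * C + A ≤ M) (hN : (2 * A1 + 1) * (200 * M) ≤ N0) (hn : 0 < n) :
    Thin (quoD π d Y M) n D A1 := by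
  have hc := F.c_pos
  have hC := F.C_nn
  have hCE : 0 ≤ (C + 1) * (3 * (3 * D + 20) + 32) := mul_nonneg (by omega) (by omega)
  obtain ⟨m, hm⟩ : ∃ m : ℕ, (m : ℤ) = 2 * A1 := ⟨(2 * A1).toNat, by omega⟩
  have hNb : 200 * M ≤ N0 := by nlinarith
  have HQ := F.quo_HM hM hπ (by omega)
  have main : ∀ u v p q z, quoD π d Y M p (u * p) ≤ D → quoD π d Y M q (u * q) ≤ D →
      quoD π d Y M p (v * p) ≤ D → quoD π d Y M q (v * q) ≤ D →
      Bt (quoD π d Y M) 0 p z q → A1 ≤ quoD π d Y M p z → A1 ≤ quoD π d Y M z q →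
      u * v = v * u ∧ (u ≠ 1 → u ^ n ≠ 1 ∧ ∀ j k : ℕ, quoD π d Y M z (u ^ j * z) +
        quoD π d Y M z (u ^ k * z) ≤ quoD π d Y M z (u ^ (j + k) * z) + 200) := by
    intro gu gv p0 q0 z0 pu qu pv qv hz hpz hzq
    obtain ⟨p1, hp1, hp1'⟩ := HQ.geo z0 p0 A1 (by omega) (by rw [HQ.symm]; exact hpz)
    obtain ⟨q1, hq1, hq1'⟩ := HQ.geo z0 q0 A1 (by omega) hzq
    have s1 := HQ.symm z0 p0
    have s2 := HQ.symm p1 p0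
    have s3 := HQ.symm z0 p1
    have t1 := HQ.tri p0 p1 q0
    have t2 := HQ.tri p0 q1 q0
    have t3 := HQ.tri p0 p1 q1
    have t4 := HQ.tri p1 q1 q0
    have t5 := HQ.tri p1 z0 q0
    have t6 := HQ.tri p0 z0 q1
    have t7 := HQ.tri p1 z0 q1
    have bz : Bt (quoD π d Y M) 0 p1 z0 q1 := by unfold Bt at *; omega
    have bp1 : Bt (quoD π d Y M) 0 p0 p1 q0 := by unfold Bt at *; omega
    have bq1 : Bt (quoD π d Y M) 0 p0 q1 q0 := by unfold Bt at *; omega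
    have d1 := HQ.disp bp1 pu qu
    have d2 := HQ.disp bq1 pu qu
    have d3 := HQ.disp bp1 pv qv
    have d4 := HQ.disp bq1 pv qv
    rw [zero_add] at d1 d2 d3 d4
    obtain ⟨p, rfl⟩ := hπ.surj p1
    obtain ⟨q', hq', hq2⟩ := F.exists_lift hM hπ p q1
    subst hq'
    have hpq : quoD π d Y M (π p) (π q') = m := by unfold Bt at *; omega
    obtain ⟨q, h, e1, e2, h0, hhm, hw⟩ := F.exists_win hM hπ (by omega) hpq
    rw [← e1] at hpq d2 d4 bz hq1
    have hN' : ((m : ℤ) + 1) * (200 * M) ≤ N0 := by rw [hm]; exact hN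
    obtain ⟨u, rfl, cu1, cu2⟩ := F.lift_elem hM hπ h0 hhm hw hN' d1 d2
    obtain ⟨v, rfl, cv1, cv2⟩ := F.lift_elem hM hπ h0 hhm hw hN' d3 d4
    obtain ⟨z, b1, b2, b3, b4⟩ := F.thin_core hM (D1 := 3 * D + 20) (A1 := A1) (by omega) hMA (by omega) cu1 cu2 cv1 cv2
    refine ⟨by rw [← map_mul, b4, map_mul], fun hu => ?_⟩
    obtain ⟨b5, b6⟩ := b3 (by rintro rfl; simp at hu)
    have hl := F.no_cross hM (by omega) (by omega) cu1 cu2 h0 hhm hw hN' b1 b2 b5 b6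
    have hqa := F.quo_axis hM hπ hl
    have hsup : ∀ j k : ℕ, quoD π d Y M (π z) (π u ^ j * π z) +
        quoD π d Y M (π z) (π u ^ k * π z) ≤ quoD π d Y M (π z) (π u ^ (j + k) * π z) + 6 := by
      intro j k
      rw [hqa, hqa, hqa]
      exact F.cone_sup hM b5 j k
    constructor
    · intro hpow
      have := low_of_orbit HQ hsup (k0 := (200 * M).toNat)
        (by rw [hqa]; exact F.cone_low hM b5 b6) 1 n
      rw [hpow, mul_one, HQ.self] at this
      omega
    · have f1 := F.quo_le hM hπ p z
      have f2 := F.quo_le hM hπ z q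
      have f3 := F.cone_bt hM b1 (by omega)
      have f4 := HQ.tri (π p) (π z) (π q)
      have f5 : Bt (quoD π d Y M) 6 (π p) (π z) (π q) := by unfold Bt at *; omega
      have f6 := HQ.close (k := 6) bz f5 (by unfold Bt at *; rw [abs_le]; omega)
      have f7 : max (0 : ℤ) 6 = 6 := rfl
      intro j k
      have hj : ∀ j : ℕ, |quoD π d Y M z0 (π u ^ j * z0) - quoD π d Y M (π z) (π u ^ j * π z)|
          ≤ 64 := by
        intro j
        have g1 := HQ.tri z0 (π z) (π u ^ j * z0)
        have g2 := HQ.tri (π z) (π u ^ j * π z) (π u ^ j * z0)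
        have g3 := HQ.inv (π u ^ j) (π z) z0
        have g4 := HQ.tri (π z) z0 (π u ^ j * π z)
        have g5 := HQ.tri z0 (π u ^ j * z0) (π u ^ j * π z)
        have g6 := HQ.inv (π u ^ j) z0 (π z)
        have g7 := HQ.symm z0 (π z)
        rw [abs_le]
        omega
      have g1 := hj j
      have g2 := hj k
      have g3 := hj (j + k)
      have g4 := hsup j k
      rw [abs_le] at g1 g2 g3
      omega
  exact ⟨fun u p q z hu a b e f g => ((main u u p q z a b a b e f g).2 hu).1,
    fun u p q z hu a b e f g => ((main u u p q z a b a b e f g).2 hu).2,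
    fun u v p q z a b a' b' e f g => (main u v p q z a b a' b' e f g).1⟩

end FamX
end PG

namespace PG

/-- `z` is nearly between `p` and `q` and at distance at least `m` from both. -/
structure Mid {G : Type} (d : G → G → ℤ) (e m : ℤ) (p z q : G) : Prop where
  bt : Bt d e p z q
  left : m ≤ d p z
  right : m ≤ d z q

/-- The displacement of `u` at both points is at most `D`. -/
structure Disp {G : Type} [Group G] (d : G → G → ℤ) (D : ℤ) (u p q : G) : Prop where
  left : d p (u * p) ≤ D
  right : d q (u * q) ≤ D

theorem Mid.mono {G : Type} {d : G → G → ℤ} {e e' m m' : ℤ} {p z q : G} (h : Mid d e m p z q)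
    (he : e ≤ e') (hm : m' ≤ m) : Mid d e' m' p z q :=
  ⟨by have := h.bt; unfold Bt at *; omega, hm.trans h.left, hm.trans h.right⟩

namespace HM
variable {G : Type} [Group G] {d : G → G → ℤ} {δ : ℤ} (hm : HM d δ)
include hm

theorem local_global {u z : G} {e : ℤ} (h2 : 2 * d z (u * z) ≤ d z (u ^ 2 * z) + e)
    (ha : e + 2 * δ < d z (u * z)) : Ax d (e + 2 * δ) u z := by
  have hδ := hm.δnn
  have key : ∀ k i j : ℕ, j = i + k → d (u ^ i * z) (u ^ j * z) = d z (u ^ k * z) := by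
    rintro k i _ rfl
    rw [pow_add, mul_assoc, hm.inv]
  have e0 : 0 ≤ e := by
    have := hm.tri z (u * z) (u ^ 2 * z)
    have h3 := key 1 1 2 rfl
    rw [pow_one] at h3
    omega
  have hz : d z (u ^ 0 * z) = 0 := by simp [hm.self]
  have grow : ∀ k : ℕ, d z (u ^ k * z) + d z (u * z) ≤ d z (u ^ (k + 1) * z) + e + δ := by
    intro k
    induction k with
    | zero => rw [hz, zero_add, pow_one]; omega
    | succ k ih =>
      have h := hm.hyp z (u ^ k * z) (u ^ (k + 1) * z) (u ^ (k + 1 + 1) * z)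
      rw [key 2 k (k + 1 + 1) (by omega), key 1 (k + 1) (k + 1 + 1) (by omega),
        key 1 k (k + 1) (by omega), pow_one] at h
      have := hm.nn z (u ^ k * z)
      rcases max_cases (d z (u ^ k * z) + d z (u * z))
        (d z (u ^ (k + 1 + 1) * z) + d z (u * z)) with h' | h' <;> omega
  refine ⟨fun j k => ?_, fun j => ?_⟩
  · cases k with
    | zero => simp only [hz, add_zero]; omega
    | succ k =>
      have h := hm.hyp z (u ^ j * z) (u ^ (j + 1) * z) (u ^ (j + (k + 1)) * z)
      rw [key (k + 1) j _ rfl, key k (j + 1) (j + (k + 1)) (by omega), key 1 j (j + 1) rfl,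
        pow_one] at h
      have g1 := grow j
      have g2 := grow k
      rcases max_cases (d z (u ^ j * z) + d z (u ^ k * z))
        (d z (u ^ (j + (k + 1)) * z) + d z (u * z)) with h' | h' <;> omega
  · induction j with
    | zero => rw [hz]; rfl
    | succ j ih =>
      have h := grow j
      rw [Nat.cast_succ]
      linarith

theorem disp_inv (u x : G) : d x (u⁻¹ * x) = d x (u * x) := by
  rw [← hm.inv u, mul_inv_cancel_left, hm.symm]

theorem Disp_inv {D : ℤ} {u p q : G} (h : Disp d D u p q) : Disp d D u⁻¹ p q :=
  ⟨by rw [hm.disp_inv]; exact h.1, by rw [hm.disp_inv]; exact h.2⟩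

theorem Disp_mul {D D' : ℤ} {u v p q : G} (h : Disp d D u p q) (h' : Disp d D' v p q) :
    Disp d (D + D') (u * v) p q := by
  have h1 := h.1
  have h2 := h.2
  have h3 := h'.1
  have h4 := h'.2
  constructor
  · have := hm.tri p (u * p) (u * v * p)
    rw [mul_assoc, hm.inv, ← mul_assoc] at this
    omega
  · have := hm.tri q (u * q) (u * v * q)
    rw [mul_assoc, hm.inv, ← mul_assoc] at this
    omega

theorem mid_move {e m D : ℤ} {u p q z : G} (hu : Disp d D u p q) (hz : Mid d e m p z q)
    (hD : D + e + 2 * δ < m) : Mid d (e + 2 * δ) (m - D) p (u * z) q := by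
  have hδ := hm.δnn
  have h0 := (hm.bt_inv u).2 hz.bt
  have h1 := hz.left
  have h2 := hz.right
  have h3 := hu.left
  have h4 := hu.right
  have a1 := hm.inv u p z
  have a2 := hm.inv u z q
  have a3 := hm.symm p (u * p)
  have a4 := hm.symm q (u * q)
  have a5 := hm.tri (u * p) p (u * z)
  have a6 := hm.tri (u * z) q (u * q)
  refine ⟨?_, by omega, by omega⟩
  have n1 := hm.nn (u * z) p
  have n2 := hm.nn q (u * z)
  rcases hm.split h0 p with h | h
  · unfold Bt at h; omega
  rcases hm.split h q with h | h
  · unfold Bt at *; omega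
  · unfold Bt at h; omega

theorem mid_close {e m : ℤ} {p q z z' : G} (hz : Mid d e m p z q) (hz' : Mid d e m p z' q) :
    d z z' ≤ |d p z - d p z'| + e + δ := by
  have := hm.close hz.bt hz'.bt le_rfl
  rw [max_self] at this
  omega

/-- The difference of distances to a far away point is insensitive to moving this point. -/
theorem busemann {a a' x y : G} (h : d a a' + d x y + δ < d a y + d a' x) :
    d a y - d a x ≤ d a' y - d a' x + δ := by
  have := hm.hyp a a' y x
  have := hm.symm x y
  rcases max_cases (d a a' + d y x) (d a x + d a' y) with h' | h' <;> omega

theorem shift_const {e m D : ℤ} {u p q z z' : G} (hu : Disp d D u p q) (hz : Mid d e m p z q)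
    (hz' : Mid d e m p z' q) (hD : D + e + 2 * δ < m) :
    |(d p (u * z) - d p z) - (d p (u * z') - d p z')| ≤ δ := by
  have hδ := hm.δnn
  have h1 := hz.left
  have h2 := hz'.left
  have h3 := hu.left
  have h4 := hm.mid_close hz hz'
  have e0 : 0 ≤ e := by
    have := hz.bt
    have := hm.tri p z q
    unfold Bt at *; omega
  have a1 := hm.inv u p z
  have a2 := hm.inv u p z'
  have a3 := hm.tri (u * p) p (u * z)
  have a4 := hm.tri (u * p) p (u * z')
  have a5 := hm.symm p (u * p)
  have a6 := hm.inv u z z'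
  have a7 := hm.inv u z' z
  have a8 := hm.symm z z'
  have b1 := hm.busemann (a := p) (a' := u * p) (x := u * z) (y := u * z')
    (by rcases abs_cases (d p z - d p z') with ⟨k, k'⟩ | ⟨k, k'⟩ <;> omega)
  have b2 := hm.busemann (a := p) (a' := u * p) (x := u * z') (y := u * z)
    (by rcases abs_cases (d p z - d p z') with ⟨k, k'⟩ | ⟨k, k'⟩ <;> omega)
  rw [abs_le]
  omega

theorem shift_le (u p z : G) : |d p (u * z) - d p z| ≤ d z (u * z) := by
  have := hm.tri p z (u * z)
  have := hm.tri p (u * z) z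
  have := hm.symm z (u * z)
  rw [abs_le]; omega

theorem disp_le {e m D : ℤ} {u p q z : G} (hu : Disp d D u p q) (hz : Mid d e m p z q)
    (hD : D + e + 2 * δ < m) : d z (u * z) ≤ |d p (u * z) - d p z| + e + 3 * δ := by
  have hδ := hm.δnn
  have h0 := hz.left
  have h1 := hm.nn p (u * p)
  have h2 := hu.left
  have := hm.mid_close (hz.mono (e' := e + 2 * δ) (m' := m - D) (by omega) (by omega))
    (hm.mid_move hu hz hD)
  rw [abs_sub_comm] at this
  omega

/-- Products of two elements and their shifts. -/
theorem shift_mul {e m D : ℤ} {u v p q z : G} (hu : Disp d D u p q) (hv : Disp d D v p q)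
    (hz : Mid d e m p z q) (hD : 2 * D + e + 4 * δ < m) :
    |(d p (u * v * z) - d p z) - ((d p (u * z) - d p z) + (d p (v * z) - d p z))| ≤ δ := by
  have hδ := hm.δnn
  have h1 := (hm.nn p (u * p)).trans hu.left
  have h2 := hm.mid_move hv hz (by omega)
  have h3 := hm.shift_const hu h2 (hz.mono (by omega) (by omega)) (by omega)
  rw [← mul_assoc] at h3
  rw [abs_le] at *
  omega

theorem comm_close {e m D : ℤ} {u v p q z : G} (hu : Disp d D u p q) (hv : Disp d D v p q)
    (hz : Mid d e m p z q) (hD : 2 * D + e + 4 * δ < m) :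
    d (u * v * z) (v * u * z) ≤ e + 7 * δ := by
  have hδ := hm.δnn
  have h1 := (hm.nn p (u * p)).trans hu.left
  have s1 := hm.shift_mul hu hv hz hD
  have s2 := hm.shift_mul hv hu hz hD
  have a1 := hm.mid_move hu (hm.mid_move hv hz (by omega)) (by omega)
  have a2 := hm.mid_move hv (hm.mid_move hu hz (by omega)) (by omega)
  rw [← mul_assoc] at a1 a2
  have a3 := hm.mid_close a1 a2
  rw [abs_le] at s1 s2
  rcases abs_cases (d p (u * v * z) - d p (v * u * z)) with ⟨k, k'⟩ | ⟨k, k'⟩ <;> omega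

theorem ax_of_long {m D : ℤ} {u p q z : G} (hu : Disp d D u p q)
    (hz : Mid d 0 m p z q) (hD : 2 * D + 4 * δ < m) (ha : 9 * δ < d z (u * z)) :
    Ax d (9 * δ) u z := by
  have hδ := hm.δnn
  have h1 := (hm.nn p (u * p)).trans hu.left
  have s1 := hm.shift_mul hu hu hz (by omega)
  have s2 := hm.disp_le hu hz (by omega)
  have s3 := hm.shift_le (u * u) p z
  have := hm.local_global (u := u) (z := z) (e := 7 * δ) (by
    rw [pow_two]
    rw [abs_le] at s1 s3
    rcases abs_cases (d p (u * z) - d p z) with ⟨k, k'⟩ | ⟨k, k'⟩ <;> omega) (by omega)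
  convert this using 1
  ring

theorem disp_const {e m D : ℤ} {u p q z z' : G} (hu : Disp d D u p q) (hz : Mid d e m p z q)
    (hz' : Mid d e m p z' q) (hD : D + e + 2 * δ < m) :
    d z (u * z) ≤ d z' (u * z') + e + 4 * δ := by
  have h1 := hm.disp_le hu hz hD
  have h2 := hm.shift_le u p z'
  have h3 := hm.shift_const hu hz hz' hD
  rw [abs_le] at h2 h3
  rcases abs_cases (d p (u * z) - d p z) with ⟨k, k'⟩ | ⟨k, k'⟩ <;> omega

theorem mid_exact {e m : ℤ} {p q z : G} (hz : Mid d e m p z q) :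
    ∃ z', Mid d 0 (m - 2 * e - δ) p z' q ∧ d z z' ≤ 2 * e + δ := by
  obtain ⟨z', h1, h2⟩ := hm.exact_near hz.bt
  have := hz.left
  have := hz.right
  have := hm.tri p z' z
  have := hm.tri z z' q
  have := hm.symm z z'
  exact ⟨z', ⟨h1, by omega, by omega⟩, h2⟩

/-- Changing the end points of a geodesic. -/
theorem mid_base {e m B : ℤ} {p q p' q' z : G} (hz : Mid d e m p z q) (hp : d p p' ≤ B)
    (hq : d q q' ≤ B) (hB : B + e + 2 * δ < m) : Mid d (e + 2 * δ) (m - B) p' z q' := by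
  have hδ := hm.δnn
  have h1 := hz.left
  have h2 := hz.right
  have a3 := hm.symm p' p
  have a4 := hm.symm q' q
  have a5 := hm.tri p p' z
  have a6 := hm.tri z q' q
  have n1 := hm.nn z p'
  have n2 := hm.nn q' z
  refine ⟨?_, by omega, by omega⟩
  rcases hm.split hz.bt p' with h | h
  · unfold Bt at h; omega
  rcases hm.split h q' with h | h
  · unfold Bt at *; omega
  · unfold Bt at h; omega

/-- Shrinking a long segment around a midpoint. -/
theorem mid_cut {m : ℤ} {p q z : G} (hz : Mid d 0 m p z q) {k : ℤ} (h0 : 0 ≤ k) (hk : k ≤ m) :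
    ∃ p' q', Mid d 0 (m - k) p p' q ∧ Mid d 0 (m - k) p q' q ∧ Mid d 0 k p' z q' := by
  have h1 := hz.left
  have h2 := hz.right
  have h3 := hz.bt
  obtain ⟨p', hp, hp'⟩ := hm.geo z p k h0 (by rw [hm.symm]; omega)
  obtain ⟨q', hq, hq'⟩ := hm.geo z q k h0 (by omega)
  have a1 := hm.symm p' p
  have a2 := hm.symm z p
  have a3 := hm.symm z p'
  have a4 := hm.tri p p' q
  have a5 := hm.tri p p' q'
  have a6 := hm.tri p' z q
  have a7 := hm.tri p z q'
  have a8 := hm.tri p' z q'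
  have a9 := hm.tri p' q' q
  have b1 := hm.tri p q' q
  have b2 := hm.tri z q' q
  unfold Bt at h3
  refine ⟨p', q', ⟨?_, ?_, ?_⟩, ⟨?_, ?_, ?_⟩, ⟨?_, ?_, ?_⟩⟩ <;> (try unfold Bt) <;> omega

end HM
end PG

namespace PG

/-- The points whose orbit under the powers of `e` is a quasi-geodesic. -/
def axis {G : Type} [Group G] (d : G → G → ℤ) (e : G) : Set G :=
  {z | ∀ j k : ℕ, d z (e ^ j * z) + d z (e ^ k * z) ≤ d z (e ^ (j + k) * z) + 200}

/-- A conjugation invariant set of elements whose axes are long and have short overlaps. -/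
structure Lines {G : Type} [Group G] (d : G → G → ℤ) (n : ℕ) (I : Set G) (ν : G → ℕ)
    (N0 c0 : ℤ) : Prop where
  hm : HM d 20
  conj : ∀ g e, e ∈ I → g * e * g⁻¹ ∈ I
  ν_conj : ∀ g, ∀ e ∈ I, ν (g * e * g⁻¹) = ν e
  ν_dvd : ∀ e ∈ I, ν e ∣ n
  pow_ne : ∀ e ∈ I, e ^ ν e ≠ 1
  far : ∀ e ∈ I, ∃ T : ℤ, ∀ x (j : ℕ), (j : ℤ) ≤ T * d x (e ^ j * x)
  abel : ∀ e ∈ I, ∀ g h, g * e = e * g → h * e = e * h → g * h = h * g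
  ne : ∀ e ∈ I, (axis d e).Nonempty
  mid : ∀ e ∈ I, ∀ p ∈ axis d e, ∃ A, ∀ (K : ℕ) z,
    Mid d 0 A ((e ^ K)⁻¹ * p) z (e ^ K * p) → z ∈ axis d e
  spin : ∀ e ∈ I, ∀ g, g * e = e * g → g ^ ν e ≠ 1 → ∀ y ∈ axis d e, N0 ≤ d y (g ^ ν e * y)
  ov : ∀ e ∈ I, ∀ f ∈ I, e ≠ f → ∀ p ∈ axis d e, ∀ q ∈ axis d e, ∀ p' ∈ axis d f,
    ∀ q' ∈ axis d f, d p p' ≤ 4500 → d q q' ≤ 4500 → d p q ≤ c0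

/-- The action by conjugation on an invariant set. -/
abbrev conjAct {G : Type} [Group G] {I : Set G} (h : ∀ g e, e ∈ I → g * e * g⁻¹ ∈ I) :
    MulAction G I where
  smul g e := ⟨g * e.1 * g⁻¹, h g e.1 e.2⟩
  one_smul e := Subtype.ext (show 1 * e.1 * 1⁻¹ = e.1 by simp)
  mul_smul g g' e := Subtype.ext (show g * g' * e.1 * (g * g')⁻¹ = g * (g' * e.1 * g'⁻¹) * g⁻¹ by
    group)

/-- The group generated by the powers of elements of the centralizer. -/
def rotG {G : Type} [Group G] (ν : G → ℕ) (e : G) : Subgroup G :=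
  Subgroup.closure {x | ∃ g, g * e = e * g ∧ g ^ ν e = x}

/-- The minimal displacement of nontrivial elements of `rotG ν e` on the axis. -/
noncomputable def lenR {G : Type} [Group G] (d : G → G → ℤ) (ν : G → ℕ) (e : G) : ℤ :=
  sInf {m | ∃ r ∈ rotG ν e, r ≠ 1 ∧ ∃ y ∈ axis d e, m = d y (r * y)}

theorem exists_ultralimit (f : ℕ → ℤ) (B : ℤ) (hf : ∀ K, |f K| ≤ B) :
    ∃ v, ∀ᶠ K in (Filter.hyperfilter ℕ : Filter ℕ), f K = v := by
  obtain ⟨v, -, hv⟩ := Ultrafilter.eq_pure_of_finite_mem (f := (Filter.hyperfilter ℕ).map f)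
    (Set.finite_Icc (-B) B)
    (show f ⁻¹' Set.Icc (-B) B ∈ Filter.hyperfilter ℕ from
      Filter.univ_mem' fun K => abs_le.1 (hf K))
  refine ⟨v, ?_⟩
  have : ({v} : Set ℤ) ∈ (Filter.hyperfilter ℕ).map f := by rw [hv]; exact rfl
  exact this

open Classical in
/-- The Busemann cocycle of the repelling end point of `e`. -/
noncomputable def bus {G : Type} [Group G] (d : G → G → ℤ) (e y y' : G) : ℤ :=
  if h : ∃ v, ∀ᶠ K in (Filter.hyperfilter ℕ : Filter ℕ),
    d (e ^ K)⁻¹ y' - d (e ^ K)⁻¹ y = v then h.choose else 0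

theorem HM.nearest {G : Type} [Group G] {d : G → G → ℤ} {δ : ℤ} (hm : HM d δ) {Y : Set G}
    (hY : Y.Nonempty) (x : G) : ∃ p ∈ Y, ∀ y ∈ Y, d x p ≤ d x y := by
  refine ⟨_, Function.argminOn_mem (fun y => (d x y).toNat) Y hY, fun y hy => ?_⟩
  have := Function.argminOn_le (fun y => (d x y).toNat) Y hy
  have := hm.nn x y
  omega

theorem HM.bus_spec {G : Type} [Group G] {d : G → G → ℤ} {δ : ℤ} (hm : HM d δ) (e y y' : G) :
    ∀ᶠ K in (Filter.hyperfilter ℕ : Filter ℕ), d (e ^ K)⁻¹ y' - d (e ^ K)⁻¹ y = bus d e y y' := by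
  have h : ∃ v, ∀ᶠ K in (Filter.hyperfilter ℕ : Filter ℕ), d (e ^ K)⁻¹ y' - d (e ^ K)⁻¹ y = v :=
    exists_ultralimit _ (d y y') fun K => by
      have := hm.tri (e ^ K)⁻¹ y y'
      have := hm.tri (e ^ K)⁻¹ y' y
      have := hm.symm y y'
      rw [abs_le]; omega
  rw [bus, dif_pos h]
  exact h.choose_spec

theorem HM.bus_add {G : Type} [Group G] {d : G → G → ℤ} {δ : ℤ} (hm : HM d δ) (e y y' y'' : G) :
    bus d e y y' + bus d e y' y'' = bus d e y y'' := by
  obtain ⟨K, h1, h2, h3⟩ := ((hm.bus_spec e y y').and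
    ((hm.bus_spec e y' y'').and (hm.bus_spec e y y''))).exists
  omega

theorem eventually_hyper {P : ℕ → Prop} (h : ∃ K0, ∀ K, K0 ≤ K → P K) :
    ∀ᶠ K in (Filter.hyperfilter ℕ : Filter ℕ), P K := by
  have : ∀ᶠ K in Filter.atTop, P K := Filter.eventually_atTop.2 h
  exact Nat.hyperfilter_le_atTop this

theorem HM.bt_axis {G : Type} [Group G] {d : G → G → ℤ} {δ : ℤ} (hm : HM d δ) {e y : G}
    (hy : y ∈ axis d e) (K : ℕ) : Bt d 200 ((e ^ K)⁻¹ * y) y (e ^ K * y) := by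
  have h := hy K K
  have h1 := hm.inv (e ^ K)⁻¹ y (e ^ K * y)
  have h2 := hm.inv (e ^ K) ((e ^ K)⁻¹ * y) (e ^ K * y)
  rw [inv_mul_cancel_left] at h1
  rw [mul_inv_cancel_left, ← mul_assoc, ← pow_add] at h2
  have := hm.symm y ((e ^ K)⁻¹ * y)
  unfold Bt
  omega

theorem HM.axis_smul {G : Type} [Group G] {d : G → G → ℤ} {δ : ℤ} (hm : HM d δ) {e y : G} (g : G)
    (hy : y ∈ axis d e) : g * y ∈ axis d (g * e * g⁻¹) := by
  intro j k
  have key : ∀ j : ℕ, d (g * y) ((g * e * g⁻¹) ^ j * (g * y)) = d y (e ^ j * y) := fun j => by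
    rw [conj_pow, mul_assoc, inv_mul_cancel_left, mul_assoc, hm.inv]
  rw [key, key, key]
  exact hy j k

namespace Lines
variable {G : Type} [Group G] {d : G → G → ℤ} {n : ℕ} {I : Set G} {ν : G → ℕ} {N0 c0 : ℤ}
  (L : Lines d n I ν N0 c0)
include L

theorem far' {e : G} (he : e ∈ I) (B : ℤ) : ∃ K0 : ℕ, ∀ K, K0 ≤ K → ∀ x, B ≤ d x (e ^ K * x) := by
  obtain ⟨T, hT⟩ := L.far e he
  refine ⟨(|T| * B).toNat + 1, fun K hK x => ?_⟩
  by_contra! hlt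
  have h1 := hT x K
  have h2 := L.hm.nn x (e ^ K * x)
  have h3 : T * d x (e ^ K * x) ≤ |T| * B :=
    (mul_le_mul_of_nonneg_right (le_abs_self T) h2).trans
      (mul_le_mul_of_nonneg_left hlt.le (abs_nonneg T))
  omega

theorem eventually_mid {e y : G} (he : e ∈ I) (hy : y ∈ axis d e) (x : G) (m : ℤ) :
    ∃ K0 : ℕ, ∀ K, K0 ≤ K → Mid d 240 m ((e ^ K)⁻¹ * x) y (e ^ K * x) := by
  obtain ⟨K0, hK⟩ := L.far' he (|m| + d y x + 300)
  refine ⟨K0, fun K hK' => ?_⟩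
  have h0 := L.hm.nn y x
  have h1 := hK K hK' y
  have h2 := L.hm.inv (e ^ K)⁻¹ y (e ^ K * y)
  rw [inv_mul_cancel_left] at h2
  have h3 : Mid d 200 (|m| + d y x + 300) ((e ^ K)⁻¹ * y) y (e ^ K * y) :=
    ⟨L.hm.bt_axis hy K, by omega, h1⟩
  have h4 := le_abs_self m
  have h5 := abs_nonneg m
  exact (L.hm.mid_base h3 (B := d y x) (p' := (e ^ K)⁻¹ * x) (q' := e ^ K * x)
    (by rw [L.hm.inv]) (by rw [L.hm.inv]) (by omega)).mono (by omega) (by omega)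

theorem eventually_mid' {e y : G} (he : e ∈ I) (hy : y ∈ axis d e) (x : G) (m : ℤ) :
    ∀ᶠ K in (Filter.hyperfilter ℕ : Filter ℕ), Mid d 240 m ((e ^ K)⁻¹ * x) y (e ^ K * x) :=
  eventually_hyper (L.eventually_mid he hy x m)

theorem quasiconvex {e p m y : G} (he : e ∈ I) (hp : p ∈ axis d e) (hy : y ∈ axis d e)
    (hm : Bt d 0 p m y) : ∃ z ∈ axis d e, d m z ≤ 1040 := by
  obtain ⟨A, hA⟩ := L.mid e he p hp
  obtain ⟨K, h1, h2⟩ := ((L.eventually_mid' he hp p (|A| + d p y + 2000)).and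
    (L.eventually_mid' he hy p (|A| + d p y + 2000))).exists
  have h3 := L.hm.mid_close h1 h2
  have b1 := h1.bt
  have b2 := h2.bt
  have l1 := h1.left
  have r1 := h1.right
  set a := (e ^ K)⁻¹ * p
  set b := e ^ K * p
  have t1 := L.hm.tri a p m
  have t2 := L.hm.tri a y m
  have t3 := L.hm.tri m p b
  have t4 := L.hm.tri m y b
  have s1 := L.hm.symm p m
  have s2 := L.hm.symm m y
  have n1 := L.hm.nn p m
  have n2 := L.hm.nn y m
  have t5 := L.hm.tri a m p
  have t6 := L.hm.tri p m b
  have h4 : Mid d 500 (|A| + 2000) a m b := by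
    unfold Bt at *
    refine ⟨?_, by omega, by omega⟩
    unfold Bt
    rcases abs_cases (d a p - d a y) with ⟨k, k'⟩ | ⟨k, k'⟩ <;> omega
  obtain ⟨z, hz, hz'⟩ := L.hm.mid_exact h4
  exact ⟨z, hA K z (hz.mono le_rfl (by have := le_abs_self A; omega)), by omega⟩

theorem gate {e : G} (he : e ∈ I) (x : G) : ∃ p, Gate d 2200 (axis d e) x p := by
  obtain ⟨p, hp, hmin⟩ := L.hm.nearest (L.ne e he) x
  refine ⟨p, hp, fun y hy => ?_⟩
  obtain ⟨m, h1, h2, h3⟩ := L.hm.center p y x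
  obtain ⟨z, hz, hz'⟩ := L.quasiconvex he hp hy h1
  have a1 := hmin z hz
  have a2 := L.hm.tri x m z
  have a3 := L.hm.symm p m
  have a4 := L.hm.symm x m
  have a5 := L.hm.symm x p
  have a6 := L.hm.symm x y
  have a7 := L.hm.symm y m
  have a8 := L.hm.tri p m y
  unfold Bt at *
  omega

end Lines
end PG

namespace PG

theorem HM.mono {G : Type} [Group G] {d : G → G → ℤ} {δ δ' : ℤ} (hm : HM d δ) (h : δ ≤ δ') :
    HM d δ' :=
  { hm with hyp := fun x y z w => (hm.hyp x y z w).trans (by omega) }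

theorem Ax.mono {G : Type} [Group G] {d : G → G → ℤ} {u z : G} {c c' : ℤ} (hu : Ax d c u z)
    (h : c ≤ c') : Ax d c' u z :=
  ⟨fun j k => (hu.sup j k).trans (by omega), hu.low⟩

namespace Lines
variable {G : Type} [Group G] {d : G → G → ℤ} {n : ℕ} {I : Set G} {ν : G → ℕ} {N0 c0 : ℤ}
  (L : Lines d n I ν N0 c0)
include L

theorem mem_rotG {e : G} (he : e ∈ I) {x : G} :
    x ∈ rotG ν e ↔ ∃ g, g * e = e * g ∧ g ^ ν e = x := by
  refine ⟨fun hx => ?_, fun hx => Subgroup.subset_closure hx⟩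
  induction hx using Subgroup.closure_induction with
  | mem x hx => exact hx
  | one => exact ⟨1, by simp, by simp⟩
  | mul x y _ _ hx hy =>
    obtain ⟨g, hg, rfl⟩ := hx
    obtain ⟨h, hh, rfl⟩ := hy
    have : Commute g h := L.abel e he g h hg hh
    refine ⟨g * h, ?_, this.mul_pow _⟩
    rw [mul_assoc, hh, ← mul_assoc, hg, mul_assoc]
  | inv x _ hx =>
    obtain ⟨g, hg, rfl⟩ := hx
    refine ⟨g⁻¹, ?_, inv_pow _ _⟩
    have : Commute g e := hg
    exact this.inv_left

theorem rotG_comm {e r : G} (he : e ∈ I) (hr : r ∈ rotG ν e) : r * e = e * r := by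
  obtain ⟨g, hg, rfl⟩ := (L.mem_rotG he).1 hr
  have : Commute g e := hg
  exact this.pow_left _

theorem axis_comm {e g y : G} (hg : g * e = e * g) (hy : y ∈ axis d e) : g * y ∈ axis d e := by
  have := L.hm.axis_smul g hy
  rwa [hg, mul_inv_cancel_right] at this

theorem bus_abs {e y y' : G} (he : e ∈ I) (hy : y ∈ axis d e) (hy' : y' ∈ axis d e) :
    |(|bus d e y y'|) - d y y'| ≤ 260 := by
  obtain ⟨K, h1, h2, h3⟩ := ((L.eventually_mid' he hy 1 0).and
    ((L.eventually_mid' he hy' 1 0).and (L.hm.bus_spec e y y'))).exists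
  rw [mul_one] at h1 h2
  have h4 := L.hm.mid_close h1 h2
  have := L.hm.tri (e ^ K)⁻¹ y y'
  have := L.hm.tri (e ^ K)⁻¹ y' y
  have := L.hm.symm y y'
  rw [abs_le]
  rcases abs_cases (d (e ^ K)⁻¹ y - d (e ^ K)⁻¹ y') with ⟨k, k'⟩ | ⟨k, k'⟩ <;>
    rcases abs_cases (bus d e y y') with ⟨j, j'⟩ | ⟨j, j'⟩ <;> omega

theorem bus_smul {e y y' : G} (he : e ∈ I) (hy : y ∈ axis d e) (g : G) :
    |bus d (g * e * g⁻¹) (g * y) (g * y') - bus d e y y'| ≤ 20 := by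
  obtain ⟨K, h1, h2, h3⟩ := ((L.eventually_mid' he hy 1 (2 * d y y' + d 1 g⁻¹ + d y y' + 30)).and
    ((L.hm.bus_spec e y y').and (L.hm.bus_spec (g * e * g⁻¹) (g * y) (g * y')))).exists
  rw [mul_one] at h1
  have hl := h1.left
  rw [conj_pow, mul_inv_rev, mul_inv_rev, inv_inv, L.hm.inv, L.hm.inv] at h3
  have a1 : d (e ^ K)⁻¹ ((e ^ K)⁻¹ * g⁻¹) = d 1 g⁻¹ := by
    have := L.hm.inv (e ^ K)⁻¹ 1 g⁻¹
    rwa [mul_one] at this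
  have t1 := L.hm.tri (e ^ K)⁻¹ ((e ^ K)⁻¹ * g⁻¹) y
  have t2 := L.hm.tri (e ^ K)⁻¹ y' y
  have t3 := L.hm.tri ((e ^ K)⁻¹ * g⁻¹) y' y
  have s1 := L.hm.symm y y'
  have n1 := L.hm.nn y y'
  have n2 := L.hm.nn 1 g⁻¹
  have b1 := L.hm.busemann (a := (e ^ K)⁻¹) (a' := (e ^ K)⁻¹ * g⁻¹) (x := y) (y := y') (by omega)
  have b2 := L.hm.busemann (a := (e ^ K)⁻¹) (a' := (e ^ K)⁻¹ * g⁻¹) (x := y') (y := y) (by omega)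
  rw [abs_le]
  omega

theorem bus_comm {e y y' g : G} (he : e ∈ I) (hy : y ∈ axis d e) (hg : g * e = e * g) :
    |bus d e (g * y) (g * y') - bus d e y y'| ≤ 20 := by
  have := L.bus_smul (y' := y') he hy g
  rwa [hg, mul_inv_cancel_right] at this

theorem lenR_spec {e : G} (he : e ∈ I) : N0 ≤ lenR d ν e ∧
    (∃ r ∈ rotG ν e, r ≠ 1 ∧ ∃ y ∈ axis d e, lenR d ν e = d y (r * y)) ∧
    ∀ r ∈ rotG ν e, r ≠ 1 → ∀ y ∈ axis d e, lenR d ν e ≤ d y (r * y) := by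
  have hlow : ∀ r ∈ rotG ν e, r ≠ 1 → ∀ y ∈ axis d e, N0 ≤ d y (r * y) := by
    intro r hr hr1 y hy
    obtain ⟨g, hg, rfl⟩ := (L.mem_rotG he).1 hr
    exact L.spin e he g hg hr1 y hy
  have hne : {m | ∃ r ∈ rotG ν e, r ≠ 1 ∧ ∃ y ∈ axis d e, m = d y (r * y)}.Nonempty := by
    obtain ⟨y, hy⟩ := L.ne e he
    exact ⟨_, e ^ ν e, (L.mem_rotG he).2 ⟨e, rfl, rfl⟩, L.pow_ne e he, y, hy, rfl⟩
  have hbd : BddBelow {m | ∃ r ∈ rotG ν e, r ≠ 1 ∧ ∃ y ∈ axis d e, m = d y (r * y)} := by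
    refine ⟨N0, ?_⟩
    rintro _ ⟨r, hr, hr1, y, hy, rfl⟩
    exact hlow r hr hr1 y hy
  refine ⟨?_, Int.csInf_mem hne hbd, fun r hr hr1 y hy => csInf_le hbd ⟨r, hr, hr1, y, hy, rfl⟩⟩
  refine le_csInf hne ?_
  rintro _ ⟨r, hr, hr1, y, hy, rfl⟩
  exact hlow r hr hr1 y hy

/-- Some rotation moves all points of the axis forward by nearly the minimal amount. -/
theorem exists_forward {e : G} (he : e ∈ I) : ∃ r ∈ rotG ν e, ∀ y ∈ axis d e,
    |bus d e y (r * y) - lenR d ν e| ≤ 300 := by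
  obtain ⟨hN, ⟨r, hr, -, y0, hy0, h0⟩, -⟩ := L.lenR_spec he
  have hc := L.rotG_comm he hr
  have hst : ∀ r : G, r * e = e * r → ∀ y ∈ axis d e, |bus d e y (r * y) - bus d e y0 (r * y0)| ≤ 20 := by
    intro r hc y hy
    have a1 := L.hm.bus_add e y y0 (r * y0)
    have a2 := L.hm.bus_add e y (r * y0) (r * y)
    have a3 := L.hm.bus_add e y y0 y
    have a4 := L.hm.bus_add e y y y
    have a5 := L.bus_comm (y' := y) he hy0 hc
    rw [abs_le] at *
    omega
  have h1 := L.bus_abs he hy0 (L.axis_comm hc hy0)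
  rcases abs_cases (bus d e y0 (r * y0)) with ⟨k, k'⟩ | ⟨k, k'⟩
  · refine ⟨r, hr, fun y hy => ?_⟩
    have := hst r hc y hy
    rw [abs_le] at *
    omega
  · have hc' : r⁻¹ * e = e * r⁻¹ := by
      have : Commute r e := hc
      exact this.inv_left
    refine ⟨r⁻¹, inv_mem hr, fun y hy => ?_⟩
    have h2 := hst r⁻¹ hc' y hy
    have h3 := L.bus_comm (y' := r * y0) he hy0 hc'
    rw [inv_mul_cancel_left] at h3
    have a1 := L.hm.bus_add e y0 (r⁻¹ * y0) y0
    have a2 := L.hm.bus_add e y0 y0 y0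
    rw [abs_le] at *
    omega

theorem bus_rot {e : G} (he : e ∈ I) (hN : 1000 ≤ N0) (y : G) {y' : G}
    (hy' : y' ∈ axis d e) : ∃ r ∈ rotG ν e, ∃ r' ∈ rotG ν e, ∃ τ, 0 ≤ τ ∧ τ ≤ lenR d ν e ∧
      |bus d e y (r * y') - τ| ≤ 1000 ∧ |bus d e y (r' * y') - (τ - lenR d ν e)| ≤ 1000 := by
  obtain ⟨r, hr, h⟩ := L.exists_forward he
  have hN' := (L.lenR_spec he).1
  set N := lenR d ν e
  have hz : ∀ k : ℤ, r ^ k * y' ∈ axis d e := fun k =>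
    L.axis_comm (L.rotG_comm he (zpow_mem hr k)) hy'
  have step : ∀ k : ℤ, |bus d e y (r ^ (k + 1) * y') - bus d e y (r ^ k * y') - N| ≤ 300 := by
    intro k
    have h1 := h _ (hz k)
    rw [← mul_assoc, ← zpow_one_add, add_comm] at h1
    have := L.hm.bus_add e y (r ^ k * y') (r ^ (k + 1) * y')
    rw [abs_le] at *
    omega
  have up : ∀ m : ℕ, (m : ℤ) ≤ bus d e y (r ^ (m : ℤ) * y') - bus d e y y' := by
    intro m
    induction m with
    | zero => simp
    | succ m ih =>
      have := step m
      rw [abs_le] at this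
      push_cast
      omega
  have down : ∀ m : ℕ, bus d e y (r ^ (-(m : ℤ)) * y') - bus d e y y' ≤ -m := by
    intro m
    induction m with
    | zero => simp
    | succ m ih =>
      have := step (-(m : ℤ) - 1)
      rw [sub_add_cancel, abs_le] at this
      push_cast
      rw [neg_add']
      omega
  obtain ⟨k, hk, hmin⟩ := Int.exists_least_of_bdd (P := fun k => 0 ≤ bus d e y (r ^ k * y'))
    ⟨-(bus d e y y').toNat, fun z hz0 => by
      by_contra! hlt
      have h1 := down (-z).toNat
      rw [Int.toNat_of_nonneg (by omega), neg_neg] at h1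
      omega⟩
    ⟨(-(bus d e y y')).toNat, by have := up (-(bus d e y y')).toNat; omega⟩
  have h1 : ¬ 0 ≤ bus d e y (r ^ (k - 1) * y') := fun h => by have := hmin _ h; omega
  have h2 := step (k - 1)
  rw [sub_add_cancel, abs_le] at h2
  refine ⟨r ^ k, zpow_mem hr k, r ^ (k - 1), zpow_mem hr _, min (bus d e y (r ^ k * y')) N,
    by omega, by omega, ?_, ?_⟩ <;> rw [abs_le] <;> omega

theorem overlap {e f : G} (he : e ∈ I) (hf : f ∈ I) (hef : e ≠ f) {y y' p p' : G}
    (hy : y ∈ axis d f) (hy' : y' ∈ axis d f) (hp : Gate d 2200 (axis d e) y p)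
    (hp' : Gate d 2200 (axis d e) y' p') : d p p' ≤ max c0 5000 := by
  by_contra! hlt
  rw [max_lt_iff] at hlt
  have b1 := L.hm.gate_cross_left hp hp' (by omega)
  have b2 := L.hm.gate_cross_right hp hp' (by omega)
  obtain ⟨q, hq⟩ := L.gate hf p
  obtain ⟨q', hq'⟩ := L.gate hf p'
  have b3 := L.hm.gate_bt b1 hy hy' hq
  have b4 := L.hm.gate_bt b2 hy hy' hq'
  have := L.ov e he f hf hef p hp.1 p' hp'.1 q hq.1 q' hq'.1 (by omega) (by omega)
  omega

theorem fam {c : ℤ} (h1 : 10000 ≤ c) (h2 : c0 ≤ c) (hN : 800 * c ≤ N0) :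
    @Fam G I _ (conjAct L.conj) d (fun e => axis d e.1) (fun e => rotG ν e.1)
      (fun e => lenR d ν e.1) c N0 := by
  let _ := conjAct L.conj
  have hR : ∀ g, ∀ e ∈ I, ∀ s ∈ rotG ν e, g * s * g⁻¹ ∈ rotG ν (g * e * g⁻¹) := by
    intro g e he s hs
    obtain ⟨h, hh, rfl⟩ := (L.mem_rotG he).1 hs
    refine (L.mem_rotG (L.conj g e he)).2 ⟨g * h * g⁻¹, ?_, ?_⟩
    · calc _ = g * (h * e) * g⁻¹ := by group
        _ = g * (e * h) * g⁻¹ := by rw [hh]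
        _ = _ := by group
    · rw [L.ν_conj g e he, conj_pow]
  have hle : ∀ g, ∀ e ∈ I, lenR d ν (g * e * g⁻¹) ≤ lenR d ν e := by
    intro g e he
    obtain ⟨r, hr, hr1, y, hy, h⟩ := (L.lenR_spec he).2.1
    have := (L.lenR_spec (L.conj g e he)).2.2 (g * r * g⁻¹) (hR g e he r hr)
      (fun h => hr1 (by simpa using h)) (g * y) (L.hm.axis_smul g hy)
    rw [show g * r * g⁻¹ * (g * y) = g * (r * y) by group, L.hm.inv] at this
    rwa [h]
  refine
    { hm := L.hm.mono (by omega)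
      c_pos := by omega
      N_big := hN
      Y_smul := fun g e x hx => L.hm.axis_smul g hx
      R_smul := fun g e s hs => hR g e.1 e.2 s hs
      R_fix := fun e s hs => Subtype.ext ?_
      N_smul := fun g e => le_antisymm (hle g e.1 e.2) ?_
      N_ge := fun e => (L.lenR_spec e.2).1
      gate := fun e x => L.gate e.2 x
      overlap := fun e f hef y hy y' hy' p p' hp hp' =>
        (L.overlap e.2 f.2 (fun h => hef (Subtype.ext h)) hy hy' hp hp').trans
          (max_le h2 (by omega))
      spin := fun e s y hs hs1 hy => (L.lenR_spec e.2).2.2 s hs hs1 y hy }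
  · show s * e.1 * s⁻¹ = e.1
    rw [L.rotG_comm e.2 hs, mul_inv_cancel_right]
  · have := hle g⁻¹ _ (L.conj g e.1 e.2)
    rwa [show g⁻¹ * (g * e.1 * g⁻¹) * g⁻¹⁻¹ = e.1 by group] at this

theorem famX {c C A : ℤ} (h1 : 10000 ≤ c) (h2 : c0 ≤ c) (hN : 800 * c ≤ N0) (hC : 0 ≤ C)
    (hA : 0 ≤ A)
    (min_ax : ∀ g x, (∀ y, d x (g * x) ≤ d y (g * y)) → g ^ n = 1 ∨ (∃ e ∈ I, g * e = e * g) ∨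
      Ax d c g x)
    (line_ax : ∀ u p q D, u ≠ 1 → 0 ≤ D → d p (u * p) ≤ D → d q (u * q) ≤ D →
      (∀ z, Bt d 0 p z q → C * D + A ≤ d p z → C * D + A ≤ d z q → Ax d c u z) ∨
      ∃ e ∈ I, u * e = e * u ∧ ∀ z, Bt d 0 p z q → C * D + A ≤ d p z → C * D + A ≤ d z q →
        ∃ y ∈ axis d e, d z y ≤ c)
    (comm : ∀ u v p q z D, 0 ≤ D → d p (u * p) ≤ D → d q (u * q) ≤ D → d p (v * p) ≤ D →
      d q (v * q) ≤ D → Bt d 0 p z q → C * D + A ≤ d p z → C * D + A ≤ d z q → u * v = v * u) :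
    @FamX G I _ (conjAct L.conj) d (fun e => axis d e.1) (fun e => rotG ν e.1)
      (fun e => lenR d ν e.1) (fun e y y' => bus d e.1 y y') n c N0 C A := by
  let _ := conjAct L.conj
  have hfix : ∀ (g : G) (e : I), g • e = e ↔ g * e.1 = e.1 * g := by
    intro g e
    rw [Subtype.ext_iff]
    exact mul_inv_eq_iff_eq_mul
  refine
    { toFam := L.fam h1 h2 hN
      C_nn := hC
      A_nn := hA
      min_ax := fun g x h => ?_
      line_ax := fun u p q D hu hD hp hq => ?_
      comm := comm
      fix_pow := fun g e h => ?_
      t_abs := fun e y hy y' hy' => (L.bus_abs e.2 hy hy').trans (by omega)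
      t_add := fun e y _ y' _ y'' _ => ?_
      t_smul := fun g e y hy y' _ => (L.bus_smul e.2 hy g).trans (by omega)
      t_rot := fun e y _ y' hy' => ?_ }
  · rcases min_ax g x h with h | ⟨e, he, h⟩ | h
    · exact .inl h
    · exact .inr (.inl ⟨⟨e, he⟩, (hfix _ _).2 h⟩)
    · exact .inr (.inr h)
  · rcases line_ax u p q D hu hD hp hq with h | ⟨e, he, h, h'⟩
    · exact .inl h
    · exact .inr ⟨⟨e, he⟩, (hfix _ _).2 h, h'⟩
  · obtain ⟨k, hk⟩ := L.ν_dvd e.1 e.2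
    rw [hk, pow_mul]
    exact pow_mem ((L.mem_rotG e.2).2 ⟨g, (hfix _ _).1 h, rfl⟩) k
  · rw [L.hm.bus_add, sub_self, abs_zero]; omega
  · obtain ⟨r, hr, r', hr', τ, t0, t1, t2, t3⟩ := L.bus_rot e.2 (by omega) y hy'
    exact ⟨r, hr, r', hr', τ, t0, t1, t2.trans (by omega), t3.trans (by omega)⟩

end Lines
end PG

namespace PG

/-- Nontorsion elements with small displacement at some point. -/
def Short {G : Type} [Group G] (d : G → G → ℤ) (n : ℕ) : Set G :=
  {u | u ^ n ≠ 1 ∧ ∃ x, d x (u * x) ≤ 260}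

/-- The standing assumptions on the metric of an intermediate group. -/
structure Stage {G : Type} [Group G] (d : G → G → ℤ) (n : ℕ) (T A : ℤ) : Prop where
  hm : HM d 20
  low : Low d n T
  thin : Thin d n 11000 A
  odd : Odd n
  A_nn : 0 ≤ A

theorem HM.disp_pow_le {G : Type} [Group G] {d : G → G → ℤ} {δ : ℤ} (hm : HM d δ) (u x : G) (k : ℕ) :
    d x (u ^ k * x) ≤ k * d x (u * x) := by
  induction k with
  | zero => simp [hm.self]
  | succ k ih =>
    have := hm.tri x (u ^ k * x) (u ^ (k + 1) * x)
    rw [pow_succ, mul_assoc, hm.inv] at this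
    rw [pow_succ, mul_assoc]
    push_cast
    linarith

/-- The displacement on a quasi-axis is nearly minimal. -/
theorem HM.sup_disp {G : Type} [Group G] {d : G → G → ℤ} {δ : ℤ} (hm : HM d δ) {u x z : G}
    {c l : ℤ} (h : ∀ j k : ℕ, d z (u ^ j * z) + d z (u ^ k * z) ≤ d z (u ^ (j + k) * z) + c)
    (hx : d x (u * x) ≤ l) : d z (u * z) ≤ l + c := by
  by_contra! hlt
  set m := (2 * d z x + |c|).toNat
  have h1 := Ax.mul_le h m 1
  rw [mul_one, pow_one] at h1
  have h2 := hm.disp_pow_le u x (m + 1)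
  have h3 := hm.tri z x (u ^ (m + 1) * z)
  have h4 := hm.tri x (u ^ (m + 1) * x) (u ^ (m + 1) * z)
  rw [hm.inv] at h4
  have h5 := hm.symm x z
  have n1 := hm.nn z x
  have n2 := neg_abs_le c
  have hmm : (m : ℤ) = 2 * d z x + |c| := Int.toNat_of_nonneg (by positivity)
  have e1 : ((m + 1 : ℕ) : ℤ) * d x (u * x) ≤ (m + 1 : ℕ) * l :=
    mul_le_mul_of_nonneg_left hx (by positivity)
  have e2 : ((m : ℤ) + 1) * (l + c + 1) ≤ ((m : ℤ) + 1) * d z (u * z) :=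
    mul_le_mul_of_nonneg_left (by omega) (by positivity)
  push_cast at *
  nlinarith

theorem HM.comm_disp {G : Type} [Group G] {d : G → G → ℤ} {δ : ℤ} (hm : HM d δ) {u g : G}
    (h : Commute g u) (p : G) (K : ℕ) :
    Disp d (d p (g * p)) g ((u ^ K)⁻¹ * p) (u ^ K * p) := by
  have h1 : g * (u ^ K)⁻¹ = (u ^ K)⁻¹ * g := (h.pow_right K).inv_right
  have h2 : g * u ^ K = u ^ K * g := h.pow_right K
  constructor
  · rw [← mul_assoc, h1, mul_assoc, hm.inv]
  · rw [← mul_assoc, h2, mul_assoc, hm.inv]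

theorem Disp.mono {G : Type} [Group G] {d : G → G → ℤ} {D D' : ℤ} {u p q : G} (h : Disp d D u p q)
    (hD : D ≤ D') : Disp d D' u p q := ⟨h.1.trans hD, h.2.trans hD⟩

theorem commute_sq {G : Type} [Group G] {u h : G} (hh : h * u * h⁻¹ = u⁻¹) :
    Commute (h ^ 2) u := by
  have e1 : h * u = u⁻¹ * h := by rw [← hh]; group
  have e2 : h * u⁻¹ = u * h := by
    have h1 := congrArg (·⁻¹) hh
    simp only [mul_inv_rev, inv_inv] at h1
    nth_rw 2 [← h1]
    group
  show h ^ 2 * u = u * h ^ 2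
  rw [pow_two, mul_assoc, e1, ← mul_assoc, e2, mul_assoc]

namespace Stage
variable {G : Type} [Group G] {d : G → G → ℤ} {n : ℕ} {T A : ℤ} (S : Stage d n T A)
include S

theorem low' {u : G} {B : ℤ} (h : ∀ K : ℕ, ∃ j : ℕ, K ≤ j ∧ ∃ x, d x (u ^ j * x) ≤ B) :
    u ^ n = 1 := by
  rcases S.low u with h1 | h1
  · exact h1
  · obtain ⟨j, hj, x, hx⟩ := h ((|T| * |B|).toNat + 1)
    have h2 := h1 x j
    have h3 := S.hm.nn x (u ^ j * x)
    have h4 : T * d x (u ^ j * x) ≤ |T| * |B| :=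
      (mul_le_mul_of_nonneg_right (le_abs_self T) h3).trans
        (mul_le_mul_of_nonneg_left (hx.trans (le_abs_self B)) (abs_nonneg T))
    omega

theorem far {u : G} (hu : u ^ n ≠ 1) (B : ℤ) :
    ∃ K0 : ℕ, ∀ K, K0 ≤ K → ∀ x, B ≤ d x (u ^ K * x) := by
  by_contra! h
  refine hu (S.low' (B := B) fun K => ?_)
  obtain ⟨j, hj, x, hx⟩ := h K
  exact ⟨j, hj, x, hx.le⟩

theorem exists_mid {u z : G} (hu : u ^ n ≠ 1) (hz : z ∈ axis d u) (m : ℤ) :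
    ∃ K : ℕ, Mid d 200 m ((u ^ K)⁻¹ * z) z (u ^ K * z) := by
  obtain ⟨K, hK⟩ := S.far hu m
  have h1 := hK K le_rfl z
  have h2 := S.hm.inv (u ^ K)⁻¹ z (u ^ K * z)
  rw [inv_mul_cancel_left] at h2
  exact ⟨K, S.hm.bt_axis hz K, by omega, h1⟩

theorem exists_mid2 {u z y : G} (hu : u ^ n ≠ 1) (hz : z ∈ axis d u) (hy : y ∈ axis d u) (m : ℤ) :
    ∃ K : ℕ, Mid d 240 m ((u ^ K)⁻¹ * z) z (u ^ K * z) ∧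
      Mid d 240 m ((u ^ K)⁻¹ * z) y (u ^ K * z) := by
  have n0 := S.hm.nn y z
  have n1 := abs_nonneg m
  obtain ⟨K, hK⟩ := S.far hu (|m| + d y z + 300)
  have key : ∀ w ∈ axis d u, Mid d 200 (|m| + d y z + 300) ((u ^ K)⁻¹ * w) w (u ^ K * w) := by
    intro w hw
    have h2 := S.hm.inv (u ^ K)⁻¹ w (u ^ K * w)
    rw [inv_mul_cancel_left] at h2
    exact ⟨S.hm.bt_axis hw K, by have := hK K le_rfl w; omega, hK K le_rfl w⟩
  have n2 := le_abs_self m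
  exact ⟨K, (key z hz).mono (by omega) (by omega), (S.hm.mid_base (key y hy) (B := d y z)
    (by rw [S.hm.inv]) (by rw [S.hm.inv]) (by omega)).mono (by omega) (by omega)⟩

theorem axis_disp {u z : G} (hu : u ∈ Short d n) (hz : z ∈ axis d u) : d z (u * z) ≤ 460 := by
  obtain ⟨-, x, hx⟩ := hu
  exact S.hm.sup_disp hz hx

theorem short_along {u p q z : G} {m B : ℤ} (hu : u ∈ Short d n) (h : Disp d B u p q)
    (hz : Mid d 0 m p z q) (hm : 2 * B + 80 < m) : d z (u * z) ≤ 440 := by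
  obtain ⟨-, x, hx⟩ := hu
  by_contra! hlt
  have := S.hm.sup_disp (S.hm.ax_of_long h hz (by omega) (by omega)).sup hx
  omega

theorem ne_one {u : G} (hu : u ∈ Short d n) : u ≠ 1 := fun h => hu.1 (by rw [h, one_pow])

theorem axis_mid {u p : G} (hu : u ∈ Short d n) {K : ℕ} {z : G} (hp : d p (u * p) ≤ 11000)
    (hz : Mid d 0 A ((u ^ K)⁻¹ * p) z (u ^ K * p)) : z ∈ axis d u := by
  have h := (S.hm.comm_disp (Commute.refl u) p K).mono hp
  exact S.thin.sup u _ _ z (S.ne_one hu) h.1 h.2 hz.bt hz.left hz.right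

theorem exists_axis {u : G} (hu : u ∈ Short d n) : (axis d u).Nonempty := by
  obtain ⟨hn, x, hx⟩ := hu
  obtain ⟨K, hK⟩ := S.far hn (2 * A)
  have h1 := hK (K + K) (by omega) ((u ^ K)⁻¹ * x)
  have hA := S.A_nn
  rw [pow_add, mul_assoc, mul_inv_cancel_left] at h1
  obtain ⟨z, hz, hz'⟩ := S.hm.geo ((u ^ K)⁻¹ * x) (u ^ K * x) A hA (by omega)
  exact ⟨z, S.axis_mid (K := K) ⟨hn, x, hx⟩ (hx.trans (by norm_num)) ⟨by unfold Bt; omega, by omega, by omega⟩⟩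

/-- An element with small displacement at the ends of a long segment around `z`. -/
theorem mid_sup {u p q z : G} {m B : ℤ} (hu : u ≠ 1) (hz : Mid d 0 m p z q) (h0 : 0 ≤ B)
    (hm : A + B ≤ m) (hB : ∀ w, Mid d 0 B p w q → d w (u * w) ≤ 11000) :
    z ∈ axis d u ∧ u ^ n ≠ 1 := by
  have hA := S.A_nn
  obtain ⟨p', q', h1, h2, h3⟩ := S.hm.mid_cut hz hA (by omega)
  have d1 := hB p' (h1.mono le_rfl (by omega))
  have d2 := hB q' (h2.mono le_rfl (by omega))
  exact ⟨S.thin.sup u p' q' z hu d1 d2 h3.bt h3.left h3.right,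
    S.thin.pow_ne u p' q' z hu d1 d2 h3.bt h3.left h3.right⟩

theorem near {u e z : G} (hu : u ∈ Short d n) (he : e ∈ Short d n) (hue : Commute e u)
    (hz : z ∈ axis d u) : ∃ y ∈ axis d e, d z y ≤ 420 := by
  have n0 := S.hm.nn z (e * z)
  obtain ⟨K, hK⟩ := S.exists_mid hu.1 hz (A + (2 * d z (e * z) + 81) + 420)
  obtain ⟨y, hy, hzy⟩ := S.hm.mid_exact hK
  refine ⟨y, (S.mid_sup (S.ne_one he) hy (B := 2 * d z (e * z) + 81) (by omega) (by omega)
    fun w hw => ?_).1, by omega⟩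
  exact (S.short_along he (S.hm.comm_disp hue z K) hw (by omega)).trans (by norm_num)

theorem conj_short {u : G} (hu : u ∈ Short d n) (g : G) : g * u * g⁻¹ ∈ Short d n := by
  obtain ⟨hn, x, hx⟩ := hu
  refine ⟨by rwa [conj_pow, Ne, conj_eq_one_iff], g * x, ?_⟩
  rw [show g * u * g⁻¹ * (g * x) = g * (u * x) by group, S.hm.inv]
  exact hx

theorem torsion_comm {u k z : G} (hu : u ∈ Short d n) (hz : z ∈ axis d u) (hk : Commute k u)
    (hd : d z (k * z) ≤ 11000) (hn : k ^ n = 1) : k = 1 := by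
  by_contra h1
  obtain ⟨K, hK⟩ := S.exists_mid hu.1 hz (A + 420)
  obtain ⟨y, hy, -⟩ := S.hm.mid_exact hK
  have h := (S.hm.comm_disp hk z K).mono hd
  exact S.thin.pow_ne k _ _ y h1 h.1 h.2 hy.bt (by have := hy.left; omega)
    (by have := hy.right; omega) hn

theorem disp_axis {u g z y : G} (hu : u ∈ Short d n) (hg : Commute g u) (hz : z ∈ axis d u)
    (hy : y ∈ axis d u) : d z (g * z) ≤ d y (g * y) + 320 := by
  obtain ⟨K, h1, h2⟩ := S.exists_mid2 hu.1 hz hy (d z (g * z) + 281)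
  have := S.hm.disp_const (S.hm.comm_disp hg z K) h1 h2 (by omega)
  omega

theorem pow_close {u v z : G} (hu : u ∈ Short d n) (hz : z ∈ axis d u) (huv : Commute v u)
    {m : ℕ} (h1 : |d z (v ^ m * z) - d z (u ^ m * z)| ≤ 1160) :
    d z ((u⁻¹ * v) ^ m * z) ≤ 1700 ∨ d z ((u * v) ^ m * z) ≤ 1700 := by
  set E := d z (u ^ m * z) + 1160
  rw [abs_le] at h1
  have n0 := S.hm.nn z (u ^ m * z)
  obtain ⟨K, hK⟩ := S.exists_mid hu.1 hz (4 * E + 1000)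
  set p := (u ^ K)⁻¹ * z
  set q := u ^ K * z
  have ha : Disp d E (u ^ m) p q :=
    (S.hm.comm_disp ((Commute.refl u).pow_left m) z K).mono (by omega)
  have hb : Disp d E (v ^ m) p q :=
    (S.hm.comm_disp (huv.pow_left m) z K).mono (by omega)
  have s1 := S.hm.shift_le (u ^ m) p z
  have s2 := S.hm.shift_le (v ^ m) p z
  have s3 := S.hm.disp_le ha hK (by omega)
  have s4 := S.hm.disp_le hb hK (by omega)
  have hi := S.hm.Disp_mul (S.hm.Disp_inv ha) hb
  have hj := S.hm.Disp_mul ha hb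
  have s5 := S.hm.shift_mul (ha.mono (D' := E + E) (by omega)) hi hK (by omega)
  have s6 := S.hm.shift_mul ha hb hK (by omega)
  have s7 := S.hm.disp_le hi hK (by omega)
  have s8 := S.hm.disp_le hj hK (by omega)
  rw [mul_inv_cancel_left] at s5
  rw [(huv.symm.inv_left).mul_pow, inv_pow, huv.symm.mul_pow]
  rw [abs_le] at s5 s6 
  rcases abs_cases (d p (u ^ m * z) - d p z) with e1 | e1 <;>
  rcases abs_cases (d p (v ^ m * z) - d p z) with e2 | e2 <;>
  rcases abs_cases (d p ((u ^ m)⁻¹ * v ^ m * z) - d p z) with e3 | e3 <;>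
  rcases abs_cases (d p (u ^ m * v ^ m * z) - d p z) with e4 | e4 <;>
  omega

theorem axis_inv {u z : G} (hz : z ∈ axis d u) : z ∈ axis d u⁻¹ := by
  intro j k
  simp only [inv_pow, S.hm.disp_inv]
  exact hz j k

theorem reversal_sq {u h z : G} (hu : u ∈ Short d n) (hh : h * u * h⁻¹ = u⁻¹)
    (hz : z ∈ axis d u) : d z (h ^ 2 * z) ≤ 560 := by
  have hz' : h * z ∈ axis d u := by
    have h1 := S.axis_inv (S.hm.axis_smul h hz)
    rwa [hh, inv_inv] at h1
  have c2 := commute_sq hh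
  have n1 := S.hm.nn z (h * z)
  have n2 := S.hm.nn z (h ^ 2 * z)
  obtain ⟨K, h1, h2⟩ := S.exists_mid2 hu.1 hz hz'
    (d z (h ^ 2 * z) + 2 * d z (h * z) + 281)
  set p := (u ^ K)⁻¹ * z
  set q := u ^ K * z
  have hD : Disp d (d z (h ^ 2 * z)) (h ^ 2) p q := S.hm.comm_disp c2 z K
  have hq : h * q = (u ^ K)⁻¹ * (h * z) := by
    have : h * u ^ K * h⁻¹ = (u ^ K)⁻¹ := by rw [← conj_pow, hh, inv_pow]
    show h * (u ^ K * z) = _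
    rw [← this]; group
  have hpq : d p (h * q) = d z (h * z) := by rw [hq, S.hm.inv]
  have hhz : d (h * z) (h ^ 2 * z) = d z (h * z) := by rw [pow_two, mul_assoc, S.hm.inv]
  have b1 : d (h * q) (h * z) = d z q := by rw [S.hm.inv, S.hm.symm]
  have b2 : d (h * q) (h ^ 2 * z) = d (h * z) q := by
    rw [pow_two, mul_assoc, S.hm.inv, S.hm.symm]
  have n3 := S.hm.nn p (h ^ 2 * z)
  have r1 := h1.right
  have B1 := S.hm.busemann (a := p) (a' := h * q) (x := h * z) (y := h ^ 2 * z) (by omega)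
  have n4 := S.hm.nn (h * q) (h ^ 2 * z)
  have l1 := h2.left
  have B2 := S.hm.busemann (a' := p) (a := h * q) (x := h * z) (y := h ^ 2 * z)
    (by have := S.hm.symm p (h * q); omega)
  have t1 := h1.bt
  have t2 := h2.bt
  have t3 := S.hm.tri p z q
  have t4 := S.hm.tri p (h * z) q
  unfold Bt at t1 t2
  have s := S.hm.disp_le hD h1 (by omega)
  rcases abs_cases (d p (h ^ 2 * z) - d p z) with e | e <;> omega

theorem not_reversal {u g : G} (hu : u ∈ Short d n) : g * u * g⁻¹ ≠ u⁻¹ := by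
  intro hg
  obtain ⟨z, hz⟩ := S.exists_axis hu
  have h2 := commute_sq hg
  have hodd : ∀ m : ℕ, g ^ (2 * m + 1) * u * (g ^ (2 * m + 1))⁻¹ = u⁻¹ := by
    intro m
    have h3 : Commute (g ^ (2 * m)) u := by rw [pow_mul]; exact Commute.pow_left h2 m
    rw [pow_succ', mul_assoc g, h3.eq, ← hg]; group
  have hn : g ^ n = 1 := S.low' (B := 560) fun K =>
    ⟨(2 * K + 1) * 2, by omega, z, by rw [pow_mul]; exact S.reversal_sq hu (hodd K) hz⟩
  obtain ⟨k, hk⟩ := S.odd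
  have hgu : Commute g u := by
    have h3 : g = (g ^ 2) ^ (k + 1) := by
      rw [← pow_mul, show 2 * (k + 1) = n + 1 by omega, pow_succ, hn, one_mul]
    rw [h3]; exact Commute.pow_left h2 _
  have hu2 : u ^ 2 = 1 := by
    have h4 : u = u⁻¹ := by rw [← hg, hgu.eq, mul_inv_cancel_right]
    rw [pow_two]; nth_rw 1 [h4]; exact inv_mul_cancel u
  refine hu.1 (S.low' (B := 0) fun K => ⟨2 * K, by omega, 1, ?_⟩)
  rw [pow_mul, hu2, one_pow, one_mul, S.hm.self]

theorem conj_fix {u g : G} (hu : u ∈ Short d n) (h : Commute (g * u * g⁻¹) u) :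
    g * u * g⁻¹ = u := by
  obtain ⟨z, hz⟩ := S.exists_axis hu
  set v := g * u * g⁻¹ with hv
  have hvs : v ∈ Short d n := S.conj_short hu g
  obtain ⟨y, hy, hzy⟩ := S.near hu hvs h hz
  have hgz : g * z ∈ axis d v := S.hm.axis_smul g hz
  have hcl : ∀ m : ℕ, |d z (v ^ m * z) - d z (u ^ m * z)| ≤ 1160 := by
    intro m
    have c1 : Commute (v ^ m) v := (Commute.refl v).pow_left m
    have a1 := S.disp_axis hvs c1 hy hgz
    have a2 := S.disp_axis hvs c1 hgz hy
    have e1 : d (g * z) (v ^ m * (g * z)) = d z (u ^ m * z) := by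
      rw [hv, conj_pow, show g * u ^ m * g⁻¹ * (g * z) = g * (u ^ m * z) by group, S.hm.inv]
    have t1 := S.hm.tri z y (v ^ m * z)
    have t2 := S.hm.tri y (v ^ m * y) (v ^ m * z)
    have t3 := S.hm.tri y z (v ^ m * y)
    have t4 := S.hm.tri z (v ^ m * z) (v ^ m * y)
    rw [S.hm.inv] at t2 t4
    have := S.hm.symm z y
    rw [abs_le]; omega
  have hdu := S.axis_disp hu hz
  have hdv : d z (v * z) ≤ 460 + 1160 := by
    have := abs_le.1 (hcl 1)
    simp only [pow_one] at this
    omega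
  have hor : (u⁻¹ * v) ^ n = 1 ∨ (u * v) ^ n = 1 := by
    by_contra! hne
    obtain ⟨K1, h1⟩ := S.far hne.1 1701
    obtain ⟨K2, h2⟩ := S.far hne.2 1701
    have h3 := h1 (max K1 K2) (le_max_left _ _) z
    have h4 := h2 (max K1 K2) (le_max_right _ _) z
    rcases S.pow_close hu hz h (hcl (max K1 K2)) with h5 | h5 <;> omega
  rcases hor with h1 | h1
  · have : u⁻¹ * v = 1 := S.torsion_comm hu hz
      (Commute.mul_left (Commute.refl u).inv_left h) (by
        have t1 := S.hm.tri z (u⁻¹ * z) (u⁻¹ * v * z)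
        rw [mul_assoc, S.hm.inv, S.hm.disp_inv, ← mul_assoc] at t1
        omega) h1
    exact (inv_mul_eq_one.1 this).symm
  · have : u * v = 1 := S.torsion_comm hu hz
      (Commute.mul_left (Commute.refl u) h) (by
        have t1 := S.hm.tri z (u * z) (u * v * z)
        rw [mul_assoc, S.hm.inv, ← mul_assoc] at t1
        omega) h1
    exact absurd (eq_inv_of_mul_eq_one_right this) (S.not_reversal hu)

theorem comm_mid {u v p q z : G} {m D : ℤ} (hD : 0 ≤ D) (hu : Disp d D u p q)
    (hv : Disp d D v p q) (hz : Mid d 0 m p z q) (hm : 3 * D + A + 1000 ≤ m) :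
    u * v = v * u := by
  have hA := S.A_nn
  set h := (v * u)⁻¹ * (u * v) with hh
  suffices h = 1 by rw [hh, inv_mul_eq_one] at this; exact this.symm
  by_contra hne
  have hd : ∀ e w m', 2 * D + e + 80 < m' → Mid d e m' p w q → d w (h * w) ≤ e + 140 := by
    intro e w m' hm' hw
    have h1 := S.hm.comm_close hu hv hw (by omega)
    have h2 := S.hm.inv (v * u) w (h * w)
    rw [← mul_assoc (v * u) h, hh, mul_inv_cancel_left] at h2
    rw [hh, ← h2, S.hm.symm]
    omega
  obtain ⟨hax, hn⟩ := S.mid_sup hne hz (B := 2 * D + 81) (by omega) (by omega)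
    fun w hw => (hd 0 w _ (by omega) hw).trans (by norm_num)
  have hsh : h ∈ Short d n := ⟨hn, z, (hd 0 z _ (by omega) hz).trans (by norm_num)⟩
  obtain ⟨p', q', h1, h2, h3⟩ := S.hm.mid_cut hz hA (by omega)
  have key : ∀ g, Disp d D g p q → g * h * g⁻¹ = h := by
    intro g hg
    refine S.conj_fix hsh ?_
    have hw : ∀ w, Mid d 0 (m - A) p w q → d w (g * h * g⁻¹ * w) ≤ 11000 := by
      intro w hw
      have a1 := S.hm.mid_move (S.hm.Disp_inv hg) hw (by omega)
      have a2 := hd _ _ _ (by omega) a1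
      have a3 := S.hm.inv g (g⁻¹ * w) (h * (g⁻¹ * w))
      rw [mul_inv_cancel_left] at a3
      rw [show g * h * g⁻¹ * w = g * (h * (g⁻¹ * w)) by group, a3]
      omega
    have hw' : ∀ w, Mid d 0 (m - A) p w q → d w (h * w) ≤ 11000 := fun w hw =>
      (hd 0 w _ (by omega) hw).trans (by norm_num)
    exact S.thin.comm _ _ p' q' z (hw p' h1) (hw q' h2) (hw' p' h1) (hw' q' h2) h3.bt h3.left
      h3.right
  have hu' : Commute u h := mul_inv_eq_iff_eq_mul.1 (key u hu)
  have hv' : Commute v h := mul_inv_eq_iff_eq_mul.1 (key v hv)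
  have huv : u * v = v * u * h := by rw [hh, mul_inv_cancel_left]
  have hpow : ∀ k : ℕ, u ^ k * v = v * u ^ k * h ^ k := by
    intro k
    induction k with
    | zero => simp
    | succ k ih =>
      have h1 := (hu'.symm.pow_left k).eq
      rw [pow_succ' u, mul_assoc, ih, pow_succ' h]
      calc u * (v * u ^ k * h ^ k) = u * v * (u ^ k * h ^ k) := by group
        _ = v * u * (h * u ^ k) * h ^ k := by rw [huv]; group
        _ = v * u * (u ^ k * h) * h ^ k := by rw [(hu'.pow_left k).eq]
        _ = _ := by group
  refine hn (S.low' (B := 340) fun k => ⟨k, le_rfl, z, ?_⟩)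
  have n1 := S.hm.nn z (v * z)
  have n2 := S.hm.nn z (u ^ k * z)
  obtain ⟨K, hK⟩ := S.exists_mid hn hax (2 * (d z (v * z) + d z (u ^ k * z)) + 281)
  have c1 := (S.hm.comm_disp (hu'.pow_left k) z K).mono
    (D' := d z (v * z) + d z (u ^ k * z)) (by omega)
  have c2 := (S.hm.comm_disp hv' z K).mono
    (D' := d z (v * z) + d z (u ^ k * z)) (by omega)
  have h4 := S.hm.comm_close c1 c2 hK (by omega)
  rw [hpow, mul_assoc (v * u ^ k), S.hm.symm, S.hm.inv] at h4
  omega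

theorem abel {e g h : G} (he : e ∈ Short d n) (hg : Commute g e) (hh : Commute h e) :
    g * h = h * g := by
  obtain ⟨z, hz⟩ := S.exists_axis he
  have n1 := S.hm.nn z (g * z)
  have n2 := S.hm.nn z (h * z)
  obtain ⟨K, hK⟩ := S.exists_mid he.1 hz (3 * (d z (g * z) + d z (h * z)) + A + 2000)
  obtain ⟨y, hy, -⟩ := S.hm.mid_exact hK
  exact S.comm_mid (by omega)
    ((S.hm.comm_disp hg z K).mono (D' := d z (g * z) + d z (h * z)) (by omega))
    ((S.hm.comm_disp hh z K).mono (by omega)) hy (by omega)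

/-- Representatives, closed under conjugation, of the short elements. -/
theorem exists_reps : ∃ I ⊆ Short d n, (∀ g e, e ∈ I → g * e * g⁻¹ ∈ I) ∧
    (∀ u ∈ Short d n, ∃ e ∈ I, u * e = e * u) ∧
    ∀ e ∈ I, ∀ f ∈ I, e * f = f * e → e = f := by
  let r : Setoid (Short d n) :=
    { r := fun u v => ∃ g : G, Commute (g * u * g⁻¹) (v : G)
      iseqv :=
        { refl := fun u => ⟨1, by simp⟩
          symm := by
            rintro u v ⟨g, hg⟩
            refine ⟨g⁻¹, ?_⟩
            have h1 : Commute _ _ := (hg.map (MulAut.conj g⁻¹).toMonoidHom).symm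
            simpa [mul_assoc] using h1
          trans := by
            rintro u v w ⟨g, hg⟩ ⟨h, hh⟩
            refine ⟨h * g, ?_⟩
            have h1 : Commute _ _ := hg.map (MulAut.conj h).toMonoidHom
            exact S.abel (S.conj_short v.2 h) (by simpa [mul_assoc] using h1) hh.symm } }
  refine ⟨{e | ∃ u : Short d n, ∃ g : G, e = g * (Quotient.mk r u).out * g⁻¹}, ?_, ?_, ?_, ?_⟩
  · rintro e ⟨u, g, rfl⟩
    exact S.conj_short (Quotient.mk r u).out.2 g
  · rintro g e ⟨u, h, rfl⟩
    exact ⟨u, g * h, by group⟩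
  · intro u hu
    obtain ⟨g, hg⟩ := Quotient.mk_out (s := r) ⟨u, hu⟩
    exact ⟨_, ⟨⟨u, hu⟩, g, rfl⟩, hg.symm⟩
  · rintro e ⟨u, g, rfl⟩ f ⟨v, h, rfl⟩ hef
    have h1 : Quotient.mk r u = Quotient.mk r v := by
      rw [← Quotient.out_eq (Quotient.mk r u), ← Quotient.out_eq (Quotient.mk r v)]
      refine Quotient.sound ⟨h⁻¹ * g, ?_⟩
      have h2 : Commute _ _ := Commute.map (show Commute _ _ from hef)
        (MulAut.conj h⁻¹).toMonoidHom
      simpa [mul_assoc] using h2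
    rw [h1] at hef ⊢
    set w : G := (Quotient.mk r v).out.1
    have h3 := S.conj_fix (S.conj_short (Quotient.mk r v).out.2 h) (g := g * h⁻¹)
      (by rw [show g * h⁻¹ * (h * w * h⁻¹) * (g * h⁻¹)⁻¹ = g * w * g⁻¹ by group]; exact hef)
    rw [← h3]; group; rfl

theorem ax_of_min {g x : G} (h : ∀ y, d x (g * x) ≤ d y (g * y)) (ha : 260 < d x (g * x)) :
    Ax d 80 g x := by
  obtain ⟨w, h1, h2⟩ := S.hm.geo x (g * x) (d x (g * x) / 2) (by omega) (by omega)
  have h3 := h w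
  have s1 := S.hm.inv g x (g * x)
  have s2 := S.hm.inv g x w
  have s3 := S.hm.inv g w (g * x)
  have e := S.hm.hyp w x (g * (g * x)) (g * x)
  have e2 := S.hm.hyp (g * w) (g * x) w (g * (g * x))
  refine S.hm.local_global (e := 40) ?_ (by omega)
  rw [pow_two, mul_assoc]
  have y1 := S.hm.symm w x
  have y2 := S.hm.symm w (g * w)
  have y3 := S.hm.symm (g * x) w
  have y5 := S.hm.symm (g * x) (g * w)
  have y4 := S.hm.symm (g * x) (g * (g * x))
  omega

theorem line_ax {u p q : G} {D : ℤ} (hu : u ≠ 1) (hD : 0 ≤ D) (h : Disp d D u p q) :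
    (∀ z, Mid d 0 (3 * D + (A + 1000)) p z q → Ax d 180 u z) ∨
      u ∈ Short d n ∧ ∀ z, Mid d 0 (3 * D + (A + 1000)) p z q → z ∈ axis d u := by
  have hA := S.A_nn
  by_cases hex : ∃ z, Mid d 0 (3 * D + (A + 1000)) p z q ∧ d z (u * z) ≤ 180
  · obtain ⟨z, hz, hd⟩ := hex
    have h1 : ∀ w, Mid d 0 (D + 41) p w q → d w (u * w) ≤ 260 := fun w hw => by
      have := S.hm.disp_const h hw (hz.mono le_rfl (by omega)) (by omega)
      omega
    have h2 : ∀ w, Mid d 0 (3 * D + (A + 1000)) p w q → w ∈ axis d u ∧ u ^ n ≠ 1 := fun w hw =>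
      S.mid_sup hu hw (B := D + 41) (by omega) (by omega)
        fun y hy => (h1 y hy).trans (by norm_num)
    exact Or.inr ⟨⟨(h2 z hz).2, z, h1 z (hz.mono le_rfl (by omega))⟩, fun w hw => (h2 w hw).1⟩
  · push Not at hex
    exact Or.inl fun z hz => S.hm.ax_of_long h hz (by omega) (by have := hex z hz; omega)

theorem lines {I : Set G} (hI : I ⊆ Short d n) (hconj : ∀ g e, e ∈ I → g * e * g⁻¹ ∈ I)
    (heq : ∀ e ∈ I, ∀ f ∈ I, e * f = f * e → e = f) {N0 c0 : ℤ} (hT : 0 < T)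
    (hN : T * N0 ≤ n) (hc : 2 * A + 2 ≤ c0) : Lines d n I (fun _ => n) N0 c0 where
  hm := S.hm
  conj := hconj
  ν_conj _ _ _ := rfl
  ν_dvd _ _ := dvd_rfl
  pow_ne e he := (hI he).1
  far e he := ⟨T, (S.low e).resolve_left (hI he).1⟩
  abel e he g h hg hh := S.abel (hI he) hg hh
  ne e he := S.exists_axis (hI he)
  mid e he p hp := ⟨A, fun K z hz => S.axis_mid (hI he)
    ((S.axis_disp (hI he) hp).trans (by norm_num)) hz⟩
  spin e he g hg hn y hy := by
    have h1 := (S.low g).resolve_left hn y n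
    exact le_of_mul_le_mul_left (hN.trans h1) hT
  ov e he f hf hef p hp q hq p' hp' q' hq' h1 h2 := by
    by_contra! hlt
    have hA := S.A_nn
    obtain ⟨z, hz, hz'⟩ := S.hm.geo p q A hA (by omega)
    have a1 := S.axis_disp (hI he) hp
    have a2 := S.axis_disp (hI he) hq
    have key : ∀ x y, y ∈ axis d f → d x y ≤ 4500 → d x (f * x) ≤ 11000 := by
      intro x y hy hxy
      have b1 := S.axis_disp (hI hf) hy
      have b2 := S.hm.tri x y (f * x)
      have b3 := S.hm.tri y (f * y) (f * x)
      rw [S.hm.inv, S.hm.symm y x] at b3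
      omega
    exact hef (heq e he f hf (S.thin.comm e f p q z (by omega) (by omega) (key p p' hp' h1)
      (key q q' hq' h2) (by unfold Bt; omega) hz.ge (by omega)))

/-- The family of axes of representatives of short elements. -/
theorem famX {I : Set G} (hI : I ⊆ Short d n)
    (hex : ∀ u ∈ Short d n, ∃ e ∈ I, u * e = e * u) {N0 c0 c : ℤ}
    (L : Lines d n I (fun _ => n) N0 c0) (h1 : 10000 ≤ c) (h2 : c0 ≤ c) (hN : 800 * c ≤ N0) :
    @FamX G I _ (conjAct L.conj) d (fun e => axis d e.1) (fun e => rotG (fun _ => n) e.1)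
      (fun e => lenR d (fun _ => n) e.1) (fun e y y' => bus d e.1 y y') n c N0 3 (A + 1000) := by
  have hA := S.A_nn
  refine L.famX h1 h2 hN (by norm_num) (by omega) ?_ ?_ ?_
  · intro g x hx
    by_cases hn : g ^ n = 1
    · exact Or.inl hn
    by_cases ha : d x (g * x) ≤ 260
    · exact Or.inr (Or.inl (hex g ⟨hn, x, ha⟩))
    · exact Or.inr (Or.inr ((S.ax_of_min hx (by omega)).mono (by omega)))
  · intro u p q D hu hD hp hq
    rcases S.line_ax hu hD ⟨hp, hq⟩ with h | ⟨hs, h⟩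
    · exact Or.inl fun z hz hl hr => (h z ⟨hz, hl, hr⟩).mono (by omega)
    · obtain ⟨e, he, hue⟩ := hex u hs
      refine Or.inr ⟨e, he, hue, fun z hz hl hr => ?_⟩
      obtain ⟨y, hy, hzy⟩ := S.near hs (hI he) hue.symm (h z ⟨hz, hl, hr⟩)
      exact ⟨y, hy, by omega⟩
  · intro u v p q z D hD hp hq hp' hq' hz hl hr
    exact S.comm_mid hD ⟨hp, hq⟩ ⟨hp', hq'⟩ ⟨hz, hl, hr⟩ (by omega)

end Stage
end PG

namespace PG

theorem FamX.stage {G ι : Type} [Group G] [MulAction G ι] {d : G → G → ℤ} {Y : ι → Set G}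
    {R : ι → Subgroup G} {N : ι → ℤ} {t : ι → G → G → ℤ} {n : ℕ}
    (F : FamX d Y R N t n 10000000000000 (10 ^ 24) 3 727768) {Q : Type} [Group Q] {π : G →* Q}
    (hπ : IsQuo π R) (hn : Odd n) :
    Stage (quoD π d Y 1000000000000000) n 200000000000000000 726768 where
  hm := F.quo_HM (by norm_num) hπ (by norm_num)
  low := by
    have h := F.quo_low (M := 1000000000000000) (by norm_num) hπ (by norm_num)
    rwa [show (200 * 1000000000000000 : ℤ) = 200000000000000000 by norm_num] at h
  thin := F.quo_thin (by norm_num) hπ (by norm_num) (by norm_num) (by norm_num) (by norm_num)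
    hn.pos
  odd := hn
  A_nn := by norm_num

theorem isQuo_mk {G ι : Type} [Group G] {R : ι → Subgroup G} (h : (⨆ i, R i).Normal) :
    IsQuo (QuotientGroup.mk' (⨆ i, R i)) R where
  surj := QuotientGroup.mk'_surjective _
  ker g := by rw [← MonoidHom.mem_ker, QuotientGroup.ker_mk']

/-- Killing the `n`-th powers of the short elements gives a stage with a smaller metric. -/
theorem Stage.next {G : Type} [Group G] {d : G → G → ℤ} {n : ℕ}
    (S : Stage d n 200000000000000000 726768) (hn : 2 * 10 ^ 41 ≤ n) :
    ∃ (K : Subgroup G) (_ : K.Normal) (d' : G ⧸ K → G ⧸ K → ℤ),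
      Stage d' n 200000000000000000 726768 ∧
      (∀ x y : G, 1000000000000000 * d' x y ≤ d x y + 1000000000000000) ∧ (∀ u ∈ Short d n, u ^ n ∈ K) ∧
      (∀ k ∈ K, k ≠ 1 → ∀ x, 10 ^ 23 ≤ d x (k * x)) ∧
      ∀ N : Subgroup G, (∀ g, g ^ n ∈ N) → K ≤ N := by
  obtain ⟨I, hI, hconj, hex, heq⟩ := S.exists_reps
  have L := S.lines hI hconj heq (N0 := 10 ^ 24) (c0 := 10000000000000) (by norm_num) (by
    have : ((2 * 10 ^ 41 : ℕ) : ℤ) ≤ n := Int.ofNat_le.2 hn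
    push_cast at this
    linarith) (by norm_num)
  let _ := conjAct L.conj
  have F := S.famX hI hex L (c := 10000000000000) (by norm_num) le_rfl (by norm_num)
  have hF := F.normal
  have hπ := isQuo_mk hF
  refine ⟨_, hF, _, F.stage hπ S.odd, fun x y => ?_, fun u hu => ?_, fun k hk h1 x => ?_, fun N hN => ?_⟩
  · have h1 := F.cone_le (M := 1000000000000000) (by norm_num) x y
    have h2 := F.quo_le (M := 1000000000000000) (by norm_num) hπ x y
    have h3 : quoD (QuotientGroup.mk' _) d _ 1000000000000000 (x : G ⧸ _) (y : G ⧸ _) ≤ _ := h2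
    linarith
  · obtain ⟨e, he, hue⟩ := hex u hu
    exact Subgroup.mem_iSup_of_mem (⟨e, he⟩ : I) (Subgroup.subset_closure ⟨u, hue, rfl⟩)
  · exact le_trans (by norm_num) (F.kernel_far x k hk h1)
  · refine iSup_le fun e => (Subgroup.closure_le _).2 ?_
    rintro _ ⟨u, -, rfl⟩
    exact hN u

end PG

namespace PG

/-- A quotient of `G` with the metric of a stage. -/
structure Tower (G : Type) [Group G] (n : ℕ) where
  carrier : Type
  [grp : Group carrier]
  φ : G →* carrier
  surj : Function.Surjective φ
  d : carrier → carrier → ℤ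
  stage : Stage d n 200000000000000000 726768

attribute [instance] Tower.grp

theorem Tower.exists_next {G : Type} [Group G] {n : ℕ} (hn : 2 * 10 ^ 41 ≤ n) (X : Tower G n) :
    ∃ X' : Tower G n, (∀ g, X.φ g = 1 → X'.φ g = 1) ∧
      (∀ g, 1000000000000000 * X'.d 1 (X'.φ g) ≤ X.d 1 (X.φ g) + 1000000000000000) ∧
      (∀ g, X.d 1 (X.φ g) ≤ 260 → X'.φ g ^ n = 1) ∧
      (∀ g, X.φ g ≠ 1 → X.d 1 (X.φ g) ≤ 10 ^ 15 → X'.φ g ≠ 1) ∧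
      ∀ N : Subgroup G, (∀ g, g ^ n ∈ N) → X.φ.ker ≤ N → X'.φ.ker ≤ N := by
  obtain ⟨K, hK, d', hS, h1, h2, h3, h4⟩ := X.stage.next hn
  refine ⟨⟨X.carrier ⧸ K, (QuotientGroup.mk' K).comp X.φ,
    (QuotientGroup.mk'_surjective K).comp X.surj, d', hS⟩, fun g hg => ?_, fun g => ?_,
    fun g hg => ?_, fun g hg hd h => ?_, fun N hN hX g hg => ?_⟩
  · simp [hg]
  · exact h1 1 (X.φ g)
  · by_cases hp : X.φ g ^ n = 1
    · change QuotientGroup.mk' K (X.φ g) ^ n = 1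
      rw [← map_pow, hp, map_one]
    · change QuotientGroup.mk' K (X.φ g) ^ n = 1
      rw [← map_pow, QuotientGroup.mk'_apply, QuotientGroup.eq_one_iff]
      exact h2 _ ⟨hp, 1, by rwa [mul_one]⟩
  · have h4 : X.φ g ∈ K := (QuotientGroup.eq_one_iff _).1 h
    have h5 := h3 _ h4 hg 1
    rw [mul_one] at h5
    omega
  · have h5 : X.φ g ∈ K := (QuotientGroup.eq_one_iff _).1 hg
    obtain ⟨g', hg', h6⟩ := h4 (N.map X.φ) (fun u => by
      obtain ⟨v, rfl⟩ := X.surj u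
      exact ⟨v ^ n, hN v, map_pow _ _ _⟩) h5
    have h7 : g'⁻¹ * g ∈ X.φ.ker := by
      rw [MonoidHom.mem_ker, map_mul, map_inv, h6, inv_mul_cancel]
    have h8 := N.mul_mem hg' (hX h7)
    rwa [mul_inv_cancel_left] at h8

/-- A stage has an `n`-periodic quotient in which short nontrivial elements survive. -/
theorem Stage.limit {G : Type} [Group G] {d : G → G → ℤ} {n : ℕ}
    (S : Stage d n 200000000000000000 726768) (hn : 2 * 10 ^ 41 ≤ n) :
    ∃ K : Subgroup G, K.Normal ∧ (∀ g, g ^ n ∈ K) ∧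
      (∀ g, g ≠ 1 → d 1 g ≤ 10 ^ 15 → g ∉ K) ∧ ∀ N : Subgroup G, (∀ g, g ^ n ∈ N) → K ≤ N := by
  choose f f1 f2 f3 f4 f5 using Tower.exists_next (G := G) hn
  obtain ⟨X, h0, hX⟩ : ∃ X : ℕ → Tower G n, X 0 = ⟨G, MonoidHom.id G, Function.surjective_id, d, S⟩ ∧
      ∀ m, X (m + 1) = f (X m) :=
    ⟨fun m => Nat.rec ⟨G, MonoidHom.id G, Function.surjective_id, d, S⟩ (fun _ Y => f Y) m, rfl, fun _ => rfl⟩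
  have mono : Monotone fun m : ℕ => (X m).φ.ker := monotone_nat_of_le_succ fun m g hg => by
    show (X (m + 1)).φ g = 1
    rw [hX]
    exact f1 _ g hg
  refine ⟨⨆ m : ℕ, (X m).φ.ker, ?_, fun g => ?_, fun g h1 hd hg => ?_, fun N hN => iSup_le fun m => ?_⟩
  · exact Subgroup.iSup_normal _
  · have key : ∀ B : ℕ, ∀ m, (X m).d 1 ((X m).φ g) ≤ B → ∃ m', (X m').d 1 ((X m').φ g) ≤ 260 := by
      intro B
      induction B using Nat.strong_induction_on with
      | _ B ih =>
        intro m hm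
        by_cases hB : B ≤ 260
        · exact ⟨m, by omega⟩
        · have h2 := f2 (X m) g
          rw [← hX] at h2
          exact ih (B - 1) (by omega) (m + 1) (by omega)
    obtain ⟨m, hm⟩ := key ((X 0).d 1 ((X 0).φ g)).toNat 0 (Int.self_le_toNat _)
    have h3 := f3 (X m) g hm
    rw [← hX, ← map_pow] at h3
    exact Subgroup.mem_iSup_of_mem (m + 1) h3
  · rw [Subgroup.mem_iSup_of_directed mono.directed_le] at hg
    obtain ⟨m, hm⟩ := hg
    have key : ∀ m, (X m).φ g ≠ 1 ∧ (X m).d 1 ((X m).φ g) ≤ 10 ^ 15 := by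
      intro m
      induction m with
      | zero =>
        rw [h0]
        exact ⟨h1, hd⟩
      | succ m ih =>
        have h2 := f2 (X m) g
        rw [hX]
        exact ⟨f4 _ g ih.1 ih.2, by omega⟩
    exact (key m).1 hm
  · induction m with
    | zero =>
      rw [h0]
      intro g hg
      rw [show g = 1 from hg]
      exact N.one_mem
    | succ m ih =>
      rw [hX]
      exact f5 _ N hN ih

end PG

namespace PG

/-- The length of the longest common prefix. -/
def cpl {β : Type*} [DecidableEq β] : List β → List β → ℕ
  | a :: l, b :: m => if a = b then cpl l m + 1 else 0
  | _, _ => 0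

section
variable {β : Type*} [DecidableEq β]

theorem cpl_nil_left (l : List β) : cpl [] l = 0 := by simp [cpl]

theorem cpl_nil_right (l : List β) : cpl l [] = 0 := by cases l <;> simp [cpl]

theorem cpl_comm (l m : List β) : cpl l m = cpl m l := by
  induction l generalizing m with
  | nil => rw [cpl_nil_left, cpl_nil_right]
  | cons a l ih =>
    cases m with
    | nil => simp [cpl]
    | cons b m => simp only [cpl, ih m, eq_comm]

theorem cpl_ultra (l m k : List β) : min (cpl l m) (cpl m k) ≤ cpl l k := by
  induction l generalizing m k with
  | nil => simp [cpl]
  | cons a l ih =>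
    cases m with
    | nil => simp [cpl]
    | cons b m =>
      cases k with
      | nil => simp [cpl]
      | cons e k =>
        have := ih m k
        simp only [cpl]
        split_ifs with h1 h2 h3 h3 <;> first | omega | exact absurd (h1.trans h2) h3

end

variable {α : Type} [DecidableEq α]

theorem isReduced_invRev {l : List (α × Bool)} (h : FreeGroup.IsReduced l) :
    FreeGroup.IsReduced (FreeGroup.invRev l) := by
  rw [FreeGroup.isReduced_iff_reduce_eq] at h ⊢
  rw [FreeGroup.reduce_invRev, h]

theorem norm_mk_of_isReduced {l : List (α × Bool)} (h : FreeGroup.IsReduced l) :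
    (FreeGroup.mk l).norm = l.length := by
  rw [FreeGroup.norm, FreeGroup.toWord_mk, h.reduce_eq]

theorem norm_inv_mul_mk {l m : List (α × Bool)} (hl : FreeGroup.IsReduced l)
    (hm : FreeGroup.IsReduced m) :
    (((FreeGroup.mk l)⁻¹ * FreeGroup.mk m).norm : ℤ) = l.length + m.length - 2 * cpl l m := by
  induction l generalizing m with
  | nil =>
    rw [cpl_nil_left, ← FreeGroup.one_eq_mk, inv_one, one_mul, norm_mk_of_isReduced hm]
    simp
  | cons a l ih =>
    cases m with
    | nil =>
      rw [cpl_nil_right, ← FreeGroup.one_eq_mk, mul_one, FreeGroup.norm_inv_eq,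
        norm_mk_of_isReduced hl]
      simp
    | cons b m =>
      by_cases hab : a = b
      · subst hab
        have h1 : (FreeGroup.mk (a :: l))⁻¹ * FreeGroup.mk (a :: m) =
            (FreeGroup.mk l)⁻¹ * FreeGroup.mk m := by
          rw [← List.singleton_append, ← List.singleton_append (l := m), ← FreeGroup.mul_mk,
            ← FreeGroup.mul_mk]
          group
        rw [h1, ih (m := m) hl.tail hm.tail]
        simp only [cpl, if_true, List.length_cons]
        push_cast
        ring
      · have h1 : FreeGroup.IsReduced (FreeGroup.invRev (a :: l) ++ b :: m) := by
          refine List.isChain_append.2 ⟨isReduced_invRev hl, hm, ?_⟩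
          intro x hx y hy
          simp only [FreeGroup.invRev, List.map_cons, List.reverse_cons, List.getLast?_append,
            List.getLast?_singleton, Option.some_or, Option.mem_def, Option.some.injEq,
            List.head?_cons] at hx hy
          subst hx hy
          intro h2
          simp only at h2 ⊢
          by_contra h3
          exact hab (Prod.ext h2 (by simpa using h3))
        rw [FreeGroup.inv_mk, FreeGroup.mul_mk, norm_mk_of_isReduced h1]
        simp [cpl, hab, FreeGroup.invRev_length]

/-- The word metric of a free group. -/
def wd (x y : FreeGroup α) : ℤ := ((x⁻¹ * y).norm : ℤ)

theorem wd_eq (x y : FreeGroup α) :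
    wd x y = x.toWord.length + y.toWord.length - 2 * cpl x.toWord y.toWord := by
  rw [← norm_inv_mul_mk FreeGroup.isReduced_toWord FreeGroup.isReduced_toWord,
    FreeGroup.mk_toWord, FreeGroup.mk_toWord, wd]

theorem wd_HM : HM (wd (α := α)) 0 where
  self x := by simp [wd]
  eq_of x y h := by
    rw [wd, Int.natCast_eq_zero, FreeGroup.norm_eq_zero, inv_mul_eq_one] at h
    exact h
  symm x y := by
    rw [wd_eq, wd_eq, cpl_comm]
    ring
  tri x y z := by
    have h := FreeGroup.norm_mul_le (x⁻¹ * y) (y⁻¹ * z)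
    rw [show x⁻¹ * y * (y⁻¹ * z) = x⁻¹ * z by group] at h
    simp only [wd]
    exact_mod_cast h
  inv g x y := by simp only [wd]; congr 2; group
  geo x y t h0 ht := by
    set w := (x⁻¹ * y).toWord with hw
    have hr : FreeGroup.IsReduced w := FreeGroup.isReduced_toWord
    have hl : wd x y = w.length := rfl
    have h1 : FreeGroup.IsReduced (w.take t.toNat) := List.IsChain.take hr _
    have h2 : FreeGroup.IsReduced (w.drop t.toNat) := List.IsChain.drop hr _
    have h3 : x⁻¹ * y = FreeGroup.mk (w.take t.toNat) * FreeGroup.mk (w.drop t.toNat) := by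
      rw [FreeGroup.mul_mk, List.take_append_drop, hw, FreeGroup.mk_toWord]
    refine ⟨x * FreeGroup.mk (w.take t.toNat), ?_, ?_⟩
    · rw [wd, inv_mul_cancel_left, norm_mk_of_isReduced h1, List.length_take]
      omega
    · rw [wd, mul_inv_rev, mul_assoc, h3, inv_mul_cancel_left, norm_mk_of_isReduced h2,
        List.length_drop]
      omega
  hyp x y z w := by
    simp only [wd_eq]
    have h1 := cpl_ultra x.toWord y.toWord z.toWord
    have h2 := cpl_ultra x.toWord w.toWord z.toWord
    have h3 := cpl_ultra y.toWord x.toWord w.toWord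
    have h4 := cpl_ultra y.toWord z.toWord w.toWord
    have h5 := cpl_ultra x.toWord z.toWord y.toWord
    have h6 := cpl_ultra x.toWord w.toWord y.toWord
    have h7 := cpl_ultra z.toWord x.toWord w.toWord
    have h8 := cpl_ultra z.toWord y.toWord w.toWord
    have c1 := cpl_comm x.toWord y.toWord
    have c2 := cpl_comm x.toWord z.toWord
    have c3 := cpl_comm x.toWord w.toWord
    have c4 := cpl_comm y.toWord z.toWord
    have c5 := cpl_comm y.toWord w.toWord
    have c6 := cpl_comm z.toWord w.toWord
    omega

end PG

namespace PG

/-- A family of periodic bi-infinite words which are recognized by their windows of length `L`. -/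
structure Words {α T : Type} (a : T → ℤ → α) (len L : ℤ) : Prop where
  per : ∀ t k, a t (k + len) = a t k
  uniq : ∀ t s k l, (∀ i, 0 ≤ i → i ≤ L → a t (k + i) = a s (l + i)) → t = s ∧ len ∣ k - l

section
variable {α : Type} (Q : ℤ) (x : α) (b : ℕ → α)

/-- The letter at the position `r` of the block `u`. -/
def blk (j : ℕ) (u r : ℤ) : α :=
  if r = 0 ∧ u % Q = 0 then b (j + 1)
  else if r = 0 ∨ r = 1 ∨ r = 3 ∨ r = u % Q + 10 then b j else x

/-- A periodic word made of blocks of length `2 * Q`. -/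
def ltr (j : ℕ) (k : ℤ) : α := blk Q x b j (k / (2 * Q)) (k % (2 * Q))

/-- The words `ltr` and their mirror images. -/
def ltr₂ (t : ℕ × Bool) (k : ℤ) : α := if t.2 then ltr Q x b t.1 (-k) else ltr Q x b t.1 k

variable {Q x b}

theorem ltr_eq (j : ℕ) (u : ℤ) {r : ℤ} (h0 : 0 ≤ r) (h1 : r < 2 * Q) :
    ltr Q x b j (2 * Q * u + r) = blk Q x b j u r := by
  rw [ltr, Int.add_comm, Int.add_mul_ediv_left _ _ (by omega), Int.add_mul_emod_self_left,
    Int.ediv_eq_zero_of_lt h0 h1, Int.emod_eq_of_lt h0 h1, zero_add]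

theorem ltr_decomp (hQ : 0 < Q) (k : ℤ) : ∃ u r, k = 2 * Q * u + r ∧ 0 ≤ r ∧ r < 2 * Q :=
  ⟨k / (2 * Q), k % (2 * Q), (Int.mul_ediv_add_emod k (2 * Q)).symm,
    Int.emod_nonneg _ (by omega), Int.emod_lt_of_pos _ (by omega)⟩

variable (hx : ∀ j, x ≠ b j)
include hx

theorem blk_ne {j : ℕ} {u r : ℤ} :
    blk Q x b j u r ≠ x ↔ r = 0 ∨ r = 1 ∨ r = 3 ∨ r = u % Q + 10 := by
  unfold blk
  split_ifs with h1 h2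
  · exact ⟨fun _ => .inl h1.1, fun _ => (hx _).symm⟩
  · exact ⟨fun _ => h2, fun _ => (hx _).symm⟩
  · exact ⟨fun h => absurd rfl h, fun h => absurd h h2⟩

theorem ltr_uniq (hb : Function.Injective b) (hQ : 20 ≤ Q) {j j' : ℕ} {k l : ℤ}
    (h : ∀ i, 0 ≤ i → i ≤ 4 * Q → ltr Q x b j (k + i) = ltr Q x b j' (l + i)) :
    j = j' ∧ 2 * Q * Q ∣ k - l := by
  obtain ⟨u, s, rfl, hs0, hs1⟩ := ltr_decomp (show 0 < Q by omega) k
  obtain ⟨v, r, hv, hr0, hr1⟩ := ltr_decomp (show 0 < Q by omega) (l + (2 * Q - s))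
  obtain rfl : l = 2 * Q * v + r - (2 * Q - s) := by omega
  have key : ∀ i, 0 ≤ i → i < 2 * Q →
      blk Q x b j (u + 1) i = ltr Q x b j' (2 * Q * v + (r + i)) := fun i h0 h1 => by
    rw [← ltr_eq j (u + 1) h0 h1]
    convert h (2 * Q - s + i) (by omega) (by omega) using 2 <;> ring
  have e0 := Int.emod_nonneg v (show Q ≠ 0 by omega)
  have e1 := Int.emod_lt_of_pos v (show 0 < Q by omega)
  have e2 := Int.emod_nonneg (u + 1) (show Q ≠ 0 by omega)
  have e3 := Int.emod_lt_of_pos (u + 1) (show 0 < Q by omega)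
  have k0 := key 0 le_rfl (by omega)
  rw [ltr_eq _ _ (by omega) (by omega)] at k0
  have m0 := (blk_ne hx).1 (k0 ▸ (blk_ne hx).2 (.inl rfl) : blk Q x b j' v (r + 0) ≠ x)
  have k1 := key 1 (by omega) (by omega)
  rw [ltr_eq _ _ (by omega) (by omega)] at k1
  have m1 := (blk_ne hx).1 (k1 ▸ (blk_ne hx).2 (.inr (.inl rfl)) : blk Q x b j' v (r + 1) ≠ x)
  obtain rfl : r = 0 := by omega
  have k2 := key ((u + 1) % Q + 10) (by omega) (by omega)
  rw [ltr_eq _ _ (by omega) (by omega)] at k2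
  have m2 := (blk_ne hx).1 (k2 ▸ (blk_ne hx).2 (.inr (.inr (.inr rfl))) :
    blk Q x b j' v (0 + ((u + 1) % Q + 10)) ≠ x)
  refine ⟨hb ?_, ?_⟩
  · simpa [blk] using k1
  · have h3 : (u + 1) % Q = v % Q := by omega
    have h4 : Q ∣ (u + 1) - v := Int.ModEq.dvd (show v ≡ u + 1 [ZMOD Q] from h3.symm)
    obtain ⟨w, hw⟩ := h4
    exact ⟨w, by linear_combination 2 * Q * hw⟩

theorem ltr_mirror (hQ : 20 ≤ Q) {j j' : ℕ} {k l : ℤ}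
    (h : ∀ i, 0 ≤ i → i ≤ 4 * Q → ltr Q x b j (k + i) = ltr Q x b j' (-(l + i))) : False := by
  obtain ⟨u, s, rfl, hs0, hs1⟩ := ltr_decomp (show 0 < Q by omega) k
  obtain ⟨v, r, hv, hr0, hr1⟩ := ltr_decomp (show 0 < Q by omega) (-(l + (2 * Q - s)))
  obtain rfl : l = -(2 * Q * v + r) - (2 * Q - s) := by omega
  have key : ∀ i, 0 ≤ i → i < 2 * Q →
      blk Q x b j (u + 1) i = ltr Q x b j' (2 * Q * v + (r - i)) := fun i h0 h1 => by
    rw [← ltr_eq j (u + 1) h0 h1]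
    convert h (2 * Q - s + i) (by omega) (by omega) using 2 <;> ring
  have e0 := Int.emod_nonneg v (show Q ≠ 0 by omega)
  have e1 := Int.emod_lt_of_pos v (show 0 < Q by omega)
  have e2 := Int.emod_nonneg (v - 1) (show Q ≠ 0 by omega)
  have e3 := Int.emod_lt_of_pos (v - 1) (show 0 < Q by omega)
  have shift : ∀ i, r < i → i ≤ 3 → 2 * Q * v + (r - i) = 2 * Q * (v - 1) + (2 * Q + r - i) :=
    fun i _ _ => by ring
  have k0 := key 0 le_rfl (by omega)
  rw [ltr_eq _ _ (by omega) (by omega)] at k0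
  have m0 := (blk_ne hx).1 (k0 ▸ (blk_ne hx).2 (.inl rfl) : blk Q x b j' v (r - 0) ≠ x)
  have k1 := key 1 (by omega) (by omega)
  have m1 := (blk_ne (Q := Q) (u := u + 1) (j := j) hx).2 (.inr (.inl rfl))
  have k3 := key 3 (by omega) (by omega)
  have m3 := (blk_ne (Q := Q) (u := u + 1) (j := j) hx).2 (.inr (.inr (.inl rfl)))
  rw [k1] at m1
  rw [k3] at m3
  by_cases hr : r = 0
  · rw [shift 1 (by omega) (by omega), ltr_eq _ _ (by omega) (by omega), blk_ne hx] at m1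
    omega
  · rw [ltr_eq _ _ (by omega) (by omega), blk_ne hx] at m1
    obtain rfl : r = 1 := by omega
    rw [shift 3 (by omega) (by omega), ltr_eq _ _ (by omega) (by omega), blk_ne hx] at m3
    omega

theorem ltr_words (hb : Function.Injective b) (hQ : 20 ≤ Q) :
    Words (ltr₂ Q x b) (2 * Q * Q) (4 * Q) where
  per := by
    have h : ∀ j k m, ltr Q x b j (k + m * (2 * Q * Q)) = ltr Q x b j k := fun j k m => by
      obtain ⟨u, r, rfl, h0, h1⟩ := ltr_decomp (show 0 < Q by omega) k
      rw [show 2 * Q * u + r + m * (2 * Q * Q) = 2 * Q * (u + Q * m) + r by ring, ltr_eq _ _ h0 h1,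
        ltr_eq _ _ h0 h1]
      simp only [blk, Int.add_mul_emod_self_left]
    intro t k
    unfold ltr₂
    split_ifs
    · rw [show -(k + 2 * Q * Q) = -k + -1 * (2 * Q * Q) by ring, h]
    · rw [← h t.1 k 1, one_mul]
  uniq := by
    rintro ⟨j, s⟩ ⟨j', s'⟩ k l h
    unfold ltr₂ at h
    cases s <;> cases s' <;> simp only [if_true, Bool.false_eq_true, if_false] at h
    · obtain ⟨rfl, h2⟩ := ltr_uniq hx hb hQ h
      exact ⟨rfl, h2⟩
    · exact (ltr_mirror hx hQ h).elim
    · refine (ltr_mirror hx hQ (k := l) (l := k) fun i h0 h1 => (h i h0 h1).symm).elim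
    · obtain ⟨rfl, h2⟩ := ltr_uniq hx hb hQ (k := -(k + 4 * Q)) (l := -(l + 4 * Q))
        (j := j) (j' := j') fun i h0 h1 => by
          convert h (4 * Q - i) (by omega) (by omega) using 2 <;> ring
      obtain ⟨w, hw⟩ := h2
      exact ⟨rfl, -w, by linear_combination -hw⟩

end

end PG

namespace PG

section
variable {G : Type} [Group G] {d : G → G → ℤ} (hm : HM d 0)
include hm

theorem HM.geodesic_unique {x y z z' : G} (h : Bt d 0 x z y) (h' : Bt d 0 x z' y)
    (hd : d x z = d x z') : z = z' := by
  have h1 := hm.close h h' (k := 0) (by rw [hd]; simp)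
  have h2 := hm.nn z z'
  exact hm.eq_of _ _ (by simpa using le_antisymm h1 h2)

theorem HM.exists_min (g : G) : ∃ x, ∀ y, d x (g * x) ≤ d y (g * y) := by
  refine ⟨Function.argmin (fun y => (d y (g * y)).toNat), fun y => ?_⟩
  have := Function.argmin_le (fun y => (d y (g * y)).toNat) y
  have := hm.nn y (g * y)
  omega

/-- In a tree, an element acts as a translation on the points which it moves least. -/
theorem HM.ax_of_min (par : ∀ x y z, 2 ∣ d x y + d y z + d x z)
    (tf : ∀ g : G, g ^ 2 = 1 → g = 1) {g x : G} (hg : g ≠ 1)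
    (hx : ∀ y, d x (g * x) ≤ d y (g * y)) : Ax d 0 g x := by
  have hne : 0 < d x (g * x) := by
    have := hm.nn x (g * x)
    by_contra h
    have := hm.eq_of x (g * x) (by omega)
    exact hg (by simpa using this.symm)
  refine hm.local_global (e := 0) ?_ (by simpa using hne)
  have e1 : d (g * x) (g ^ 2 * x) = d x (g * x) := by rw [pow_two, mul_assoc, hm.inv]
  obtain ⟨z, z1, z2⟩ := hm.geo x (g * x) (d x (g * x) / 2) (by omega) (by omega)
  have e2 : d (g * x) (g * z) = d x z := hm.inv _ _ _
  have e3 : d (g * z) (g ^ 2 * x) = d z (g * x) := by rw [pow_two, mul_assoc, hm.inv]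
  have h1 := hx z
  have h2 := hm.hyp x z (g * x) (g * z)
  have h3 := hm.hyp x (g * x) (g * z) (g ^ 2 * x)
  have h4 := par x (g * x) (g ^ 2 * x)
  have h5 := hm.nn x (g ^ 2 * x)
  have h6 : d x (g ^ 2 * x) ≠ 0 := fun h => hg (tf g (by simpa using (hm.eq_of _ _ h).symm))
  have h7 := hm.symm z (g * x)
  omega

theorem HM.comm_of_mid {u v p q z : G} {m D : ℤ} (hu : Disp d D u p q) (hv : Disp d D v p q)
    (hz : Mid d 0 m p z q) (h : 2 * D < m) : u * v = v * u := by
  have h1 := hm.comm_close hu hv hz (by simpa using h)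
  have h2 := hm.nn (u * v * z) (v * u * z)
  exact mul_right_cancel (hm.eq_of _ _ (by simpa using le_antisymm h1 h2))

theorem HM.ax_of_mid {u p q z : G} {m D : ℤ} (hu : Disp d D u p q) (h1 : u ≠ 1)
    (hz : Mid d 0 m p z q) (h : 2 * D < m) : Ax d 0 u z := by
  refine hm.ax_of_long hu hz (by simpa using h) ?_
  have h2 := hm.nn z (u * z)
  rcases h2.lt_or_eq with h3 | h3
  · simpa using h3
  · exact absurd (hm.eq_of _ _ h3.symm).symm (by simpa using h1)

variable (ax : ∀ g : G, g ≠ 1 → ∃ x, Ax d 0 g x)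
include ax

theorem HM.le_disp_pow {e : G} (he : e ≠ 1) (x : G) (j : ℕ) : (j : ℤ) ≤ d x (e ^ j * x) := by
  obtain ⟨z, hz⟩ := ax e he
  have h := hm.sup_disp (u := e ^ j) (x := x) (z := z) (c := 0) (fun k l => by
    rw [← pow_mul, ← pow_mul, ← pow_mul, mul_add]
    exact hz.sup _ _) le_rfl
  have := hz.low j
  omega

theorem HM.disp_conj_pow {e g : G} (h : g * e = e * g) (p : G) (K : ℕ) :
    Disp d (d p (g * p)) g ((e ^ K)⁻¹ * p) (e ^ K * p) := by
  have h1 : Commute g (e ^ K) := Commute.pow_right h K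
  constructor
  · rw [← mul_assoc, h1.inv_right.eq, mul_assoc, hm.inv]
  · rw [← mul_assoc, h1.eq, mul_assoc, hm.inv]

theorem HM.mid_pow {e p : G} (he : e ≠ 1) {c : ℤ}
    (hp : ∀ j k : ℕ, d p (e ^ j * p) + d p (e ^ k * p) ≤ d p (e ^ (j + k) * p) + c) (K : ℕ) :
    Mid d c K ((e ^ K)⁻¹ * p) p (e ^ K * p) := by
  have h := hp K K
  have h1 := hm.inv (e ^ K)⁻¹ p (e ^ K * p)
  have h2 := hm.inv (e ^ K) ((e ^ K)⁻¹ * p) (e ^ K * p)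
  rw [inv_mul_cancel_left] at h1
  rw [mul_inv_cancel_left, ← mul_assoc, ← pow_add] at h2
  have h3 := hm.le_disp_pow ax he p K
  refine ⟨?_, by omega, by omega⟩
  rw [Bt]
  omega

theorem HM.centralizer_abel {e g h : G} (he : e ≠ 1) (hg : g * e = e * g) (hh : h * e = e * h) :
    g * h = h * g := by
  obtain ⟨p, hp⟩ := ax e he
  set D := max (d p (g * p)) (d p (h * p)) with hD
  have h1 := hm.mid_pow ax he hp.sup (2 * D + 1).toNat
  have h2 := hm.disp_conj_pow ax hg p (2 * D + 1).toNat
  have h3 := hm.disp_conj_pow ax hh p (2 * D + 1).toNat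
  exact hm.comm_of_mid (D := D) (h2.mono (le_max_left _ _)) (h3.mono (le_max_right _ _)) h1
    (by omega)

theorem HM.mid_axis {e p : G} (he : e ≠ 1) (K : ℕ) (z : G)
    (hz : Mid d 0 (2 * d p (e * p) + 1) ((e ^ K)⁻¹ * p) z (e ^ K * p)) : z ∈ axis d e := by
  intro j k
  have := (hm.ax_of_mid (hm.disp_conj_pow ax rfl p K) he hz (by omega)).sup j k
  omega

end

end PG

namespace PG

theorem exists_line {G : Type} [Group G] (g : ℤ → G) :
    ∃ P : ℤ → G, P 0 = 1 ∧ ∀ k, P (k + 1) = P k * g k := by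
  let A : ℕ → G := fun m => Nat.rec 1 (fun i y => y * g i) m
  let B : ℕ → G := fun m => Nat.rec 1 (fun i y => y * (g (-(i + 1 : ℤ)))⁻¹) m
  refine ⟨fun k => if 0 ≤ k then A k.toNat else B (-k).toNat, rfl, fun k => ?_⟩
  by_cases h : 0 ≤ k
  · obtain ⟨m, rfl⟩ := Int.eq_ofNat_of_zero_le h
    simp only [h, if_true, show (0 : ℤ) ≤ (m : ℤ) + 1 by omega]
    rfl
  · obtain ⟨m, rfl⟩ : ∃ m : ℕ, k = -(m + 1 : ℤ) := ⟨(-k - 1).toNat, by omega⟩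
    have h1 : B (-(-(m + 1 : ℤ))).toNat = B m * (g (-(m + 1 : ℤ)))⁻¹ := by
      rw [show (-(-(m + 1 : ℤ))).toNat = m + 1 by omega]
    simp only [h, if_false, h1, inv_mul_cancel_right]
    split_ifs with h2
    · obtain rfl : m = 0 := by omega
      rfl
    · congr 1
      omega

section
variable {α : Type}

/-- The sum of the exponents. -/
def height : FreeGroup α →* Multiplicative ℤ := FreeGroup.lift fun _ => Multiplicative.ofAdd 1

theorem height_of (x : α) : (height (FreeGroup.of x)).toAdd = 1 := by simp [height]

variable [DecidableEq α]

theorem height_mk_le (l : List (α × Bool)) : |(height (FreeGroup.mk l)).toAdd| ≤ l.length := by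
  induction l with
  | nil => simp [← FreeGroup.one_eq_mk]
  | cons c l ih =>
    obtain ⟨x, b⟩ := c
    rw [← List.singleton_append, ← FreeGroup.mul_mk, map_mul, toAdd_mul]
    have h : |(height (FreeGroup.mk [(x, b)])).toAdd| ≤ 1 := by
      cases b <;> simp [height]
    refine (abs_add_le _ _).trans ?_
    simp only [List.length_append, List.length_singleton]
    push_cast
    omega

theorem height_le (x y : FreeGroup α) : |(height y).toAdd - (height x).toAdd| ≤ wd x y := by
  have h := height_mk_le (x⁻¹ * y).toWord
  rw [FreeGroup.mk_toWord, map_mul, map_inv, toAdd_mul, toAdd_inv] at h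
  rw [wd, FreeGroup.norm]
  refine le_trans (le_of_eq ?_) h
  congr 1
  ring

theorem wd_par (x y z : FreeGroup α) : 2 ∣ wd x y + wd y z + wd x z := by
  simp only [wd_eq]
  omega

theorem freeGroup_sq {g : FreeGroup α} (h : g ^ 2 = 1) : g = 1 :=
  (pow_eq_one_iff_left two_ne_zero).1 h

theorem wd_ax {g : FreeGroup α} (hg : g ≠ 1) : ∃ x, Ax wd 0 g x := by
  obtain ⟨x, hx⟩ := (wd_HM (α := α)).exists_min g
  exact ⟨x, wd_HM.ax_of_min wd_par (fun _ => freeGroup_sq) hg hx⟩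

end

/-- The lines spelled by a family of words. -/
structure Spell {α T : Type} (a : T → ℤ → α) (P : T → ℤ → FreeGroup α) (len L : ℤ) : Prop where
  words : Words a len L
  len_pos : 0 < len
  zero : ∀ t, P t 0 = 1
  succ : ∀ t k, P t (k + 1) = P t k * FreeGroup.of (a t k)

namespace Spell
variable {α T : Type} [DecidableEq α] {a : T → ℤ → α} {P : T → ℤ → FreeGroup α} {len L : ℤ}
  (S : Spell a P len L)
include S

theorem add_len (t : T) (k : ℤ) : P t (k + len) = P t len * P t k := by
  induction k using Int.induction_on with
  | zero => rw [zero_add, S.zero, mul_one]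
  | succ k ih =>
    rw [add_right_comm, S.succ, ih, S.succ, S.words.per, mul_assoc]
  | pred k ih =>
    have h1 := S.succ t (-(k : ℤ) - 1)
    have h2 := S.succ t (-(k : ℤ) - 1 + len)
    rw [sub_add_cancel] at h1
    rw [show -(k : ℤ) - 1 + len + 1 = -k + len by ring, ih, h1, S.words.per, ← mul_assoc] at h2
    exact (mul_right_cancel h2).symm

theorem add_mul_len (t : T) (k m : ℤ) : P t (k + m * len) = P t len ^ m * P t k := by
  induction m using Int.induction_on with
  | zero => simp
  | succ m ih =>
    rw [show k + (m + 1 : ℤ) * len = k + m * len + len by ring, S.add_len, ih, add_comm (m : ℤ),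
      zpow_add, zpow_one, mul_assoc]
  | pred m ih =>
    have h := S.add_len t (k + (-(m : ℤ) - 1) * len)
    rw [show k + (-(m : ℤ) - 1) * len + len = k + -(m : ℤ) * len by ring, ih] at h
    rw [sub_eq_neg_add, zpow_add, zpow_neg_one, mul_assoc, ← sub_eq_neg_add, h, inv_mul_cancel_left]

theorem height (t : T) (k : ℤ) : (height (P t k)).toAdd = k := by
  induction k using Int.induction_on with
  | zero => rw [S.zero, map_one, toAdd_one]
  | succ k ih => rw [S.succ, map_mul, toAdd_mul, ih, height_of]
  | pred k ih =>
    have h1 := S.succ t (-(k : ℤ) - 1)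
    rw [sub_add_cancel] at h1
    rw [h1, map_mul, toAdd_mul, height_of] at ih
    omega

theorem wd_le (t : T) (k : ℤ) (n : ℕ) : wd (P t k) (P t (k + n)) ≤ n := by
  induction n with
  | zero => simp [wd]
  | succ n ih =>
    have h := wd_HM.tri (P t k) (P t (k + n)) (P t (k + n + 1))
    have h1 : wd (P t (k + n)) (P t (k + n + 1)) = 1 := by
      rw [wd, S.succ, inv_mul_cancel_left, FreeGroup.norm_of]; rfl
    push_cast
    rw [← add_assoc]
    omega

theorem dist (h : FreeGroup α) (t : T) (k l : ℤ) : wd (h * P t k) (h * P t l) = max (k - l) (l - k) := by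
  rw [wd_HM.inv]
  wlog hkl : k ≤ l generalizing k l
  · rw [wd_HM.symm, this l k (by omega), max_comm]
  refine le_antisymm ?_ ?_
  · have h1 := S.wd_le t k (l - k).toNat
    rw [Int.toNat_of_nonneg (by omega), add_sub_cancel] at h1
    exact h1.trans (le_max_right _ _)
  · have h1 := height_le (P t k) (P t l)
    rw [S.height, S.height, abs_sub_comm] at h1
    exact (max_le (le_abs_self _) (by rw [abs_sub_comm]; exact le_abs_self _)).trans h1

/-- Two lines sharing a long segment coincide. -/
theorem eq_of_overlap {h h' : FreeGroup α} {t s : T} {k l : ℤ} {n : ℤ} (hn : L < n)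
    (h1 : h * P t k = h' * P s l) (h2 : h * P t (k + n) = h' * P s (l + n)) :
    t = s ∧ ∃ m : ℤ, h = h' * P t len ^ m := by
  have key : ∀ i, 0 ≤ i → i ≤ n → h * P t (k + i) = h' * P s (l + i) := fun i h0 hi => by
    have e1 := S.dist h t k (k + i)
    have e2 := S.dist h t (k + i) (k + n)
    have e3 := S.dist h t k (k + n)
    have e4 := S.dist h' s l (l + i)
    have e5 := S.dist h' s (l + i) (l + n)
    have e6 := S.dist h' s l (l + n)
    rw [← h1] at e4 e6
    rw [← h2] at e5 e6
    refine wd_HM.geodesic_unique (x := h * P t k) (y := h * P t (k + n)) ?_ ?_ ?_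
    · rw [Bt, e1, e2, e3]; omega
    · rw [Bt, e4, e5, e6]; omega
    · omega
  obtain ⟨rfl, m, hm⟩ := S.words.uniq t s k l fun i h0 hi => by
    have e1 := key i h0 (by omega)
    have e2 := key (i + 1) (by omega) (by omega)
    rw [← add_assoc, ← add_assoc, S.succ, S.succ, ← mul_assoc, ← mul_assoc, e1] at e2
    exact FreeGroup.of_injective (mul_left_cancel e2)
  refine ⟨rfl, -m, ?_⟩
  obtain rfl : k = l + m * len := by rw [mul_comm, ← hm]; ring
  rw [S.add_mul_len, ← mul_assoc] at h1
  rw [zpow_neg, ← mul_right_cancel h1, mul_inv_cancel_right]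

/-- A point near the long segment with ends near a line is on this line. -/
theorem mem_of_near {h h' : FreeGroup α} {t s : T} {k n l l' i B : ℤ} 
    (h1 : wd (h * P t k) (h' * P s l) ≤ B) (h2 : wd (h * P t (k + n)) (h' * P s l') ≤ B)
    (hi : B < i) (hn : i < n - B) : ∃ j, h * P t (k + i) = h' * P s j := by
  have hB := wd_HM.nn (h * P t k) (h' * P s l)
  have e1 := S.dist h t k (k + i)
  have e2 := S.dist h t (k + i) (k + n)
  have e3 := S.dist h t k (k + n)
  have m1 : Mid wd 0 (B + 1) (h * P t k) (h * P t (k + i)) (h * P t (k + n)) :=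
    ⟨by rw [Bt, e1, e2, e3]; omega, by omega, by omega⟩
  have m2 := (wd_HM.mid_base m1 h1 h2 (by omega)).bt
  have e4 := S.dist h' s l l'
  set z := h * P t (k + i)
  have n1 := wd_HM.nn (h' * P s l) z
  have n2 := wd_HM.nn z (h' * P s l')
  rw [Bt] at m2
  obtain ⟨j, hj⟩ : ∃ j, max (l - j) (j - l) = wd (h' * P s l) z ∧ max (l - j) (j - l) + max (j - l') (l' - j) = max (l - l') (l' - l) := by
    rcases le_total l l' with hl | hl
    · exact ⟨l + wd (h' * P s l) z, by omega, by omega⟩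
    · exact ⟨l - wd (h' * P s l) z, by omega, by omega⟩
  have e5 := S.dist h' s l j
  have e6 := S.dist h' s j l'
  refine ⟨j, wd_HM.geodesic_unique (x := h' * P s l) (y := h' * P s l') ?_ ?_ ?_⟩
  · rw [Bt]; omega
  · rw [Bt]; omega
  · omega

theorem eq_of_near {h h' : FreeGroup α} {t s : T} {k k' l l' B : ℤ} (hL : 0 ≤ L)
    (h1 : wd (h * P t k) (h' * P s l) ≤ B) (h2 : wd (h * P t k') (h' * P s l') ≤ B)
    (hk : L + 2 * B + 2 < max (k - k') (k' - k)) : t = s ∧ ∃ m : ℤ, h = h' * P t len ^ m := by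
  wlog hkk : k ≤ k' generalizing k k' l l'
  · exact this h2 h1 (by omega) (by omega)
  obtain ⟨n, rfl⟩ : ∃ n, k' = k + n := ⟨k' - k, by ring⟩
  have hB := wd_HM.nn (h * P t k) (h' * P s l)
  obtain ⟨j, hj⟩ := S.mem_of_near h1 h2 (i := B + 1) (by omega) (by omega)
  obtain ⟨j', hj'⟩ := S.mem_of_near h1 h2 (i := B + 1 + (L + 1)) (by omega) (by omega)
  have e1 := congrArg (fun g => (PG.height g).toAdd) hj
  have e2 := congrArg (fun g => (PG.height g).toAdd) hj'
  simp only [map_mul, toAdd_mul, S.height] at e1 e2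
  refine S.eq_of_overlap (k := k + (B + 1)) (l := j) (n := L + 1) (by omega) hj ?_
  rw [add_assoc, hj', show j' = j + (L + 1) by omega]

theorem ne_one (t : T) : P t len ≠ 1 := fun h => by
  have h1 := S.height t len
  rw [h, map_one, toAdd_one] at h1
  have := S.len_pos
  omega

theorem conj_ne_one (h : FreeGroup α) (t : T) : h * P t len * h⁻¹ ≠ 1 := fun h1 =>
  S.ne_one t (conj_eq_one_iff.1 h1)

theorem conj_zpow_mul (h : FreeGroup α) (t : T) (k m : ℤ) :
    (h * P t len * h⁻¹) ^ m * (h * P t k) = h * P t (k + m * len) := by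
  rw [S.add_mul_len, conj_zpow]
  group

theorem near_axis {h p : FreeGroup α} {t : T} (hp : p ∈ axis wd (h * P t len * h⁻¹)) :
    ∃ k, wd p (h * P t k) ≤ 400 := by
  set e := h * P t len * h⁻¹ with he
  set B := wd p (h * P t 0) with hB
  have hB0 := wd_HM.nn p (h * P t 0)
  obtain ⟨K, hK⟩ : ∃ K : ℕ, B + 201 ≤ K := ⟨_, Int.self_le_toNat _⟩
  have h1 := wd_HM.mid_pow (fun g => wd_ax) (S.conj_ne_one h t) hp K
  have e1 := S.conj_zpow_mul h t 0 K
  have e2 := S.conj_zpow_mul h t 0 (-K)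
  rw [zpow_natCast] at e1
  rw [zpow_neg, zpow_natCast] at e2
  have h2 := wd_HM.mid_base h1 (p' := (e ^ K)⁻¹ * (h * P t 0)) (q' := e ^ K * (h * P t 0)) (B := B)
    (by rw [wd_HM.inv]) (by rw [wd_HM.inv]) (by omega)
  rw [e1, e2] at h2
  obtain ⟨z, hz, hpz⟩ := wd_HM.exact_near h2.bt
  set l := 0 + -(K : ℤ) * len
  set l' := 0 + (K : ℤ) * len
  have hl : l ≤ l' := by
    have := S.len_pos
    have : 0 ≤ (K : ℤ) * len := by positivity
    simp only [l, l']
    linarith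
  have n1 := wd_HM.nn (h * P t l) z
  have n2 := wd_HM.nn z (h * P t l')
  have e4 := S.dist h t l l'
  rw [Bt] at hz
  refine ⟨l + wd (h * P t l) z, ?_⟩
  have e5 := S.dist h t l (l + wd (h * P t l) z)
  have e6 := S.dist h t (l + wd (h * P t l) z) l'
  have e7 := wd_HM.geodesic_unique (x := h * P t l) (y := h * P t l') (z := z)
    (z' := h * P t (l + wd (h * P t l) z)) (by rw [Bt]; omega) (by rw [Bt]; omega) (by omega)
  rw [← e7]
  omega

theorem eq_zpow_of_commute (hL : 0 ≤ L) {h g : FreeGroup α} {t : T}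
    (hg : g * (h * P t len * h⁻¹) = h * P t len * h⁻¹ * g) :
    ∃ m : ℤ, g = (h * P t len * h⁻¹) ^ m := by
  set B := wd (h * P t 0) (g * h * P t 0) with hB
  have hB0 := wd_HM.nn (h * P t 0) (g * h * P t 0)
  set m := L + 2 * B + 3 with hm
  have h1 : wd (h * P t (0 + m * len)) (g * h * P t (0 + m * len)) ≤ B := by
    have h2 : Commute g ((h * P t len * h⁻¹) ^ m) := Commute.zpow_right hg m
    rw [mul_assoc g, ← S.conj_zpow_mul, ← mul_assoc g, h2.eq, mul_assoc (_ ^ _) g, wd_HM.inv, hB, mul_assoc]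
  obtain ⟨-, j, hj⟩ := S.eq_of_near hL (k := 0) (l := 0) hB.ge h1 (by
    have := S.len_pos
    refine lt_max_of_lt_right ?_
    nlinarith)
  refine ⟨-j, ?_⟩
  rw [conj_zpow, zpow_neg]
  nth_rw 1 [hj]
  group

end Spell
end PG

namespace PG

namespace Spell
variable {α T : Type} [DecidableEq α] {a : T → ℤ → α} {P : T → ℤ → FreeGroup α} {len L : ℤ}
  (S : Spell a P len L)

variable (P len) in
/-- The conjugates of the periods of some of the words. -/
def periods (U : Set T) : Set (FreeGroup α) := {e | ∃ h, ∃ t ∈ U, e = h * P t len * h⁻¹}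

include S

theorem conj_eq {h h' : FreeGroup α} {t : T} {m : ℤ} (hm : h = h' * P t len ^ m) :
    h * P t len * h⁻¹ = h' * P t len * h'⁻¹ := by
  rw [hm]
  group

theorem lines {U : Set T} {n : ℕ} {N0 : ℤ} (hN0 : N0 ≤ len) (hL : 0 ≤ L)
    (hL' : L ≤ 5000000000000) :
    Lines wd n (periods P len U) (fun _ => 1) N0 10000000000000 where
  hm := wd_HM.mono (by norm_num)
  conj := by
    rintro g _ ⟨h, t, ht, rfl⟩
    exact ⟨g * h, t, ht, by group⟩
  ν_conj _ _ _ := rfl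
  ν_dvd _ _ := one_dvd n
  pow_ne := by
    rintro _ ⟨h, t, ht, rfl⟩
    rw [pow_one]
    exact S.conj_ne_one h t
  far := by
    rintro _ ⟨h, t, ht, rfl⟩
    refine ⟨1, fun x j => ?_⟩
    rw [one_mul]
    exact wd_HM.le_disp_pow (fun _ => wd_ax) (S.conj_ne_one h t) x j
  abel := by
    rintro _ ⟨h, t, ht, rfl⟩ g g' hg hg'
    exact wd_HM.centralizer_abel (fun _ => wd_ax) (S.conj_ne_one h t) hg hg'
  ne := by
    rintro _ ⟨h, t, ht, rfl⟩
    obtain ⟨z, hz⟩ := wd_ax (S.conj_ne_one h t)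
    exact ⟨z, fun j k => (hz.sup j k).trans (by omega)⟩
  mid := by
    rintro _ ⟨h, t, ht, rfl⟩ p hp
    exact ⟨_, fun K z hz => wd_HM.mid_axis (fun _ => wd_ax) (S.conj_ne_one h t) K z hz⟩
  spin := by
    rintro _ ⟨h, t, ht, rfl⟩ g hg h1 y hy
    refine hN0.trans ?_
    simp only [pow_one] at h1 ⊢
    obtain ⟨m, rfl⟩ := S.eq_zpow_of_commute hL hg
    have hm : m ≠ 0 := by
      rintro rfl
      exact h1 (zpow_zero _)
    refine le_trans ?_ (height_le _ _)
    have h2 : (PG.height ((h * P t len * h⁻¹) ^ m * y)).toAdd - (PG.height y).toAdd = m * len := by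
      simp only [map_mul, map_zpow, map_inv, toAdd_mul, toAdd_zpow, toAdd_inv, S.height]
      rw [smul_eq_mul]
      ring
    rw [h2, abs_mul, abs_of_pos S.len_pos]
    have := Int.one_le_abs hm
    have := S.len_pos
    nlinarith
  ov := by
    rintro _ ⟨h, t, ht, rfl⟩ _ ⟨h', t', ht', rfl⟩ hne p hp q hq p' hp' q' hq' h1 h2
    obtain ⟨k, hk⟩ := S.near_axis hp
    obtain ⟨k', hk'⟩ := S.near_axis hq
    obtain ⟨l, hl⟩ := S.near_axis hp'
    obtain ⟨l', hl'⟩ := S.near_axis hq'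
    by_contra hlt
    have e1 := wd_HM.tri p (h * P t k) q
    have e2 := wd_HM.tri (h * P t k) (h * P t k') q
    have e3 := wd_HM.symm q (h * P t k')
    have e4 := S.dist h t k k'
    have e5 := wd_HM.tri (h * P t k) p (h' * P t' l)
    have e6 := wd_HM.tri p p' (h' * P t' l)
    have e7 := wd_HM.symm p (h * P t k)
    have e8 := wd_HM.tri (h * P t k') q (h' * P t' l')
    have e9 := wd_HM.tri q q' (h' * P t' l')
    obtain ⟨rfl, m, hm⟩ := S.eq_of_near hL (B := 5300) (h := h) (h' := h') (t := t) (s := t')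
      (k := k) (k' := k') (l := l) (l' := l') (by omega) (by omega) (by omega)
    exact hne (S.conj_eq hm)

theorem famX {U : Set T} {n : ℕ} (hL : 0 ≤ L) (hL' : L ≤ 5000000000000)
    (hlen : 10 ^ 24 ≤ len) :
    @FamX (FreeGroup α) (periods P len U) _
      (conjAct (S.lines (U := U) (n := n) hlen hL hL').conj) wd
      (fun e => axis wd e.1) (fun e => rotG (fun _ => 1) e.1) (fun e => lenR wd (fun _ => 1) e.1)
      (fun e y y' => bus wd e.1 y y') n 10000000000000 (10 ^ 24) 3 727768 := by
  refine (S.lines (U := U) (n := n) hlen hL hL').famX (by norm_num) le_rfl (by norm_num)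
    (by norm_num) (by norm_num) (fun g x hx => ?_)
    (fun u p q D hu hD hp hq => .inl fun z hz h1 h2 => ?_)
    fun u v p q z D hD hp hq hp' hq' hz h1 h2 => ?_
  · by_cases hg : g = 1
    · exact .inl (by rw [hg, one_pow])
    · exact .inr (.inr ((wd_HM.ax_of_min wd_par (fun _ => freeGroup_sq) hg hx).mono (by norm_num)))
  · exact (wd_HM.ax_of_mid ⟨hp, hq⟩ hu ⟨hz, h1, h2⟩ (by omega)).mono (by norm_num)
  · exact wd_HM.comm_of_mid ⟨hp, hq⟩ ⟨hp', hq'⟩ ⟨hz, h1, h2⟩ (by omega)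

theorem rotG_le {U : Set T} (hL : 0 ≤ L) {N : Subgroup (FreeGroup α)} (hN : N.Normal)
    (h : ∀ t ∈ U, P t len ∈ N) (e : periods P len U) : rotG (fun _ => 1) e.1 ≤ N := by
  obtain ⟨_, g, t, ht, rfl⟩ := e
  refine (Subgroup.closure_le _).2 ?_
  rintro _ ⟨u, hu, rfl⟩
  obtain ⟨m, rfl⟩ := S.eq_zpow_of_commute hL hu
  rw [pow_one]
  exact N.zpow_mem (hN.conj_mem _ (h t ht) g) m

theorem near_path {t : T} {z : FreeGroup α} {e : ℤ} (hz : Bt wd e 1 z (P t len)) :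
    ∃ k, wd z (P t k) ≤ 2 * e := by
  obtain ⟨z', h1, h2⟩ := wd_HM.exact_near hz
  have n1 := wd_HM.nn 1 z'
  have n2 := wd_HM.nn z' (P t len)
  have hl := S.len_pos
  have e4 := S.dist 1 t 0 len
  have e5 := S.dist 1 t 0 (wd 1 z')
  have e6 := S.dist 1 t (wd 1 z') len
  simp only [one_mul, S.zero] at e4 e5 e6
  rw [Bt] at h1
  have e7 := wd_HM.geodesic_unique (x := 1) (y := P t len) (z := z') (z' := P t (wd 1 z'))
    (by rw [Bt]; omega) (by rw [Bt]; omega) (by omega)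
  exact ⟨wd 1 z', by rw [← e7]; omega⟩

/-- A period far along the axis of another period is that period. -/
theorem mem_of_far {U : Set T} (hL : 0 ≤ L) (hL' : L ≤ 5000000000000) {t : T}
    (e : periods P len U) {p q : FreeGroup α} (hp : Gate wd 2200 (axis wd e.1) 1 p)
    (hq : Gate wd 2200 (axis wd e.1) (P t len) q) (hpq : 10000000000000 < wd p q) : t ∈ U := by
  obtain ⟨_, h, s, hs, rfl⟩ := e
  obtain ⟨k, hk⟩ := S.near_path (wd_HM.gate_cross_left hp hq (by omega))
  obtain ⟨l, hl⟩ := S.near_path (wd_HM.gate_cross_right hp hq (by omega))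
  obtain ⟨k', hk'⟩ := S.near_axis hp.1
  obtain ⟨l', hl'⟩ := S.near_axis hq.1
  have e1 := wd_HM.tri (P t k) p (h * P s k')
  have e2 := wd_HM.tri (P t l) q (h * P s l')
  have e3 := wd_HM.symm p (P t k)
  have e4 := wd_HM.symm q (P t l)
  have e5 := wd_HM.tri p (P t k) q
  have e6 := wd_HM.tri (P t k) (P t l) q
  have e7 := S.dist 1 t k l
  simp only [one_mul] at e7
  obtain ⟨rfl, -⟩ := S.eq_of_near hL (B := 9200) (h := 1) (h' := h) (t := t) (s := s)
    (k := k) (k' := l) (l := k') (l' := l') (by rw [one_mul]; omega) (by rw [one_mul]; omega)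
    (by omega)
  exact hs

/-- The `n`-periodic quotient by some of the periods in which the other periods survive. -/
theorem exists_periodic_quotient (U : Set T) {n : ℕ} (hn : Odd n) (hn' : 2 * 10 ^ 41 ≤ n)
    (hL : 0 ≤ L) (hL' : L ≤ 5000000000000) (hlen : 10 ^ 24 ≤ len)
    (hlen' : len ≤ 10 ^ 25) :
    ∃ K : Subgroup (FreeGroup α), K.Normal ∧ (∀ g, g ^ n ∈ K) ∧ (∀ t, P t len ∈ K ↔ t ∈ U) ∧
      ∀ N : Subgroup (FreeGroup α), N.Normal → (∀ g, g ^ n ∈ N) → (∀ t ∈ U, P t len ∈ N) →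
        K ≤ N := by
  have Ls := S.lines (U := U) (n := n) hlen hL hL'
  let _ := conjAct Ls.conj
  have F := S.famX (U := U) (n := n) hL hL' hlen
  have hF := F.normal
  have hπ := isQuo_mk hF
  obtain ⟨K, hK, h1, h2, h3⟩ := (F.stage hπ hn).limit hn'
  refine ⟨K.comap (QuotientGroup.mk' _), hK.comap _, fun g => ?_, fun t => ⟨fun ht => ?_, fun ht => ?_⟩,
    fun N hN hN1 hN2 => ?_⟩
  · rw [Subgroup.mem_comap, map_pow]
    exact h1 _
  · by_contra htU
    refine h2 _ (fun h4 => ?_) ?_ ht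
    · have h5 : P t len ∈ ⨆ e : periods P len U, rotG (fun _ => 1) e.1 := by
        rwa [← MonoidHom.mem_ker, QuotientGroup.ker_mk'] at h4
      have h7 := F.good 1 (P t len) h5
      generalize hw : P t len = w at h7
      cases h7 with
      | one => exact S.ne_one t hw
      | step k g e hg hD hk =>
        have h6 := F.N_ge e
        rw [mul_one, ← hw] at hD
        refine htU (S.mem_of_far hL hL' e (F.pr_gate e 1) (F.pr_gate e (P t len)) ?_)
        change _ ≤ wd (F.pr e 1) (F.pr e (P t len)) at hD
        linarith
    · have e1 := F.cone_le (M := 1000000000000000) (by norm_num) 1 (P t len)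
      have e2 := F.quo_le (M := 1000000000000000) (by norm_num) hπ 1 (P t len)
      have e3 : quoD (QuotientGroup.mk' _) wd _ 1000000000000000 1 (QuotientGroup.mk' _ (P t len)) ≤ _ := e2
      have e4 := S.dist 1 t 0 len
      simp only [one_mul, S.zero] at e4
      have e5 := S.len_pos
      rw [max_eq_right (by omega)] at e4
      linarith
  · refine Subgroup.ker_le_comap _ _ ?_
    · rw [QuotientGroup.ker_mk']
      exact Subgroup.mem_iSup_of_mem (⟨P t len, 1, t, ht, by group⟩ : periods P len U)
        (Subgroup.subset_closure ⟨P t len, rfl, pow_one _⟩)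
  · have hK1 : (⨆ e : periods P len U, rotG (fun _ => 1) e.1) ≤ N :=
      iSup_le (S.rotG_le hL hN hN2)
    have h4 : K ≤ N.map (QuotientGroup.mk' (⨆ e : periods P len U, rotG (fun _ => 1) e.1)) := by
      refine h3 _ fun g => ?_
      obtain ⟨g, rfl⟩ := QuotientGroup.mk'_surjective _ g
      exact ⟨g ^ n, hN1 g, map_pow _ _ _⟩
    refine (Subgroup.comap_mono h4).trans ?_
    rw [Subgroup.comap_map_eq, QuotientGroup.ker_mk', sup_of_le_left hK1]

end Spell
end PG

namespace PG

section Ltr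
variable {α : Type} {Q : ℤ} {x : α} {b : ℕ → α}

theorem ltr_zero (j : ℕ) : ltr Q x b j 0 = b (j + 1) := by
  simp [ltr, blk]

theorem ltr_mem (hQ : 0 < Q) (j : ℕ) {k : ℤ} (h0 : 0 < k) (h1 : k < 2 * Q * Q) :
    ltr Q x b j k = x ∨ ltr Q x b j k = b j := by
  obtain ⟨u, r, rfl, hr, hr'⟩ := ltr_decomp hQ k
  rw [ltr_eq j u hr hr', blk]
  have h : ¬(r = 0 ∧ u % Q = 0) := by
    rintro ⟨rfl, hu⟩
    have hu1 : 0 < u := by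
      by_contra hu1
      nlinarith
    have hu2 : u < Q := by
      by_contra hu2
      nlinarith
    rw [Int.emod_eq_of_lt hu1.le hu2] at hu
    omega
  rw [if_neg h]
  split_ifs
  · exact .inr rfl
  · exact .inl rfl

end Ltr

/-- The product of the first values of a function. -/
def lprod {G : Type} [Monoid G] (g : ℕ → G) (m : ℕ) : G := ((List.range m).map g).prod

theorem map_lprod {G H : Type} [Monoid G] [Monoid H] (f : G →* H) (g : ℕ → G) (m : ℕ) :
    f (lprod g m) = lprod (fun k => f (g k)) m := by
  simp [lprod, map_list_prod, Function.comp_def]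

theorem lprod_succ {G : Type} [Monoid G] (g : ℕ → G) (m : ℕ) :
    lprod g (m + 1) = lprod g m * g m := by
  simp [lprod, List.range_succ]

theorem lprod_succ' {G : Type} [Monoid G] (g : ℕ → G) (m : ℕ) :
    lprod g (m + 1) = g 0 * lprod (fun k => g (k + 1)) m := by
  simp [lprod, List.range_succ_eq_map, Function.comp_def]

theorem lprod_congr {G : Type} [Monoid G] {g g' : ℕ → G} {m : ℕ} (h : ∀ k < m, g k = g' k) :
    lprod g m = lprod g' m :=
  congrArg List.prod (List.map_congr_left fun k hk => h k (List.mem_range.1 hk))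

theorem lprod_reflect {G : Type} [CommMonoid G] (g : ℕ → G) (m : ℕ) :
    lprod (fun k => g (m - 1 - k)) m = lprod g m := by
  have h : ∀ g : ℕ → G, lprod g m = ∏ k ∈ Finset.range m, g k := fun g => by
    induction m with
    | zero => simp [lprod]
    | succ m ih => rw [lprod_succ, ih, Finset.prod_range_succ]
  rw [h, h, Finset.prod_range_reflect]

section Retract
variable {β : Type} (u v : β)

/-- The letters `b j`. -/
def bseq : ℕ → β ⊕ ℕ
  | 0 => .inl v
  | j + 1 => .inr j

theorem bseq_ne (huv : u ≠ v) (j : ℕ) : (.inl u : β ⊕ ℕ) ≠ bseq v j := by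
  cases j with
  | zero => simpa [bseq] using huv
  | succ j => simp [bseq]

theorem bseq_injective : Function.Injective (bseq v) := by
  intro i j h
  cases i <;> cases j <;> simp_all [bseq]

/-- Substitution of two elements into a word. -/
def subst {G : Type} [Group G] (x y : G) : FreeGroup Bool →* G :=
  FreeGroup.lift fun c => if c then x else y

theorem map_subst {G H : Type} [Group G] [Group H] (f : G →* H) (x y : G) (w : FreeGroup Bool) :
    f (subst x y w) = subst (f x) (f y) w := by
  have h : f.comp (subst x y) = subst (f x) (f y) := by
    ext c
    cases c <;> simp [subst]
  exact DFunLike.congr_fun h w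

/-- The values of the letters `b j` under a retraction that kills `b (j + 1) * W j (x, b j)`. -/
def bval (W : ℕ → FreeGroup Bool) : ℕ → FreeGroup β
  | 0 => .of v
  | j + 1 => (subst (.of u) (bval W j) (W j))⁻¹

theorem exists_retract (W : ℕ → FreeGroup Bool) :
    ∃ σ : FreeGroup (β ⊕ ℕ) →* FreeGroup β,
      (∀ g, σ (FreeGroup.map Sum.inl g) = g) ∧
      (∀ j, σ (.of (bseq v (j + 1)) * subst (.of (.inl u)) (.of (bseq v j)) (W j)) = 1) ∧
      ∀ (H : Type) [Group H] (π : FreeGroup (β ⊕ ℕ) →* H),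
        (∀ j, π (.of (bseq v (j + 1)) * subst (.of (.inl u)) (.of (bseq v j)) (W j)) = 1) →
          ∀ g, π (FreeGroup.map Sum.inl (σ g)) = π g := by
  set σ : FreeGroup (β ⊕ ℕ) →* FreeGroup β :=
    FreeGroup.lift (Sum.elim .of fun j => bval u v W (j + 1)) with hσ
  have h1 : ∀ i, σ (.of (.inl i)) = .of i := fun i => by simp [hσ]
  have h2 : ∀ j, σ (.of (bseq v j)) = bval u v W j := fun j => by
    cases j <;> simp [hσ, bseq, bval]
  refine ⟨σ, fun g => ?_, fun j => ?_, fun H _ π hπ g => ?_⟩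
  · have h3 : σ.comp (FreeGroup.map Sum.inl) = MonoidHom.id _ := by
      ext i
      simp [h1]
    exact DFunLike.congr_fun h3 g
  · rw [map_mul, map_subst, h1, h2, h2, bval, inv_mul_cancel]
  · have h4 : ∀ j, π (FreeGroup.map Sum.inl (σ (.of (bseq v j)))) = π (.of (bseq v j)) := by
      intro j
      induction j with
      | zero => rw [h2]; simp [bval, bseq]
      | succ j ih =>
        have h5 := hπ j
        rw [map_mul, map_subst] at h5
        rw [h2] at ih ⊢
        rw [bval, map_inv, map_inv, map_subst, map_subst, ih, FreeGroup.map.of, eq_comm]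
        exact eq_inv_of_mul_eq_one_left h5
    have h3 : (π.comp (FreeGroup.map Sum.inl)).comp σ = π := by
      ext i
      cases i with
      | inl i => simp [h1]
      | inr j => exact h4 (j + 1)
    exact DFunLike.congr_fun h3 g

end Retract

section Family
variable {α : Type} {Q : ℤ} {x : α} {b : ℕ → α} {P : ℕ × Bool → ℤ → FreeGroup α}

theorem path_eq_lprod {a : ℤ → α} {p : ℤ → FreeGroup α} (h0 : p 0 = 1)
    (h1 : ∀ k, p (k + 1) = p k * .of (a k)) (m : ℕ) :
    p m = lprod (fun k => .of (a k)) m := by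
  induction m with
  | zero => simpa [lprod] using h0
  | succ m ih => rw [lprod_succ, ← ih, ← h1, Nat.cast_succ]

/-- The words of `ltr` in two letters. -/
noncomputable def ltrWord (Q : ℤ) (x : α) (b : ℕ → α) (l j : ℕ) : FreeGroup Bool :=
  open Classical in lprod (fun k => .of (decide (ltr Q x b j (k + 1) = x))) l

theorem subst_ltrWord (hQ : 0 < Q) {l : ℕ} (hl : (l : ℤ) + 1 = 2 * Q * Q) (j : ℕ) :
    subst (.of x) (.of (b j)) (ltrWord Q x b l j) =
      lprod (fun k => FreeGroup.of (ltr Q x b j (k + 1))) l := by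
  rw [ltrWord, map_lprod]
  refine lprod_congr fun k hk => ?_
  rcases ltr_mem (x := x) (b := b) hQ j (k := k + 1) (by omega) (by omega) with h | h
  · simp [subst, h]
  · by_cases h' : b j = x <;> simp [subst, h, h']

theorem path_false (hQ : 0 < Q) {l : ℕ} (hl : (l : ℤ) + 1 = 2 * Q * Q)
    (S : Spell (ltr₂ Q x b) P (2 * Q * Q) (4 * Q)) (j : ℕ) :
    P (j, false) (2 * Q * Q) = .of (b (j + 1)) * subst (.of x) (.of (b j)) (ltrWord Q x b l j) := by
  have h := path_eq_lprod (S.zero (j, false)) (S.succ (j, false)) (l + 1)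
  rw [subst_ltrWord hQ hl, ← hl]
  rw [lprod_succ'] at h
  simpa [ltr₂, ltr_zero] using h

theorem path_true {l : ℕ} (hl : (l : ℤ) + 1 = 2 * Q * Q)
    (S : Spell (ltr₂ Q x b) P (2 * Q * Q) (4 * Q)) (j : ℕ) {A : Type} [CommGroup A]
    (f : FreeGroup α →* A) : f (P (j, true) (2 * Q * Q)) = f (P (j, false) (2 * Q * Q)) := by
  have h := fun s => path_eq_lprod (S.zero (j, s)) (S.succ (j, s)) (l + 1)
  simp only [lprod_succ', Nat.cast_add, Nat.cast_one, hl] at h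
  rw [h, h, map_mul, map_mul, map_lprod, map_lprod, ← lprod_reflect]
  congr 1
  refine lprod_congr fun k hk => ?_
  have h2 := S.words.per (j, false) (-((l - 1 - k : ℕ) + 1 : ℤ))
  have h3 : -((l - 1 - k : ℕ) + 1 : ℤ) + 2 * Q * Q = k + 1 := by omega
  rw [h3] at h2
  simp only [ltr₂, if_true] at h2 ⊢
  simp_all

theorem exists_subgroups {β : Type} [DecidableEq β] {u v : β} (huv : u ≠ v) {n : ℕ} (hn : Odd n)
    (hn' : 2 * 10 ^ 41 ≤ n) :
    ∃ N : Set ℕ → Subgroup (FreeGroup β), (∀ S, (N S).Normal) ∧ (∀ S g, g ^ n ∈ N S) ∧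
      Function.Injective N ∧ ∀ S (A : Type) [CommGroup A] (f : FreeGroup β →* A),
        (∀ a : A, a ^ n = 1) → N S ≤ f.ker := by
  obtain ⟨Q, hQ⟩ : ∃ Q : ℤ, Q = 1000000000000 := ⟨_, rfl⟩
  obtain ⟨l, hl⟩ : ∃ l : ℕ, (l : ℤ) + 1 = 2 * Q * Q :=
    ⟨(2 * Q * Q - 1).toNat, by rw [hQ, Int.toNat_of_nonneg] <;> norm_num⟩
  have hQ0 : 0 < Q := by omega
  choose P hP0 hP1 using fun t => exists_line fun k =>
    FreeGroup.of (ltr₂ Q (Sum.inl u) (bseq v) t k)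
  have S : Spell (ltr₂ Q (Sum.inl u) (bseq v)) P (2 * Q * Q) (4 * Q) :=
    ⟨ltr_words (bseq_ne u v huv) (bseq_injective v) (by omega), by positivity, hP0, hP1⟩
  obtain ⟨σ, h1, h2, h3⟩ := exists_retract u v (ltrWord Q (Sum.inl u) (bseq v) l)
  choose K hK using fun X : Set ℕ => S.exists_periodic_quotient {t | t.2 = true → t.1 ∈ X} hn hn'
    (by omega) (by omega) (by rw [hQ]; norm_num) (by rw [hQ]; norm_num)
  have h4 : ∀ X g, FreeGroup.map Sum.inl (σ g) ∈ K X ↔ g ∈ K X := by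
    intro X g
    have := (hK X).1
    rw [← QuotientGroup.eq_one_iff, ← QuotientGroup.eq_one_iff (N := K X) g]
    have h5 := h3 _ (QuotientGroup.mk' (K X)) (fun j => ?_) g
    · exact iff_of_eq (congrArg (· = 1) h5)
    · rw [← path_false hQ0 hl S]
      exact (QuotientGroup.eq_one_iff _).2 (((hK X).2.2.1 _).2 (by simp))
  refine ⟨fun X => (K X).comap (FreeGroup.map Sum.inl), fun X => (hK X).1.comap _, fun X g => ?_,
    fun X Y hXY => ?_, fun X A _ f hf g hg => ?_⟩
  · rw [Subgroup.mem_comap, map_pow]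
    exact (hK X).2.1 _
  · ext j
    have h5 : ∀ X, j ∈ X ↔ σ (P (j, true) (2 * Q * Q)) ∈ (K X).comap (FreeGroup.map Sum.inl) := by
      intro X
      rw [Subgroup.mem_comap, h4, (hK X).2.2.1]
      simp
    rw [h5, h5]
    exact iff_of_eq (congrArg (_ ∈ ·) hXY)
  · have h5 := (hK X).2.2.2 (f.comp σ).ker inferInstance (fun g => ?_) (fun t _ => ?_) hg
    · rwa [MonoidHom.mem_ker, MonoidHom.comp_apply, h1] at h5
    · rw [MonoidHom.mem_ker, map_pow, hf]
    · have h6 : ∀ j, (f.comp σ) (P (j, false) (2 * Q * Q)) = 1 := fun j => by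
        rw [path_false hQ0 hl S, MonoidHom.comp_apply, h2, map_one]
      obtain ⟨j, s⟩ := t
      rw [MonoidHom.mem_ker]
      cases s with
      | false => exact h6 j
      | true => rw [path_true hl S, h6]

end Family

end PG

namespace PG

/-- A quotient of a free group that maps onto `(ℤ/p)^r` has rank `r`. -/
theorem rank_quotient {r p : ℕ} [Fact p.Prime] (N : Subgroup (FreeGroup (Fin r))) [N.Normal]
    (h : ∀ f : FreeGroup (Fin r) →* Multiplicative (Fin r → ZMod p), N ≤ f.ker) :
    (∃ T : Finset (FreeGroup (Fin r) ⧸ N), T.card = r ∧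
      Subgroup.closure (T : Set (FreeGroup (Fin r) ⧸ N)) = ⊤) ∧
    ∀ T : Finset (FreeGroup (Fin r) ⧸ N),
      Subgroup.closure (T : Set (FreeGroup (Fin r) ⧸ N)) = ⊤ → r ≤ T.card := by
  classical
  set f : FreeGroup (Fin r) →* Multiplicative (Fin r → ZMod p) :=
    FreeGroup.lift fun i => .ofAdd (Pi.single i 1) with hf
  set φ := QuotientGroup.lift N f (h f)
  have hφ : ∀ i, (φ (QuotientGroup.mk' N (.of i))).toAdd = Pi.single i 1 := fun i => by
    simp [φ, hf]
  have hlow : ∀ T : Finset (FreeGroup (Fin r) ⧸ N),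
      Subgroup.closure (T : Set (FreeGroup (Fin r) ⧸ N)) = ⊤ → r ≤ T.card := by
    intro T hT
    set B : Finset (Fin r → ZMod p) := T.image fun g => (φ g).toAdd with hB
    have h1 : ∀ g, (φ g).toAdd ∈ Submodule.span (ZMod p) (B : Set (Fin r → ZMod p)) := by
      intro g
      have hg : g ∈ Subgroup.closure (T : Set (FreeGroup (Fin r) ⧸ N)) := hT ▸ Subgroup.mem_top g
      induction hg using Subgroup.closure_induction with
      | mem g hg => exact Submodule.subset_span (by rw [hB]; exact_mod_cast Finset.mem_image_of_mem _ hg)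
      | one => simp
      | mul g g' _ _ hg hg' => rw [map_mul, toAdd_mul]; exact Submodule.add_mem _ hg hg'
      | inv g _ hg => rw [map_inv, toAdd_inv]; exact Submodule.neg_mem _ hg
    have h2 : Submodule.span (ZMod p) (B : Set (Fin r → ZMod p)) = ⊤ := by
      rw [eq_top_iff, ← (Pi.basisFun (ZMod p) (Fin r)).span_eq, Submodule.span_le]
      rintro _ ⟨i, rfl⟩
      rw [Pi.basisFun_apply, ← hφ]
      exact h1 _
    have h3 := finrank_span_finset_le_card (R := ZMod p) B
    rw [Set.finrank, h2, finrank_top, Module.finrank_fin_fun] at h3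
    exact h3.trans Finset.card_image_le
  refine ⟨⟨Finset.univ.image fun i => QuotientGroup.mk' N (.of i), ?_, ?_⟩, hlow⟩
  · rw [Finset.card_image_of_injective, Finset.card_univ, Fintype.card_fin]
    intro i j hij
    have := hφ i
    rw [show QuotientGroup.mk' N (.of i) = QuotientGroup.mk' N (.of j) from hij, hφ j] at this
    by_contra hne
    have h1 := congrFun this i
    simp [hne] at h1
  · have h1 := congrArg (Subgroup.map (QuotientGroup.mk' N)) (FreeGroup.closure_range_of (Fin r))
    rw [MonoidHom.map_closure, ← Set.range_comp,
      Subgroup.map_top_of_surjective _ (QuotientGroup.mk'_surjective N)] at h1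
    rw [← h1, Finset.coe_image, Finset.coe_univ, Set.image_univ]
    rfl

theorem not_countable_set_nat : ¬ Countable (Set ℕ) := fun _ => by
  obtain ⟨f, hf⟩ := exists_surjective_nat (Set ℕ)
  exact Function.cantor_surjective f hf

/-- Countably many normal subgroups have a quotient isomorphic to a given one. -/
theorem countable_quotients {β σ : Type} [Finite β] (N : σ → Subgroup (FreeGroup β))
    [hN : ∀ S, (N S).Normal] (hinj : Function.Injective N) (S : σ) :
    Countable {X : σ // Nonempty (FreeGroup β ⧸ N X ≃* FreeGroup β ⧸ N S)} := by
  have hc : Countable (FreeGroup β) := by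
    have := Finite.to_countable (α := β)
    exact (Quot.mk_surjective (r := FreeGroup.Red.Step)).countable
  have hq : Countable (FreeGroup β ⧸ N S) := (QuotientGroup.mk'_surjective (N S)).countable
  let F : {X : σ // Nonempty (FreeGroup β ⧸ N X ≃* FreeGroup β ⧸ N S)} → β → FreeGroup β ⧸ N S :=
    fun X i => X.2.some (QuotientGroup.mk' _ (.of i))
  refine Function.Injective.countable (f := F) fun X Y h => Subtype.ext (hinj ?_)
  have h1 : X.2.some.toMonoidHom.comp (QuotientGroup.mk' (N X)) =
      Y.2.some.toMonoidHom.comp (QuotientGroup.mk' (N Y)) := by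
    ext i
    exact congrFun h i
  have h2 : ∀ X : {X : σ // Nonempty (FreeGroup β ⧸ N X ≃* FreeGroup β ⧸ N S)},
      (X.2.some.toMonoidHom.comp (QuotientGroup.mk' (N X))).ker = N X := fun X => by
    ext g
    simp
  rw [← h2 X, h1, h2 Y]

end PG

/-- Theorem 1.3, Atabekyan.
For large enough odd `n` and every `r ≥ 2` there are uncountably many pairwise
non-isomorphic `n`-periodic groups of rank exactly `r`. -/
theorem uncountably_many_periodic_groups_of_rank :
    ∃ n₀ : ℕ, ∀ n : ℕ, Odd n → n₀ ≤ n → ∀ r : ℕ, 2 ≤ r →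
    ∃ (ι : Type) (G : ι → GrpB),
      ¬ Countable ι ∧
      (∀ i, ∀ g : (G i).carrier, g ^ n = 1) ∧
      (∀ i, (∃ T : Finset (G i).carrier, T.card = r ∧
          Subgroup.closure (T : Set (G i).carrier) = ⊤) ∧
        ∀ T : Finset (G i).carrier,
          Subgroup.closure (T : Set (G i).carrier) = ⊤ → r ≤ T.card) ∧
      (∀ i j, i ≠ j → IsEmpty ((G i).carrier ≃* (G j).carrier)) := by
  refine ⟨2 * 10 ^ 41, fun n hodd hn r hr => ?_⟩
  obtain ⟨N, hN, hpow, hinj, hker⟩ := PG.exists_subgroups (β := Fin r) (u := ⟨0, by omega⟩)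
    (v := ⟨1, by omega⟩) (by simp) hodd hn
  have : Fact n.minFac.Prime := ⟨Nat.minFac_prime (by omega)⟩
  let s : Setoid (Set ℕ) :=
    { r := fun X Y => Nonempty (FreeGroup (Fin r) ⧸ N X ≃* FreeGroup (Fin r) ⧸ N Y)
      iseqv := ⟨fun _ => ⟨.refl _⟩, fun ⟨e⟩ => ⟨e.symm⟩, fun ⟨e⟩ ⟨e'⟩ => ⟨e.trans e'⟩⟩ }
  refine ⟨Quotient s, fun q => ⟨FreeGroup (Fin r) ⧸ N q.out⟩, fun hc => ?_, fun q g => ?_,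
    fun q => ?_, fun q q' hq => ⟨fun e => hq ?_⟩⟩
  · refine PG.not_countable_set_nat ?_
    have h1 : ∀ q : Quotient s, Countable {X // Quotient.mk s X = q} := fun q => by
      have h2 := PG.countable_quotients N hinj q.out
      refine Function.Injective.countable (f := fun X : {X // Quotient.mk s X = q} =>
        (⟨X.1, Quotient.exact (X.2.trans q.out_eq.symm)⟩ :
          {X // Nonempty (FreeGroup (Fin r) ⧸ N X ≃* FreeGroup (Fin r) ⧸ N q.out)}))
        fun X Y h => Subtype.ext (congrArg (fun Z => Z.1) h)
    exact (Equiv.sigmaFiberEquiv (Quotient.mk s)).surjective.countable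
  · obtain ⟨g, rfl⟩ := QuotientGroup.mk'_surjective _ g
    rw [← map_pow]
    exact (QuotientGroup.eq_one_iff _).2 (hpow _ g)
  · refine PG.rank_quotient (p := n.minFac) (N q.out) fun f => hker _ _ f fun a => ?_
    refine Multiplicative.toAdd.injective (funext fun i => ?_)
    have h1 : ((n : ℕ) : ZMod n.minFac) = 0 := (ZMod.natCast_eq_zero_iff _ _).2 n.minFac_dvd
    rw [toAdd_pow, toAdd_one, Pi.smul_apply, nsmul_eq_mul, h1, zero_mul, Pi.zero_apply]
  · rw [← q.out_eq, ← q'.out_eq]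
    exact Quotient.sound ⟨e⟩
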